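/- Let l ≥ 5 be an odd integer, q ∈ ℂ a primitive l-th root of unity, and n ≥ 3. Let TL_n be the quotient of the level-one cyclotomic Khovanov–Lauda–Rouquier algebra R_n^{(1)} by the two-sided ideal generated by all e(i) with (i_1, i_2, i_3) ≡ (0, 1, 2) (mod l), with its induced ℤ-grading (this quotient is isomorphic to the Temperley–Lieb algebra Tl_n(q)). Then TL_n is a graded cellular algebra with respect to the poset of two-column partitions of n under the dominance order, with index sets T(λ) the standard λ-tableaux: there exist homogeneous elements {ψ_{στ} : λ a two-column partition of n, σ, τ ∈ Std(λ)} forming a graded cellular basis of TL_n with deg ψ_{στ} = deg σ + deg τ for some degree function deg on standard tableaux. -/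

import Mathlib

noncomputable section

namespace Statement2

/-- Residue sequences of length `n` with values in `ℤ/lℤ`. -/
abbrev Res (l n : ℕ) := Fin n → ZMod l

/-- Generators of the Khovanov–Lauda–Rouquier algebra. -/
inductive KLRGen (l n : ℕ) : Type
  | e : Res l n → KLRGen l n
  | y : Fin n → KLRGen l n
  | psi : Fin (n - 1) → KLRGen l n

/-- The generator `e(i)` in the free algebra. -/
def eG (l n : ℕ) (i : Res l n) : FreeAlgebra ℂ (KLRGen l n) :=
  FreeAlgebra.ι ℂ (KLRGen.e i)

/-- The generator `y_r` in the free algebra. -/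
def yG (l n : ℕ) (r : Fin n) : FreeAlgebra ℂ (KLRGen l n) :=
  FreeAlgebra.ι ℂ (KLRGen.y r)

/-- The generator `ψ_r` in the free algebra. -/
def pG (l n : ℕ) (r : Fin (n - 1)) : FreeAlgebra ℂ (KLRGen l n) :=
  FreeAlgebra.ι ℂ (KLRGen.psi r)

/-- The position `r` as an element of `Fin n`. -/
def lo {n : ℕ} (r : Fin (n - 1)) : Fin n := ⟨r.val, by have := r.2; omega⟩

/-- The position `r + 1` as an element of `Fin n`. -/
def hi {n : ℕ} (r : Fin (n - 1)) : Fin n := ⟨r.val + 1, by have := r.2; omega⟩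

/-- The defining relations of the cyclotomic KLR algebra, where `Lam ⊆ ℤ/lℤ` is the set of
residues allowed at the first position (the multiset of cyclotomic parameters). -/
inductive KLRRel (l n : ℕ) [NeZero l] (Lam : Set (ZMod l)) :
    FreeAlgebra ℂ (KLRGen l n) → FreeAlgebra ℂ (KLRGen l n) → Prop
  | cyc1 (i : Res l n) (r : Fin n) (hr : r.val = 0) (h : i r ∉ Lam) :
      KLRRel l n Lam (eG l n i) 0
  | cyc2 (i : Res l n) (r : Fin n) (hr : r.val = 0) (h : i r ∈ Lam) :
      KLRRel l n Lam (yG l n r * eG l n i) 0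
  | orth (i j : Res l n) (h : i ≠ j) : KLRRel l n Lam (eG l n i * eG l n j) 0
  | idem (i : Res l n) : KLRRel l n Lam (eG l n i * eG l n i) (eG l n i)
  | sum1 : KLRRel l n Lam (∑ i : Res l n, eG l n i) 1
  | ye (r : Fin n) (i : Res l n) :
      KLRRel l n Lam (yG l n r * eG l n i) (eG l n i * yG l n r)
  | psie (r : Fin (n - 1)) (i : Res l n) :
      KLRRel l n Lam (pG l n r * eG l n i) (eG l n (i ∘ Equiv.swap (lo r) (hi r)) * pG l n r)
  | yy (r s : Fin n) : KLRRel l n Lam (yG l n r * yG l n s) (yG l n s * yG l n r)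
  | psiy (r : Fin (n - 1)) (s : Fin n) (h1 : s.val ≠ r.val) (h2 : s.val ≠ r.val + 1) :
      KLRRel l n Lam (pG l n r * yG l n s) (yG l n s * pG l n r)
  | pp (r s : Fin (n - 1)) (h : r.val + 1 < s.val ∨ s.val + 1 < r.val) :
      KLRRel l n Lam (pG l n r * pG l n s) (pG l n s * pG l n r)
  | py (r : Fin (n - 1)) (i : Res l n) :
      KLRRel l n Lam (pG l n r * (yG l n (hi r) * eG l n i))
        ((yG l n (lo r) * pG l n r + if i (lo r) = i (hi r) then 1 else 0) * eG l n i)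
  | yp (r : Fin (n - 1)) (i : Res l n) :
      KLRRel l n Lam (yG l n (hi r) * (pG l n r * eG l n i))
        ((pG l n r * yG l n (lo r) + if i (lo r) = i (hi r) then 1 else 0) * eG l n i)
  | psisq (r : Fin (n - 1)) (i : Res l n) :
      KLRRel l n Lam (pG l n r * pG l n r * eG l n i)
        ((if i (hi r) = i (lo r) then 0
          else if i (hi r) = i (lo r) + 1 then yG l n (hi r) - yG l n (lo r)
          else if i (hi r) = i (lo r) - 1 then yG l n (lo r) - yG l n (hi r)
          else 1) * eG l n i)
  | braid (r s : Fin (n - 1)) (h : s.val = r.val + 1) (i : Res l n) :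
      KLRRel l n Lam (pG l n r * pG l n s * pG l n r * eG l n i)
        ((pG l n s * pG l n r * pG l n s +
          (if i (hi s) = i (lo r) ∧ i (lo s) = i (lo r) + 1 then 1
           else if i (hi s) = i (lo r) ∧ i (lo s) = i (lo r) - 1 then -1
           else 0)) * eG l n i)

/-- The cyclotomic KLR algebra with cyclotomic residue set `Lam`. -/
abbrev KLR (l n : ℕ) [NeZero l] (Lam : Set (ZMod l)) := RingQuot (KLRRel l n Lam)

/-- The relation identifying the chosen KLR idempotents `e(i)`, `i ∈ bad`, with `0`;
quotienting by it is the same as quotienting by the two-sided ideal they generate. -/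
def quotRel (l n : ℕ) [NeZero l] (Lam : Set (ZMod l)) (bad : Set (Res l n)) :
    KLR l n Lam → KLR l n Lam → Prop := fun a b =>
  b = 0 ∧ ∃ i ∈ bad, a = RingQuot.mkAlgHom ℂ (KLRRel l n Lam) (eG l n i)

/-- The quotient of the cyclotomic KLR algebra by the two-sided ideal generated by the
idempotents `e(i)`, `i ∈ bad`. -/
abbrev BQuot (l n : ℕ) [NeZero l] (Lam : Set (ZMod l)) (bad : Set (Res l n)) :=
  RingQuot (quotRel l n Lam bad)

/-- The canonical map from the free algebra onto the quotient. -/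
def bmk (l n : ℕ) [NeZero l] (Lam : Set (ZMod l)) (bad : Set (Res l n)) :
    FreeAlgebra ℂ (KLRGen l n) →ₐ[ℂ] BQuot l n Lam bad :=
  (RingQuot.mkAlgHom ℂ (quotRel l n Lam bad)).comp (RingQuot.mkAlgHom ℂ (KLRRel l n Lam))

/-- The entries of the Cartan matrix of type `A_{l-1}^{(1)}`. -/
def cartan (l : ℕ) (i j : ZMod l) : ℤ :=
  if i = j then 2 else if j = i + 1 ∨ j = i - 1 then -1 else 0

/-- The level-one cyclotomic set `{0} ⊆ ℤ/lℤ`. -/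
def Lam1 (l : ℕ) : Set (ZMod l) := {0}

/-- The residue sequences `i` with `(i₁, i₂, i₃) ≡ (0, 1, 2) (mod l)`. -/
def badSet1 (l n : ℕ) (hn : 3 ≤ n) : Set (Res l n) :=
  {i | i ⟨0, by omega⟩ = 0 ∧ i ⟨1, by omega⟩ = 1 ∧ i ⟨2, by omega⟩ = 2}

/-- Two-column partitions of `n`, encoded by the number `b` of parts equal to `2`
(the partition is `(2^b, 1^{n-2b})`). -/
abbrev TwoCol (n : ℕ) := {b : ℕ // 2 * b ≤ n}

/-- The `i`-th part (0-indexed) of the two-column partition `(2^b, 1^{n-2b})`. -/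
def tcRow (n b i : ℕ) : ℕ := if i < b then 2 else if i < n - b then 1 else 0

/-- The dominance order: `tcDom n lam mu` means `lam` dominates `mu`. -/
def tcDom (n : ℕ) (lam mu : TwoCol n) : Prop :=
  ∀ j : ℕ, ∑ i ∈ Finset.range j, tcRow n mu.1 i ≤ ∑ i ∈ Finset.range j, tcRow n lam.1 i

/-- Standard tableaux of two-column shape `(2^b, 1^{n-2b})`, encoded by the set `S` of entries
lying in the second column (0-indexed); standardness amounts to the ballot condition: among
the entries `≤ k` at most half lie in the second column. -/
abbrev StdT (n : ℕ) (lam : TwoCol n) :=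
  {S : Finset (Fin n) // S.card = lam.1 ∧
    ∀ k : Fin n, 2 * ((S.filter (fun x => x ≤ k)).card) ≤ k.val + 1}

/-- Idempotents `P j a` (projecting on residue `a` at position `j`) together with `y j`, `ψ j`
satisfying the Temperley-Lieb quotient of the level-one KLR relations, deformed by `ξ` in the
quadratic relation. -/
structure TLData (l n : ℕ) [NeZero l] (R A : Type*) [CommRing R] [Ring A] [Algebra R A]
    (ξ : R) where
  P : ℕ → ZMod l → A
  y : ℕ → A
  ψ : ℕ → A
  P_comm : ∀ i j a b, P i a * P j b = P j b * P i a
  P_orth : ∀ i a b, a ≠ b → P i a * P i b = 0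
  P_idem : ∀ i a, P i a * P i a = P i a
  P_sum : ∀ i, ∑ a, P i a = 1
  Py : ∀ i j a, P i a * y j = y j * P i a
  yy : ∀ i j, y i * y j = y j * y i
  ψP1 : ∀ r a, ψ r * P r a = P (r + 1) a * ψ r
  ψP2 : ∀ r a, ψ r * P (r + 1) a = P r a * ψ r
  ψP : ∀ r j a, j ≠ r → j ≠ r + 1 → ψ r * P j a = P j a * ψ r
  ψy : ∀ r j, j ≠ r → j ≠ r + 1 → ψ r * y j = y j * ψ r
  ψψ : ∀ r s, r + 1 < s → ψ r * ψ s = ψ s * ψ r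
  ψy1 : ∀ r, r + 1 < n → ψ r * y (r + 1) = y r * ψ r + ∑ a, P r a * P (r + 1) a
  yψ1 : ∀ r, r + 1 < n → y (r + 1) * ψ r = ψ r * y r + ∑ a, P r a * P (r + 1) a
  psisq : ∀ r a b, r + 1 < n → ψ r * ψ r * (P r a * P (r + 1) b) =
    (if b = a then 0 else if b = a + 1 then y (r + 1) - y r - algebraMap R A ξ
      else if b = a - 1 then y r - y (r + 1) - algebraMap R A ξ else 1) * (P r a * P (r + 1) b)
  braid : ∀ r a b c, r + 2 < n →
    ψ r * ψ (r + 1) * ψ r * (P r a * P (r + 1) b * P (r + 2) c) =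
    (ψ (r + 1) * ψ r * ψ (r + 1) + (if c = a ∧ b = a + 1 then 1
      else if c = a ∧ b = a - 1 then -1 else 0)) * (P r a * P (r + 1) b * P (r + 2) c)
  P_zero : ∀ a, a ≠ 0 → P 0 a = 0
  y_zero : y 0 = 0
  bad : P 0 0 * P 1 1 * P 2 2 = 0

namespace TLData

variable {l n : ℕ} [NeZero l] {R A : Type*} [CommRing R] [Ring A] [Algebra R A] {ξ : R}
  (D : TLData l n R A ξ)

/-- The idempotent of a (reversed) residue word. -/
def E : List (ZMod l) → A
  | [] => 1
  | a :: w => E w * D.P w.length a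

@[simp] lemma E_nil : D.E [] = 1 := rfl
lemma E_cons (a : ZMod l) (w : List (ZMod l)) : D.E (a :: w) = D.E w * D.P w.length a := rfl

/-- The subalgebra generated by the generators on the first `m` positions. -/
def Alg (m : ℕ) : Subalgebra R A :=
  Algebra.adjoin R ({z | ∃ j a, j < m ∧ z = D.P j a} ∪ {z | ∃ j, j < m ∧ z = D.y j} ∪
    {z | ∃ j, j + 1 < m ∧ z = D.ψ j})

lemma P_mem {m j : ℕ} (h : j < m) (a : ZMod l) : D.P j a ∈ D.Alg m :=
  Algebra.subset_adjoin (Or.inl (Or.inl ⟨j, a, h, rfl⟩))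

lemma y_mem {m j : ℕ} (h : j < m) : D.y j ∈ D.Alg m :=
  Algebra.subset_adjoin (Or.inl (Or.inr ⟨j, h, rfl⟩))

lemma ψ_mem {m j : ℕ} (h : j + 1 < m) : D.ψ j ∈ D.Alg m :=
  Algebra.subset_adjoin (Or.inr ⟨j, h, rfl⟩)

lemma Alg_mono {m k : ℕ} (h : m ≤ k) : D.Alg m ≤ D.Alg k := by
  refine Algebra.adjoin_mono ?_
  rintro z ((⟨j, a, hj, rfl⟩ | ⟨j, hj, rfl⟩) | ⟨j, hj, rfl⟩)
  · exact Or.inl (Or.inl ⟨j, a, by omega, rfl⟩)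
  · exact Or.inl (Or.inr ⟨j, by omega, rfl⟩)
  · exact Or.inr ⟨j, by omega, rfl⟩

lemma Alg_comm_of {m : ℕ} {z : A} (hP : ∀ j a, j < m → D.P j a * z = z * D.P j a)
    (hy : ∀ j, j < m → D.y j * z = z * D.y j) (hψ : ∀ j, j + 1 < m → D.ψ j * z = z * D.ψ j)
    {x : A} (hx : x ∈ D.Alg m) : x * z = z * x := by
  induction hx using Algebra.adjoin_induction with
  | mem x hx =>
    rcases hx with ((⟨j, a, hj, rfl⟩ | ⟨j, hj, rfl⟩) | ⟨j, hj, rfl⟩)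
    · exact hP j a hj
    · exact hy j hj
    · exact hψ j hj
  | algebraMap r => exact Algebra.commutes r z
  | add x y _ _ hx hy => rw [add_mul, mul_add, hx, hy]
  | mul x y _ _ hx hy => rw [mul_assoc, hy, ← mul_assoc, hx, mul_assoc]

lemma Alg_comm_P {m k : ℕ} (h : m ≤ k) (a : ZMod l) {x : A} (hx : x ∈ D.Alg m) :
    x * D.P k a = D.P k a * x :=
  D.Alg_comm_of (fun j b _ => D.P_comm j k b a) (fun j _ => (D.Py k j a).symm)
    (fun j hj => D.ψP j k a (by omega) (by omega)) hx

lemma Alg_comm_y {m k : ℕ} (h : m ≤ k) {x : A} (hx : x ∈ D.Alg m) :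
    x * D.y k = D.y k * x :=
  D.Alg_comm_of (fun j b _ => D.Py j k b) (fun j _ => D.yy j k)
    (fun j hj => D.ψy j k (by omega) (by omega)) hx

lemma Alg_comm_ψ {m k : ℕ} (h : m ≤ k) {x : A} (hx : x ∈ D.Alg m) :
    x * D.ψ k = D.ψ k * x :=
  D.Alg_comm_of (fun j b _ => (D.ψP k j b (by omega) (by omega)).symm)
    (fun j _ => (D.ψy k j (by omega) (by omega)).symm)
    (fun j hj => D.ψψ j k (by omega)) hx

/-- Closure under left multiplication by `Alg m` can be checked on generators. -/
lemma Alg_induction_left {m : ℕ} (T : Submodule R A)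
    (hP : ∀ j a, j < m → ∀ z ∈ T, D.P j a * z ∈ T)
    (hy : ∀ j, j < m → ∀ z ∈ T, D.y j * z ∈ T)
    (hψ : ∀ j, j + 1 < m → ∀ z ∈ T, D.ψ j * z ∈ T)
    {x : A} (hx : x ∈ D.Alg m) : ∀ z ∈ T, x * z ∈ T := by
  induction hx using Algebra.adjoin_induction with
  | mem x hx =>
    rcases hx with ((⟨j, a, hj, rfl⟩ | ⟨j, hj, rfl⟩) | ⟨j, hj, rfl⟩)
    · exact hP j a hj
    · exact hy j hj
    · exact hψ j hj
  | algebraMap r => intro z hz; rw [← Algebra.smul_def]; exact T.smul_mem _ hz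
  | add x y _ _ hx hy => intro z hz; rw [add_mul]; exact T.add_mem (hx z hz) (hy z hz)
  | mul x y _ _ hx hy => intro z hz; rw [mul_assoc]; exact hx _ (hy z hz)

lemma E_mem (w : List (ZMod l)) : D.E w ∈ D.Alg w.length := by
  induction w with
  | nil => exact one_mem _
  | cons a w ih =>
    exact mul_mem (D.Alg_mono (by simp) ih) (D.P_mem (by simp) a)

lemma E_comm_P (w : List (ZMod l)) (j : ℕ) (a : ZMod l) :
    D.E w * D.P j a = D.P j a * D.E w := by
  induction w with
  | nil => simp
  | cons b w ih => rw [E_cons, mul_assoc, D.P_comm, ← mul_assoc, ih, mul_assoc]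

lemma E_comm_y (w : List (ZMod l)) (j : ℕ) : D.E w * D.y j = D.y j * D.E w := by
  induction w with
  | nil => simp
  | cons b w ih => rw [E_cons, mul_assoc, D.Py, ← mul_assoc, ih, mul_assoc]

lemma E_idem (w : List (ZMod l)) : D.E w * D.E w = D.E w := by
  induction w with
  | nil => simp
  | cons b w ih =>
    rw [E_cons]
    calc _ = (D.E w * (D.P w.length b * D.E w)) * D.P w.length b := by simp only [mul_assoc]
      _ = (D.E w * D.E w) * (D.P w.length b * D.P w.length b) := by
        rw [← E_comm_P]; simp only [mul_assoc]
      _ = _ := by rw [ih, D.P_idem]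

lemma E_comm_ψ (w : List (ZMod l)) {j : ℕ} (h : w.length ≤ j) : D.E w * D.ψ j = D.ψ j * D.E w :=
  D.Alg_comm_ψ h (D.E_mem w)

/-- `ψ` exchanges the two last letters. -/
lemma ψ_E (a b : ZMod l) (w : List (ZMod l)) :
    D.ψ w.length * D.E (b :: a :: w) = D.E (a :: b :: w) * D.ψ w.length := by
  simp only [E_cons, List.length_cons]
  calc _ = D.ψ w.length * D.E w * D.P w.length a * D.P (w.length + 1) b := by
        simp only [mul_assoc]
    _ = D.E w * (D.ψ w.length * D.P w.length a) * D.P (w.length + 1) b := by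
        rw [← D.E_comm_ψ w le_rfl]; simp only [mul_assoc]
    _ = D.E w * D.P (w.length + 1) a * (D.ψ w.length * D.P (w.length + 1) b) := by
        rw [D.ψP1]; simp only [mul_assoc]
    _ = _ := by
        rw [D.ψP2]
        calc _ = D.E w * (D.P (w.length + 1) a * D.P w.length b) * D.ψ w.length := by
              simp only [mul_assoc]
          _ = _ := by rw [D.P_comm]; simp only [mul_assoc]

lemma d_E (a b : ZMod l) (w : List (ZMod l)) :
    (∑ c, D.P w.length c * D.P (w.length + 1) c) * D.E (b :: a :: w) =
      if a = b then D.E (b :: a :: w) else 0 := by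
  simp only [E_cons, List.length_cons, Finset.sum_mul]
  have key : ∀ c, D.P w.length c * D.P (w.length + 1) c *
      (D.E w * D.P w.length a * D.P (w.length + 1) b) =
      D.E w * (D.P w.length c * D.P w.length a) * (D.P (w.length + 1) c *
        D.P (w.length + 1) b) := by
    intro c
    calc _ = D.P w.length c * (D.P (w.length + 1) c * D.E w) * D.P w.length a *
          D.P (w.length + 1) b := by simp only [mul_assoc]
      _ = D.P w.length c * D.E w * (D.P (w.length + 1) c * D.P w.length a) *
          D.P (w.length + 1) b := by rw [← E_comm_P]; simp only [mul_assoc]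
      _ = _ := by rw [← E_comm_P, D.P_comm (w.length + 1)]; simp only [mul_assoc]
  simp only [key]
  rw [Finset.sum_eq_single a]
  · split_ifs with h
    · subst h; rw [D.P_idem, D.P_idem]
    · rw [D.P_orth _ _ _ h, mul_zero]
  · intro c _ hc; rw [D.P_orth _ _ _ hc]; simp
  · simp

lemma ψy1_E (a b : ZMod l) (w : List (ZMod l)) (h : w.length + 1 < n) :
    D.ψ w.length * D.y (w.length + 1) * D.E (b :: a :: w) =
      (D.y w.length * D.ψ w.length + if a = b then 1 else 0) * D.E (b :: a :: w) := by
  rw [D.ψy1 _ h, add_mul, add_mul, d_E]; split_ifs <;> simp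

lemma yψ1_E (a b : ZMod l) (w : List (ZMod l)) (h : w.length + 1 < n) :
    D.y (w.length + 1) * D.ψ w.length * D.E (b :: a :: w) =
      (D.ψ w.length * D.y w.length + if a = b then 1 else 0) * D.E (b :: a :: w) := by
  rw [D.yψ1 _ h, add_mul, add_mul, d_E]; split_ifs <;> simp

lemma E_two (a b : ZMod l) (w : List (ZMod l)) :
    D.E (b :: a :: w) = (D.P w.length a * D.P (w.length + 1) b) * D.E w := by
  simp only [E_cons, List.length_cons]
  rw [E_comm_P, mul_assoc, E_comm_P, ← mul_assoc]

lemma psisq_E (a b : ZMod l) (w : List (ZMod l)) (h : w.length + 1 < n) :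
    D.ψ w.length * D.ψ w.length * D.E (b :: a :: w) =
    (if b = a then 0 else if b = a + 1 then D.y (w.length + 1) - D.y w.length - algebraMap R A ξ
      else if b = a - 1 then D.y w.length - D.y (w.length + 1) - algebraMap R A ξ else 1) *
      D.E (b :: a :: w) := by
  rw [E_two, ← mul_assoc, D.psisq _ _ _ h, mul_assoc]

lemma E_three (a b c : ZMod l) (w : List (ZMod l)) :
    D.E (c :: b :: a :: w) =
      (D.P w.length a * D.P (w.length + 1) b * D.P (w.length + 2) c) * D.E w := by
  rw [E_cons, E_two, mul_assoc, E_comm_P, ← mul_assoc]; rfl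

lemma braid_E (a b c : ZMod l) (w : List (ZMod l)) (h : w.length + 2 < n) :
    D.ψ w.length * D.ψ (w.length + 1) * D.ψ w.length * D.E (c :: b :: a :: w) =
    (D.ψ (w.length + 1) * D.ψ w.length * D.ψ (w.length + 1) + (if c = a ∧ b = a + 1 then 1
      else if c = a ∧ b = a - 1 then -1 else 0)) * D.E (c :: b :: a :: w) := by
  rw [E_three, ← mul_assoc, D.braid _ _ _ _ h, mul_assoc]

end TLData

namespace TLData

variable {l n : ℕ} [NeZero l] {R A : Type*} [CommRing R] [Ring A] [Algebra R A] {ξ : R}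
  (D : TLData l n R A ξ)

/-- Stability under two-sided multiplication by `Alg m`. -/
def Closed (m : ℕ) (I : Submodule R A) : Prop :=
  ∀ x ∈ D.Alg m, ∀ z ∈ I, x * z ∈ I ∧ z * x ∈ I

lemma closed_bot (m : ℕ) : D.Closed m ⊥ := by
  intro x _ z hz
  rw [Submodule.mem_bot] at hz
  simp [hz]

variable {D} in
lemma E_suffix {m : ℕ} {I : Submodule R A} (hI : D.Closed m I) {v w : List (ZMod l)}
    (hm : v.length + w.length ≤ m) (h : D.E w ∈ I) : D.E (v ++ w) ∈ I := by
  induction v with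
  | nil => exact h
  | cons a v ih =>
    simp only [List.length_cons] at hm
    rw [List.cons_append, E_cons]
    exact (hI _ (D.P_mem (by rw [List.length_append]; omega) a) _ (ih (by omega))).2

lemma E_append_eq {X Y : A} {w : List (ZMod l)} (h : X * D.E w = Y * D.E w)
    (v : List (ZMod l)) : X * D.E (v ++ w) = Y * D.E (v ++ w) := by
  induction v with
  | nil => exact h
  | cons a v ih => rw [List.cons_append, E_cons, ← mul_assoc, ih, mul_assoc]

lemma ψ_E_append (a b : ZMod l) (w v : List (ZMod l)) :
    D.ψ w.length * D.E (v ++ b :: a :: w) = D.E (v ++ a :: b :: w) * D.ψ w.length := by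
  induction v with
  | nil => exact D.ψ_E a b w
  | cons c v ih =>
    rw [List.cons_append, List.cons_append, E_cons, E_cons, ← mul_assoc, ih, mul_assoc, mul_assoc,
      D.ψP]
    · simp
    all_goals simp only [List.length_append, List.length_cons]; omega

variable {D}

lemma swap_far {m : ℕ} {I : Submodule R A} (hI : D.Closed m I) (hmn : m ≤ n)
    {v w : List (ZMod l)} {a b : ZMod l} (hm : v.length + w.length + 2 ≤ m)
    (h0 : b ≠ a) (h1 : b ≠ a + 1) (h2 : b ≠ a - 1) (h : D.E (v ++ a :: b :: w) ∈ I) :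
    D.E (v ++ b :: a :: w) ∈ I := by
  have e := D.psisq_E a b w (by omega)
  rw [if_neg h0, if_neg h1, if_neg h2] at e
  have e2 := D.E_append_eq e v
  rw [one_mul, mul_assoc, ψ_E_append] at e2
  rw [← e2]
  have hψ : D.ψ w.length ∈ D.Alg m := D.ψ_mem (by omega)
  exact (hI _ hψ _ (hI _ hψ _ h).2).1

lemma pair_last {m : ℕ} {I : Submodule R A} (hI : D.Closed m I) (hmn : m ≤ n)
    {w : List (ZMod l)} {a b : ZMod l} (hm : w.length + 3 ≤ m) (h0 : a ≠ b)
    (h1 : b = a + 1 ∨ b = a - 1) (h : D.E (a :: b :: a :: w) ∈ I) :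
    D.E (a :: a :: b :: w) ∈ I := by
  set r := w.length with hr
  have hψ1 : D.ψ r ∈ D.Alg m := D.ψ_mem (by omega)
  have hψ2 : D.ψ (r + 1) ∈ D.Alg m := D.ψ_mem (by omega)
  have hy1 : D.y (r + 1) ∈ D.Alg m := D.y_mem (by omega)
  have hy2 : D.y (r + 2) ∈ D.Alg m := D.y_mem (by omega)
  set e := D.E (a :: a :: b :: w) with he
  have s1 : D.ψ (r + 1) * e = e * D.ψ (r + 1) := D.ψ_E a a (b :: w)
  have s2 : D.ψ r * e = D.E (a :: b :: a :: w) * D.ψ r := D.ψ_E_append b a w [a]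
  have s2' : e * D.ψ r = D.ψ r * D.E (a :: b :: a :: w) := (D.ψ_E_append a b w [a]).symm
  have q1 : D.ψ (r + 1) * D.ψ (r + 1) * e = 0 := by
    have := D.psisq_E a a (b :: w) (by simp only [List.length_cons]; omega)
    simpa using this
  have q2 : D.ψ (r + 1) * D.y (r + 2) * e = (D.y (r + 1) * D.ψ (r + 1) + 1) * e := by
    have := D.ψy1_E a a (b :: w) (by simp only [List.length_cons]; omega)
    simpa using this
  have q3 : D.y (r + 2) * D.ψ (r + 1) * e = (D.ψ (r + 1) * D.y (r + 1) + 1) * e := by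
    have := D.yψ1_E a a (b :: w) (by simp only [List.length_cons]; omega)
    simpa using this
  have hin : D.ψ (r + 1) * (D.ψ r * D.ψ r * e) * D.ψ (r + 1) ∈ I := by
    refine (hI _ hψ2 _ (hI _ hψ2 _ ?_).1).2
    rw [mul_assoc, s2]
    exact (hI _ hψ1 _ (hI _ hψ1 _ h).2).1
  have yψ : D.ψ (r + 1) * D.y r = D.y r * D.ψ (r + 1) := D.ψy _ _ (by omega) (by omega)
  have cent : ∀ z : A, algebraMap R A ξ * z = z * algebraMap R A ξ := Algebra.commutes ξ
  have key : D.ψ (r + 1) * ((D.y (r + 1) - D.y r - algebraMap R A ξ) * e) * D.ψ (r + 1)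
      = - (D.ψ (r + 1) * e) := by
    have t1 : D.ψ (r + 1) * (D.y r * e) * D.ψ (r + 1) = 0 := by
      rw [← mul_assoc, yψ, mul_assoc, mul_assoc, ← s1, ← mul_assoc (D.ψ _), q1,
        mul_zero]
    have t2 : D.ψ (r + 1) * (algebraMap R A ξ * e) * D.ψ (r + 1) = 0 := by
      rw [← mul_assoc, ← cent, mul_assoc, mul_assoc, ← s1, ← mul_assoc (D.ψ _), q1,
        mul_zero]
    have t3 : D.ψ (r + 1) * (D.y (r + 1) * e) * D.ψ (r + 1) = - (D.ψ (r + 1) * e) := by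
      have u : D.y (r + 1) * D.ψ (r + 1) * e = D.ψ (r + 1) * D.y (r + 2) * e - e := by
        rw [q2, add_mul, one_mul, add_sub_cancel_right]
      have ey : D.y (r + 2) * e = e * D.y (r + 2) := (D.E_comm_y _ _).symm
      calc _ = D.ψ (r + 1) * (D.y (r + 1) * (e * D.ψ (r + 1))) := by simp only [mul_assoc]
        _ = D.ψ (r + 1) * (D.y (r + 1) * D.ψ (r + 1) * e) := by rw [← s1]; simp only [mul_assoc]
        _ = D.ψ (r + 1) * D.ψ (r + 1) * (D.y (r + 2) * e) - D.ψ (r + 1) * e := by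
          rw [u, mul_sub]; simp only [mul_assoc]
        _ = _ := by rw [ey, ← mul_assoc, q1, zero_mul, zero_sub]
    rw [sub_mul, sub_mul, mul_sub, mul_sub, sub_mul, sub_mul, t1, t2, t3, sub_zero, sub_zero]
  have fin : D.ψ (r + 1) * e ∈ I := by
    have e' := D.E_append_eq (D.psisq_E b a w (by omega)) [a]
    simp only [List.cons_append, List.nil_append] at e'
    change D.ψ r * D.ψ r * e = _ * e at e'
    rw [e', if_neg h0] at hin
    split_ifs at hin with g1 g2
    · change D.ψ (r + 1) * ((D.y (r + 1) - D.y r - algebraMap R A ξ) * e) * D.ψ (r + 1) ∈ I at hin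
      rw [key] at hin
      exact neg_mem_iff.1 hin
    · have t2 : D.ψ (r + 1) * (algebraMap R A ξ * e) * D.ψ (r + 1) = 0 := by
        rw [← mul_assoc, ← cent, mul_assoc, mul_assoc, ← s1, ← mul_assoc (D.ψ _), q1,
          mul_zero]
      have : D.ψ (r + 1) * ((D.y r - D.y (r + 1) - algebraMap R A ξ) * e) * D.ψ (r + 1)
          = D.ψ (r + 1) * e := by
        have : (D.y r - D.y (r + 1) - algebraMap R A ξ) * e =
          -((D.y (r + 1) - D.y r - algebraMap R A ξ) * e) - 2 * (algebraMap R A ξ * e) := by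
          noncomm_ring
        rw [this, mul_sub, sub_mul, mul_neg, neg_mul, key, neg_neg]
        have : D.ψ (r + 1) * (2 * (algebraMap R A ξ * e)) * D.ψ (r + 1) =
          2 * (D.ψ (r + 1) * (algebraMap R A ξ * e) * D.ψ (r + 1)) := by noncomm_ring
        rw [this, t2, mul_zero, sub_zero]
      change D.ψ (r + 1) * ((D.y r - D.y (r + 1) - algebraMap R A ξ) * e) * D.ψ (r + 1) ∈ I at hin
      rwa [this] at hin
    · exact absurd h1 (by
        rintro (h1 | h1)
        · exact g2 (by rw [h1]; ring)
        · exact g1 (by rw [h1]; ring))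
  have : e = D.y (r + 2) * (D.ψ (r + 1) * e) - D.ψ (r + 1) * e * D.y (r + 1) := by
    rw [← mul_assoc, q3, mul_assoc, D.E_comm_y]
    noncomm_ring
  rw [this]
  exact I.sub_mem (hI _ hy2 _ fin).1 (hI _ hy1 _ fin).2

lemma braid_triple {m : ℕ} {I : Submodule R A} (hI : D.Closed m I) (hmn : m ≤ n)
    {w : List (ZMod l)} {a b : ZMod l} (hm : w.length + 3 ≤ m)
    (h1 : b = a + 1 ∨ b = a - 1) (h : D.E (b :: a :: a :: w) ∈ I)
    (h' : D.E (a :: a :: b :: w) ∈ I) : D.E (a :: b :: a :: w) ∈ I := by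
  set r := w.length with hr
  have hψ1 : D.ψ r ∈ D.Alg m := D.ψ_mem (by omega)
  have hψ2 : D.ψ (r + 1) ∈ D.Alg m := D.ψ_mem (by omega)
  have br := D.braid_E a b a w (by omega)
  have s1 : D.ψ r * D.E (a :: b :: a :: w) = D.E (a :: a :: b :: w) * D.ψ r :=
    D.ψ_E_append a b w [a]
  have s2 : D.ψ (r + 1) * D.E (a :: b :: a :: w) = D.E (b :: a :: a :: w) * D.ψ (r + 1) :=
    D.ψ_E b a (a :: w)
  have m1 : D.ψ r * D.ψ (r + 1) * D.ψ r * D.E (a :: b :: a :: w) ∈ I := by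
    rw [mul_assoc, s1]
    exact (hI _ (mul_mem hψ1 hψ2) _ (hI _ hψ1 _ h').2).1
  have m2 : D.ψ (r + 1) * D.ψ r * D.ψ (r + 1) * D.E (a :: b :: a :: w) ∈ I := by
    rw [mul_assoc, s2]
    exact (hI _ (mul_mem hψ2 hψ1) _ (hI _ hψ2 _ h).2).1
  rw [← hr] at br
  by_cases g : b = a + 1
  · rw [if_pos ⟨rfl, g⟩, add_mul, one_mul] at br
    have : D.E (a :: b :: a :: w) = D.ψ r * D.ψ (r + 1) * D.ψ r * D.E (a :: b :: a :: w) -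
      D.ψ (r + 1) * D.ψ r * D.ψ (r + 1) * D.E (a :: b :: a :: w) := by rw [br]; abel
    rw [this]; exact I.sub_mem m1 m2
  · rw [if_neg (by tauto), if_pos ⟨rfl, by tauto⟩, add_mul, neg_mul, one_mul] at br
    have : D.E (a :: b :: a :: w) = D.ψ (r + 1) * D.ψ r * D.ψ (r + 1) * D.E (a :: b :: a :: w) -
      D.ψ r * D.ψ (r + 1) * D.ψ r * D.E (a :: b :: a :: w) := by rw [br]; abel
    rw [this]; exact I.sub_mem m2 m1

lemma E_zero_zero (hn : 2 ≤ n) : D.E [0, 0] = 0 := by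
  have q1 := D.ψy1_E 0 0 [] (by simp only [List.length_nil]; omega)
  have q2 := D.yψ1_E 0 0 [] (by simp only [List.length_nil]; omega)
  have q3 := D.psisq_E 0 0 [] (by simp only [List.length_nil]; omega)
  simp only [List.length_nil, zero_add, D.y_zero, zero_mul, mul_zero, if_true, one_mul] at q1 q2 q3
  have c : D.y 1 * D.E [0, 0] = D.E [0, 0] * D.y 1 := (D.E_comm_y _ _).symm
  calc D.E [0, 0] = D.y 1 * D.ψ 0 * D.E [0, 0] := q2.symm
    _ = D.y 1 * D.ψ 0 * (D.ψ 0 * D.y 1 * D.E [0, 0]) := by rw [q1]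
    _ = D.y 1 * (D.ψ 0 * D.ψ 0 * D.E [0, 0]) * D.y 1 := by
      rw [mul_assoc (D.ψ 0), c]; simp only [mul_assoc]
    _ = 0 := by rw [q3]; simp

end TLData

lemma small_ne_zero {l : ℕ} (hl : 5 ≤ l) :
    (1 : ZMod l) ≠ 0 ∧ (2 : ZMod l) ≠ 0 ∧ (3 : ZMod l) ≠ 0 ∧ (4 : ZMod l) ≠ 0 := by
  have key : ∀ k : ℕ, 0 < k → k < 5 → (k : ZMod l) ≠ 0 := by
    intro k h0 h5 h
    rw [ZMod.natCast_eq_zero_iff] at h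
    have := Nat.le_of_dvd h0 h
    omega
  exact ⟨by simpa using key 1, by simpa using key 2, by simpa using key 3, by simpa using key 4⟩

/-- The residue at position `j` of the initial tableau with `b` entries in the second column. -/
def resIni (l b j : ℕ) : ZMod l :=
  if j < 2 * b then (if j % 2 = 0 then -((j / 2 : ℕ) : ZMod l) else 1 - ((j / 2 : ℕ) : ZMod l))
  else -((j - b : ℕ) : ZMod l)

lemma resIni_even {l b i : ℕ} (h : i < b) : resIni l b (2 * i) = -(i : ZMod l) := by
  rw [resIni, if_pos (by omega), if_pos (by omega)]; congr 2; omega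

lemma resIni_odd {l b i : ℕ} (h : i < b) : resIni l b (2 * i + 1) = 1 - (i : ZMod l) := by
  rw [resIni, if_pos (by omega), if_neg (by omega)]; congr 2; omega

lemma resIni_ge {l b j : ℕ} (h : 2 * b ≤ j) : resIni l b j = -((j - b : ℕ) : ZMod l) := by
  rw [resIni, if_neg (by omega)]

/-- The (reversed) residue word of the initial tableau. -/
def wordIni (l b : ℕ) : ℕ → List (ZMod l)
  | 0 => []
  | m + 1 => resIni l b m :: wordIni l b m

@[simp] lemma wordIni_zero (l b : ℕ) : wordIni l b 0 = [] := rfl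
lemma wordIni_succ (l b m : ℕ) : wordIni l b (m + 1) = resIni l b m :: wordIni l b m := rfl
@[simp] lemma wordIni_length (l b m : ℕ) : (wordIni l b m).length = m := by
  induction m with
  | zero => rfl
  | succ m ih => rw [wordIni_succ, List.length_cons, ih]

lemma wordIni_congr {l b b' m : ℕ} (h : ∀ j < m, resIni l b j = resIni l b' j) :
    wordIni l b m = wordIni l b' m := by
  induction m with
  | zero => rfl
  | succ m ih =>
    rw [wordIni_succ, wordIni_succ, h m (by omega), ih fun j hj => h j (by omega)]

lemma wordIni_eq {l b b' m : ℕ} (h : m ≤ 2 * b + 1) (h' : b ≤ b') :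
    wordIni l b' m = wordIni l b m := by
  refine wordIni_congr fun j hj => ?_
  rcases Nat.lt_or_ge j (2 * b) with h1 | h1
  · rw [resIni, resIni, if_pos h1, if_pos (by omega)]
  · have : j = 2 * b := by omega
    subst this
    rcases Nat.lt_or_ge b b' with h2 | h2
    · rw [resIni_even h2, resIni_ge le_rfl]; congr 2; omega
    · have : b = b' := by omega
      rw [this]

lemma wordIni_two (l b : ℕ) : wordIni l (b + 1) (2 * b + 2) =
    (1 - (b : ZMod l)) :: -(b : ZMod l) :: wordIni l b (2 * b) := by
  rw [show 2 * b + 2 = (2 * b + 1) + 1 from rfl, wordIni_succ, resIni_odd (by omega), wordIni_succ,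
    resIni_even (by omega), wordIni_eq (b := b) (by omega) (by omega)]

lemma wordIni_ge {l b m : ℕ} (h : 2 * b ≤ m) :
    wordIni l b (m + 1) = -((m - b : ℕ) : ZMod l) :: wordIni l b m := by
  rw [wordIni_succ, resIni_ge h]

/-- The content of a residue word (a weight in the fundamental representation). -/
def wt (r : ZMod l) : List (ZMod l) → ℤ
  | [] => (if r = 0 then 1 else 0) + (if r = 1 then 1 else 0)
  | a :: w => wt r w + (if r + 1 = a then 1 else 0) - (if r = a then 1 else 0)

lemma wt_wordIni {l : ℕ} (r : ZMod l) : ∀ {m b : ℕ}, 2 * b ≤ m →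
    wt r (wordIni l b m) = (if r = -((m - b : ℕ) : ZMod l) then 1 else 0) +
      (if r = 1 - (b : ZMod l) then 1 else 0) := by
  have e1 : ∀ a : ZMod l, (if r + 1 = a then (1 : ℤ) else 0) = if r = a - 1 then 1 else 0 :=
    fun a => by simp only [eq_sub_iff_add_eq]
  have step1 : ∀ b, wt r (wordIni l b (2 * b)) = (if r = -((b : ℕ) : ZMod l) then 1 else 0) +
      (if r = 1 - (b : ZMod l) then 1 else 0) := by
    intro b
    induction b with
    | zero => simp [wt]
    | succ b ih =>
      rw [show 2 * (b + 1) = 2 * b + 2 by ring, wordIni_two, wt, wt, ih, e1, e1]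
      push_cast
      rw [show (1 : ZMod l) - (b + 1) = 1 - b - 1 by ring, show -((b : ZMod l) + 1) = -b - 1 by ring]
      ring
  intro m b h
  induction m, h using Nat.le_induction with
  | base => rw [step1, show 2 * b - b = b by omega]
  | succ m h ih =>
    rw [wordIni_ge h, wt, ih, e1, show m + 1 - b = (m - b) + 1 by omega]
    push_cast
    rw [show -(((m - b : ℕ) : ZMod l) + 1) = -((m - b : ℕ) : ZMod l) - 1 by ring]
    ring

namespace TLData

variable {l n : ℕ} [NeZero l] {R A : Type*} [CommRing R] [Ring A] [Algebra R A] {ξ : R}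
  (D : TLData l n R A ξ)

/-- The initial idempotent. -/
def J (b m : ℕ) : A := D.E (wordIni l b m)

lemma J_succ (b m : ℕ) : D.J b (m + 1) = D.J b m * D.P m (resIni l b m) := by
  rw [J, wordIni_succ, E_cons, wordIni_length]; rfl

lemma J_mem (b m : ℕ) : D.J b m ∈ D.Alg m := by
  have := D.E_mem (wordIni l b m); rwa [wordIni_length] at this

/-- The two-sided ideal of `Alg m` spanned by the initial idempotents with at least `b` entries in
the second column. -/
def K (m b : ℕ) : Submodule R A :=
  Submodule.span R {z | ∃ x ∈ D.Alg m, ∃ y ∈ D.Alg m, ∃ b', b ≤ b' ∧ 2 * b' ≤ m ∧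
    z = x * D.J b' m * y}

lemma J_mem_K {m b : ℕ} (h : 2 * b ≤ m) : D.J b m ∈ D.K m b :=
  Submodule.subset_span ⟨1, one_mem _, 1, one_mem _, b, le_rfl, h, by simp⟩

lemma K_le_of {m b : ℕ} {I : Submodule R A} (hI : D.Closed m I)
    (h : ∀ b', b ≤ b' → 2 * b' ≤ m → D.J b' m ∈ I) : D.K m b ≤ I := by
  refine Submodule.span_le.2 ?_
  rintro _ ⟨x, hx, y, hy, b', h1, h2, rfl⟩
  exact (hI y hy _ (hI x hx _ (h b' h1 h2)).1).2

lemma K_closed (m b : ℕ) : D.Closed m (D.K m b) := by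
  intro x hx z hz
  induction hz using Submodule.span_induction with
  | mem z hz =>
    obtain ⟨x', hx', y', hy', b', h1, h2, rfl⟩ := hz
    exact ⟨Submodule.subset_span ⟨x * x', mul_mem hx hx', y', hy', b', h1, h2, by
        simp only [mul_assoc]⟩,
      Submodule.subset_span ⟨x', hx', y' * x, mul_mem hy' hx, b', h1, h2, by
        simp only [mul_assoc]⟩⟩
  | zero => simp
  | add a b _ _ ha hb =>
    rw [mul_add, add_mul]
    exact ⟨Submodule.add_mem _ ha.1 hb.1, Submodule.add_mem _ ha.2 hb.2⟩
  | smul c a _ ha =>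
    rw [mul_smul_comm, smul_mul_assoc]
    exact ⟨Submodule.smul_mem _ _ ha.1, Submodule.smul_mem _ _ ha.2⟩

lemma K_anti {m b b' : ℕ} (h : b ≤ b') : D.K m b' ≤ D.K m b :=
  D.K_le_of (D.K_closed m b) fun b'' h1 h2 => Submodule.subset_span
    ⟨1, one_mem _, 1, one_mem _, b'', by omega, h2, by simp⟩

/-- The target of the letter `r` following the initial word. -/
def Jt (m b : ℕ) (r : ZMod l) : Submodule R A :=
  if r = 1 - (b : ZMod l) ∧ 2 * b < m then D.K (m + 1) (b + 1) else ⊥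

lemma Jt_closed (m b : ℕ) (r : ZMod l) : D.Closed (m + 1) (D.Jt m b r) := by
  rw [Jt]; split_ifs
  · exact D.K_closed _ _
  · exact D.closed_bot _

/-- Any letter other than the next first-column residue leads to `Jt`. -/
def Good (m b : ℕ) : Prop :=
  ∀ r : ZMod l, r ≠ -((m - b : ℕ) : ZMod l) → D.E (r :: wordIni l b m) ∈ D.Jt m b r

lemma K_mono_of_good {m b : ℕ} (h : ∀ b', b ≤ b' → 2 * b' ≤ m → D.Good m b') :
    D.K m b ≤ D.K (m + 1) b := by
  refine Submodule.span_le.2 ?_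
  rintro _ ⟨x, hx, y, hy, b', h1, h2, rfl⟩
  have e : D.J b' m = ∑ a, D.E (a :: wordIni l b' m) := by
    simp only [E_cons]; rw [← Finset.mul_sum, D.P_sum, mul_one]; rfl
  rw [e, Finset.mul_sum, Finset.sum_mul]
  refine Submodule.sum_mem _ fun a _ => ?_
  refine (D.K_closed _ _ y (D.Alg_mono (by omega) hy) _
    (D.K_closed _ _ x (D.Alg_mono (by omega) hx) _ ?_).1).2
  by_cases ha : a = -((m - b' : ℕ) : ZMod l)
  · rw [ha, ← wordIni_ge h2]
    exact D.K_anti h1 (D.J_mem_K (by omega))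
  · have := h b' h1 h2 a ha
    rw [Jt] at this
    split_ifs at this
    · exact D.K_anti (by omega) this
    · rw [Submodule.mem_bot] at this; rw [this]; exact zero_mem _

lemma Jt_mono_of_good {m b : ℕ} (h : ∀ b', b + 1 ≤ b' → 2 * b' ≤ m + 1 → D.Good (m + 1) b')
    (r : ZMod l) : D.Jt m b r ≤ D.Jt (m + 1) b r := by
  rw [Jt, Jt]
  by_cases g : r = 1 - (b : ZMod l) ∧ 2 * b < m
  · rw [if_pos g, if_pos ⟨g.1, by omega⟩]
    exact D.K_mono_of_good h
  · rw [if_neg g]; exact bot_le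

/-- The weight element: central in `Alg m`. -/
def Wt (m : ℕ) (r : ZMod l) : A :=
  ((if r = 0 then 1 else 0) + (if r = 1 then 1 else 0) : ℤ) +
    (∑ j ∈ Finset.range m, D.P j (r + 1) - ∑ j ∈ Finset.range m, D.P j r)

lemma sum_P_ψ {m j : ℕ} (h : j + 1 < m) (a : ZMod l) :
    (∑ k ∈ Finset.range m, D.P k a) * D.ψ j = D.ψ j * ∑ k ∈ Finset.range m, D.P k a := by
  rw [Finset.sum_mul, Finset.mul_sum]
  refine Finset.sum_nbij' (Equiv.swap j (j + 1)) (Equiv.swap j (j + 1)) ?_ ?_ ?_ ?_ ?_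
  · intro k hk
    rw [Finset.mem_range] at hk ⊢
    rw [Equiv.swap_apply_def]; split_ifs <;> omega
  · intro k hk
    rw [Finset.mem_range] at hk ⊢
    rw [Equiv.swap_apply_def]; split_ifs <;> omega
  · simp
  · simp
  · intro k _
    by_cases h1 : k = j
    · subst h1; rw [Equiv.swap_apply_left, D.ψP2]
    · by_cases h2 : k = j + 1
      · subst h2; rw [Equiv.swap_apply_right, D.ψP1]
      · rw [Equiv.swap_apply_of_ne_of_ne h1 h2, D.ψP _ _ _ h1 h2]

lemma Wt_comm {m : ℕ} (r : ZMod l) {x : A} (hx : x ∈ D.Alg m) : x * D.Wt m r = D.Wt m r * x := by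
  refine D.Alg_comm_of ?_ ?_ ?_ hx
  · intro j a _
    simp only [Wt, mul_add, add_mul, mul_sub, sub_mul, Finset.mul_sum, Finset.sum_mul, D.P_comm j]
    rw [Int.cast_comm]
  · intro j _
    simp only [Wt, mul_add, add_mul, mul_sub, sub_mul, Finset.mul_sum, Finset.sum_mul, D.Py _ j]
    rw [Int.cast_comm]
  · intro j hj
    simp only [Wt, mul_add, add_mul, mul_sub, sub_mul, D.sum_P_ψ hj]
    rw [Int.cast_comm]

lemma P_E_self (a c : ZMod l) (w : List (ZMod l)) :
    D.P w.length c * D.E (a :: w) = (if c = a then 1 else 0) * D.E (a :: w) := by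
  rw [E_cons, ← mul_assoc, ← E_comm_P, mul_assoc]
  split_ifs with h
  · subst h; rw [D.P_idem, one_mul]
  · rw [D.P_orth _ _ _ h]; simp

lemma Wt_E (r : ZMod l) (w : List (ZMod l)) :
    D.Wt w.length r * D.E w = (wt r w : ℤ) * D.E w := by
  induction w with
  | nil => simp [Wt, wt]
  | cons a w ih =>
    have : D.Wt (a :: w).length r =
        D.Wt w.length r + (D.P w.length (r + 1) - D.P w.length r) := by
      simp only [Wt, List.length_cons, Finset.sum_range_succ]; abel
    rw [this, add_mul, sub_mul, P_E_self, P_E_self, wt]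
    rw [E_cons, ← mul_assoc, ih]
    push_cast
    noncomm_ring

lemma mul_P_eq_zero_of_wt (h2 : IsUnit (2 : R)) {m b : ℕ}
    (hg : ∀ b', b ≤ b' → 2 * b' ≤ m → D.Good m b') (r : ZMod l)
    {z : A} (hz : z ∈ D.K m b) (hw : D.Wt m r * z = 0) : z * D.P m r = 0 := by
  have main : ∀ z ∈ D.K m b, (D.Wt m r - 1) * (D.Wt m r - 2) * (z * D.P m r) = 0 := by
    intro z hz
    induction hz using Submodule.span_induction with
    | mem z hz =>
      obtain ⟨x, hx, y, hy, b', h1, h2, rfl⟩ := hz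
      have c : (D.Wt m r - 1) * (D.Wt m r - 2) * (x * D.J b' m * y * D.P m r) =
          x * ((D.Wt m r - 1) * (D.Wt m r - 2) * D.J b' m * D.P m r) * y := by
        have cx := D.Wt_comm r hx
        rw [mul_assoc _ y, D.Alg_comm_P le_rfl r hy]
        have : (D.Wt m r - 1) * (D.Wt m r - 2) * x = x * ((D.Wt m r - 1) * (D.Wt m r - 2)) := by
          have e : (D.Wt m r - 2) * x = x * (D.Wt m r - 2) := by
            rw [sub_mul, mul_sub, cx, mul_two, two_mul]
          have e' : (D.Wt m r - 1) * x = x * (D.Wt m r - 1) := by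
            rw [sub_mul, mul_sub, cx, mul_one, one_mul]
          rw [mul_assoc, e, ← mul_assoc, e', mul_assoc]
        simp only [← mul_assoc]
        rw [this]
        simp only [mul_assoc]
      rw [c]
      have hW : D.Wt m r * D.J b' m = (wt r (wordIni l b' m) : ℤ) * D.J b' m := by
        have := D.Wt_E r (wordIni l b' m); rwa [wordIni_length] at this
      have hW2 : (D.Wt m r - 1) * (D.Wt m r - 2) * D.J b' m =
          (((wt r (wordIni l b' m) - 1) * (wt r (wordIni l b' m) - 2) : ℤ) : A) * D.J b' m := by
        set w := wt r (wordIni l b' m)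
        have e : (D.Wt m r - 2) * D.J b' m = ((w - 2 : ℤ) : A) * D.J b' m := by
          rw [sub_mul, hW]; push_cast; rw [sub_mul]
        have e' : (D.Wt m r - 1) * D.J b' m = ((w - 1 : ℤ) : A) * D.J b' m := by
          rw [sub_mul, hW]; push_cast; rw [sub_mul]
        rw [mul_assoc, e, ← mul_assoc, ← Int.cast_comm, mul_assoc, e', ← mul_assoc, ← Int.cast_mul,
          mul_comm]
      rw [hW2, wt_wordIni r h2]
      by_cases g1 : r = -((m - b' : ℕ) : ZMod l)
      · rw [if_pos g1]; split_ifs <;> simp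
      · by_cases g2 : r = 1 - (b' : ZMod l)
        · rw [if_neg g1, if_pos g2]; simp
        · have := hg b' h1 h2 r g1
          rw [Jt, if_neg (by tauto), Submodule.mem_bot, E_cons, wordIni_length] at this
          rw [mul_assoc _ (D.J b' m), J, this]
          simp
    | zero => simp
    | add a b _ _ ha hb => rw [add_mul, mul_add, ha, hb, add_zero]
    | smul c a _ ha => rw [smul_mul_assoc, mul_smul_comm, ha, smul_zero]
  have h := main z hz
  have e : (D.Wt m r - 1) * (D.Wt m r - 2) * (z * D.P m r) = (2 : R) • (z * D.P m r) := by
    have e1 : (D.Wt m r - 1) * (D.Wt m r - 2) * z = 2 * z := by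
      have : (D.Wt m r - 1) * (D.Wt m r - 2) * z =
        (D.Wt m r - 3) * (D.Wt m r * z) + 2 * z := by noncomm_ring
      rw [this, hw, mul_zero, zero_add]
    rw [← mul_assoc, e1, two_mul, two_smul, add_mul]
  rw [e] at h
  exact (IsUnit.smul_eq_zero h2).1 h

end TLData

namespace TLData

variable {l n : ℕ} [NeZero l] {R A : Type*} [CommRing R] [Ring A] [Algebra R A] {ξ : R}
  {D : TLData l n R A ξ}

lemma good_zero : D.Good 0 0 := by
  intro r hr
  have : r ≠ 0 := by simpa using hr
  simp [E_cons, D.P_zero r this]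

/-- `Good` when the two columns have equal length. -/
lemma good_even (hl : 5 ≤ l) (b : ℕ) (hn : 2 * b + 3 ≤ n)
    (ih : ∀ m' b', m' < 2 * b + 2 → 2 * b' ≤ m' → D.Good m' b') :
    D.Good (2 * b + 2) (b + 1) := by
  obtain ⟨c1, c2, c3, c4⟩ := small_ne_zero hl
  intro r hr
  rw [show 2 * b + 2 - (b + 1) = b + 1 by omega] at hr
  push_cast at hr
  obtain ⟨k, hk⟩ : ∃ k : ZMod l, k = -(b : ZMod l) := ⟨_, rfl⟩
  have hrk : r ≠ k - 1 := by rw [hk]; intro h; exact hr (by rw [h]; ring)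
  set w0 := wordIni l b (2 * b) with hw0
  have hW : wordIni l (b + 1) (2 * b + 2) = (k + 1) :: k :: w0 := by
    rw [wordIni_two, hk]; congr 1; ring
  have hW1 : wordIni l b (2 * b + 1) = k :: w0 := by
    rw [wordIni_ge (by omega), show 2 * b - b = b by omega, hk]
  have hl0 : w0.length = 2 * b := wordIni_length _ _ _
  have g0 : ∀ s : ZMod l, s ≠ k → D.E (s :: w0) = 0 := by
    intro s hs
    have := ih (2 * b) b (by omega) le_rfl s (by
      rw [show 2 * b - b = b by omega, ← hk]; exact hs)
    rw [Jt, if_neg (by omega)] at this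
    exact this
  have g1 : ∀ s : ZMod l, s ≠ k - 1 → s ≠ k + 1 → D.E (s :: k :: w0) = 0 := by
    intro s hs hs'
    have := ih (2 * b + 1) b (by omega) (by omega) s (by
      rw [show 2 * b + 1 - b = b + 1 by omega]; push_cast
      intro h; apply hs; rw [h, hk]; ring)
    rw [Jt, if_neg, hW1] at this
    · exact this
    · rintro ⟨h, -⟩; apply hs'; rw [h, hk]; ring
  have cl : D.Closed (2 * b + 3) ⊥ := D.closed_bot _
  have suf : ∀ {v w : List (ZMod l)}, v.length + w.length ≤ 2 * b + 3 → D.E w = 0 →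
      D.E (v ++ w) ∈ (⊥ : Submodule R A) := fun hvw h => E_suffix cl hvw h
  rw [Jt, if_neg (by omega), hW]
  by_cases r1 : r = k + 1
  · subst r1
    refine pair_last cl hn (a := k + 1) (b := k) (w := w0) (by omega) (by grind) (by grind) ?_
    exact suf (v := [k + 1, k]) (by simp; omega) (g0 (k + 1) (by grind))
  by_cases r2 : r = k
  · subst r2
    refine braid_triple cl hn (a := r) (b := r + 1) (w := w0) (by omega) (by grind) ?_ ?_
    · exact suf (v := [r + 1]) (by simp; omega) (g1 r (by grind) (by grind))
    · exact suf (v := [r, r]) (by simp; omega) (g0 (r + 1) (by grind))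
  by_cases r3 : r = k + 2
  swap
  · refine swap_far cl hn (v := []) (a := k + 1) (b := r) (w := k :: w0)
      (by simp; omega) r1 (by grind) (by grind) ?_
    exact suf (v := [k + 1]) (by simp; omega) (g1 r (by grind) (by grind))
  subst r3
  rcases b with _ | b
  · have : k = 0 := by rw [hk]; simp
    subst this
    have hb := D.bad
    simp only [hw0]
    simpa [E_cons] using hb
  set w1 := wordIni l b (2 * b) with hw1
  have hl1 : w1.length = 2 * b := wordIni_length _ _ _
  have e0 : w0 = (k + 2) :: (k + 1) :: w1 := by
    rw [hw0, show 2 * (b + 1) = 2 * b + 2 by ring, wordIni_two, hk]; push_cast; congr 1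
    · ring
    · congr 1; ring
  have h1 : D.E (k :: w1) = 0 := by
    have := ih (2 * b) b (by omega) le_rfl k (by
      rw [show 2 * b - b = b by omega, hk]; push_cast; grind)
    rw [Jt, if_neg (by omega)] at this
    exact this
  have h2 : D.E ((k + 1) :: (k + 1) :: w1) = 0 := by
    have := ih (2 * b + 1) b (by omega) (by omega) (k + 1) (by
      rw [show 2 * b + 1 - b = b + 1 by omega, hk]; push_cast; grind)
    rw [Jt, if_neg, wordIni_ge (by omega), show 2 * b - b = b by omega,
      show -(b : ZMod l) = k + 1 by rw [hk]; push_cast; ring] at this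
    · exact this
    · rw [hk]; push_cast; grind
  have h3 : D.E ((k + 1) :: k :: (k + 1) :: w1) ∈ (⊥ : Submodule R A) := by
    refine braid_triple cl hn (a := k + 1) (b := k) (w := w1) (by omega) (by grind) ?_ ?_
    · exact suf (v := [k]) (by simp; omega) h2
    · exact suf (v := [k + 1, k + 1]) (by simp; omega) h1
  have h4 : D.E ((k + 2) :: (k + 2) :: k :: (k + 1) :: w1) ∈ (⊥ : Submodule R A) := by
    refine swap_far cl hn (v := [k + 2]) (a := k) (b := k + 2) (w := (k + 1) :: w1)
      (by simp; omega) (by grind) (by grind) (by grind) ?_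
    refine swap_far cl hn (v := []) (a := k) (b := k + 2) (w := (k + 2) :: (k + 1) :: w1)
      (by simp; omega) (by grind) (by grind) (by grind) ?_
    rw [← e0]
    exact suf (v := [k]) (by simp; omega) (g0 (k + 2) (by grind))
  rw [e0]
  refine swap_far cl hn (v := [k + 2, k + 1]) (a := k + 2) (b := k) (w := (k + 1) :: w1)
    (by simp; omega) (by grind) (by grind) (by grind) ?_
  refine braid_triple cl hn (a := k + 2) (b := k + 1) (w := k :: (k + 1) :: w1)
    (by simp; omega) (by grind) ?_ ?_
  · exact suf (v := [k + 1]) (by simp; omega) h4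
  · exact suf (v := [k + 2, k + 2]) (by simp; omega) h3

/-- `Good` when the column lengths differ by one. -/
lemma good_odd (hl : 5 ≤ l) (b : ℕ) (hn : 2 * b + 2 ≤ n)
    (ih : ∀ m' b', m' < 2 * b + 1 → 2 * b' ≤ m' → D.Good m' b') :
    D.Good (2 * b + 1) b := by
  obtain ⟨c1, c2, c3, c4⟩ := small_ne_zero hl
  intro r hr
  obtain ⟨a, ha⟩ : ∃ a : ZMod l, a = -(b : ZMod l) := ⟨_, rfl⟩
  rw [show 2 * b + 1 - b = b + 1 by omega] at hr
  push_cast at hr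
  have hra : r ≠ a - 1 := by rw [ha]; intro h; exact hr (by rw [h]; ring)
  set w0 := wordIni l b (2 * b) with hw0
  have hl0 : w0.length = 2 * b := wordIni_length _ _ _
  have hW : wordIni l b (2 * b + 1) = a :: w0 := by
    rw [wordIni_ge (by omega), show 2 * b - b = b by omega, ha]
  by_cases r1 : r = a + 1
  · rw [Jt, if_pos ⟨by rw [r1, ha]; ring, by omega⟩]
    have : r :: wordIni l b (2 * b + 1) = wordIni l (b + 1) (2 * b + 2) := by
      rw [wordIni_two, hW, r1, ← ha]; congr 1; rw [ha]; ring
    rw [this]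
    exact D.J_mem_K (by omega)
  have cl : D.Closed (2 * b + 2) ⊥ := D.closed_bot _
  have suf : ∀ {v w : List (ZMod l)}, v.length + w.length ≤ 2 * b + 2 → D.E w = 0 →
      D.E (v ++ w) ∈ (⊥ : Submodule R A) := fun hvw h => E_suffix cl hvw h
  rw [Jt, if_neg (by rintro ⟨h, -⟩; apply r1; rw [h, ha]; ring), hW]
  by_cases r2 : r = a
  swap
  · refine swap_far cl hn (v := []) (a := a) (b := r) (w := w0)
      (by simp; omega) r2 (by grind) (by grind) ?_
    refine suf (v := [a]) (by simp; omega) ?_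
    have := ih (2 * b) b (by omega) le_rfl r (by
      rw [show 2 * b - b = b by omega, ← ha]; exact r2)
    rw [Jt, if_neg (by omega)] at this
    exact this
  subst r2
  rcases b with _ | b
  · have : r = 0 := by rw [ha]; simp
    subst this
    exact D.E_zero_zero (by omega)
  set w1 := wordIni l b (2 * b) with hw1
  have hl1 : w1.length = 2 * b := wordIni_length _ _ _
  have e0 : w0 = (r + 2) :: (r + 1) :: w1 := by
    rw [hw0, show 2 * (b + 1) = 2 * b + 2 by ring, wordIni_two, ha]; push_cast; congr 1
    · ring
    · congr 1; ring
  have h1 : D.E (r :: w1) = 0 := by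
    have := ih (2 * b) b (by omega) le_rfl r (by
      rw [show 2 * b - b = b by omega, ha]; push_cast; grind)
    rw [Jt, if_neg (by omega)] at this
    exact this
  rw [e0]
  refine swap_far cl hn (v := [r]) (a := r + 2) (b := r) (w := (r + 1) :: w1)
    (by simp; omega) (by grind) (by grind) (by grind) ?_
  refine swap_far cl hn (v := []) (a := r + 2) (b := r) (w := r :: (r + 1) :: w1)
    (by simp; omega) (by grind) (by grind) (by grind) ?_
  refine E_suffix cl (v := [r + 2]) (by simp; omega) ?_
  refine pair_last cl hn (a := r) (b := r + 1) (w := w1) (by omega) (by grind) (by grind) ?_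
  exact suf (v := [r, r + 1]) (by simp; omega) h1

/-- `Good` when the column lengths differ by at least two. -/
lemma good_step (hl : 5 ≤ l) (h2 : IsUnit (2 : R)) (m b : ℕ) (hb : 2 * b ≤ m) (hn : m + 3 ≤ n)
    (ih : ∀ m' b', m' < m + 2 → 2 * b' ≤ m' → D.Good m' b')
    (ih' : ∀ b', b + 1 ≤ b' → 2 * b' ≤ m + 2 → D.Good (m + 2) b') :
    D.Good (m + 2) b := by
  obtain ⟨c1, c2, c3, c4⟩ := small_ne_zero hl
  intro r hr
  obtain ⟨a, ha⟩ : ∃ a : ZMod l, a = -((m - b : ℕ) : ZMod l) - 1 := ⟨_, rfl⟩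
  have hU1 : -((m + 1 - b : ℕ) : ZMod l) = a := by
    rw [show m + 1 - b = (m - b) + 1 by omega, ha]; push_cast; ring
  have hU0 : -((m - b : ℕ) : ZMod l) = a + 1 := by rw [ha]; ring
  have hU2 : -((m + 2 - b : ℕ) : ZMod l) = a - 1 := by
    rw [show m + 2 - b = (m - b) + 2 by omega, ha]; push_cast; ring
  rw [hU2] at hr
  set w0 := wordIni l b m with hw0
  have hl0 : w0.length = m := wordIni_length _ _ _
  have e1 : wordIni l b (m + 1) = (a + 1) :: w0 := by rw [wordIni_ge hb, hU0]
  have e2 : wordIni l b (m + 2) = a :: (a + 1) :: w0 := by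
    rw [wordIni_ge (by omega), hU1, e1]
  have mono1 : ∀ s : ZMod l, D.Jt (m + 1) b s ≤ D.Jt (m + 2) b s := D.Jt_mono_of_good ih'
  have mono0 : ∀ s : ZMod l, D.Jt m b s ≤ D.Jt (m + 1) b s :=
    D.Jt_mono_of_good fun b' _ h => ih _ _ (by omega) h
  have cl : D.Closed (m + 3) (D.Jt (m + 2) b r) := D.Jt_closed _ _ _
  have g1 : ∀ s : ZMod l, s ≠ a → D.E (s :: (a + 1) :: w0) ∈ D.Jt (m + 2) b s := by
    intro s hs
    have := ih (m + 1) b (by omega) (by omega) s (by rw [hU1]; exact hs)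
    rw [e1] at this
    exact mono1 s this
  rw [e2]
  by_cases r1 : r = a
  · subst r1
    refine pair_last cl hn (a := r) (b := r + 1) (w := w0) (by omega) (by grind) (by grind) ?_
    refine E_suffix cl (v := [r, r + 1]) (by simp; omega) ?_
    exact mono1 r (mono0 r (ih m b (by omega) hb r (by rw [hU0]; grind)))
  by_cases r2 : r = a + 1
  swap
  · refine swap_far cl hn (v := []) (a := a) (b := r) (w := (a + 1) :: w0)
      (by simp; omega) r1 r2 hr ?_
    refine E_suffix cl (v := [a]) (by simp; omega) ?_
    exact g1 r r1
  subst r2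
  refine braid_triple cl hn (a := a + 1) (b := a) (w := w0) (by omega) (by grind) ?_ ?_
  · exact E_suffix cl (v := [a]) (by simp; omega) (g1 (a + 1) (by grind))
  · have h0 := ih m b (by omega) hb a (by rw [hU0]; grind)
    rw [← hw0] at h0
    by_cases g : a = 1 - (b : ZMod l) ∧ 2 * b < m
    · rw [Jt, if_pos g] at h0
      have hK1 : D.E ((a + 1) :: a :: w0) ∈ D.K (m + 2) (b + 1) := by
        have := D.K_mono_of_good (m := m + 1) (b := b + 1) (fun b' _ h => ih _ _ (by omega) h) h0
        exact E_suffix (D.K_closed _ _) (v := [a + 1]) (by simp; omega) this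
      have hz : D.E ((a + 1) :: (a + 1) :: a :: w0) = 0 := by
        rw [E_cons]
        have hlen : ((a + 1) :: a :: w0).length = m + 2 := by simp [hl0]
        rw [hlen]
        refine D.mul_P_eq_zero_of_wt h2 ih' (a + 1) hK1 ?_
        have hw := D.Wt_E (a + 1) ((a + 1) :: a :: w0)
        rw [hlen] at hw
        rw [hw]
        have : wt (a + 1) ((a + 1) :: a :: w0) = wt (a + 1) (wordIni l b (m + 2)) := by
          rw [e2]; simp only [wt]; ring
        rw [this, wt_wordIni _ (by omega), hU2, ← g.1, if_neg (by grind), if_neg (by grind)]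
        simp
      rw [hz]; exact zero_mem _
    · rw [Jt, if_neg g, Submodule.mem_bot] at h0
      refine E_suffix cl (v := [a + 1, a + 1]) (by simp; omega) ?_
      rw [h0]; exact zero_mem _

theorem good (hl : 5 ≤ l) (h2 : IsUnit (2 : R)) :
    ∀ m, m + 1 ≤ n → ∀ b, 2 * b ≤ m → D.Good m b := by
  intro m
  induction m using Nat.strong_induction_on with
  | _ m ih =>
  intro hn
  have ih1 : ∀ m' b', m' < m → 2 * b' ≤ m' → D.Good m' b' :=
    fun m' b' h h' => ih m' h (by omega) b' h'
  have key : ∀ d b, m - b = d → 2 * b ≤ m → D.Good m b := by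
    intro d
    induction d using Nat.strong_induction_on with
    | _ d ihd =>
    intro b hd hb
    have ihb : ∀ b', b + 1 ≤ b' → 2 * b' ≤ m → D.Good m b' :=
      fun b' h h' => ihd (m - b') (by omega) b' rfl h'
    rcases Nat.lt_or_ge m (2 * b + 2) with h | h
    · rcases Nat.lt_or_ge m (2 * b + 1) with h' | h'
      · have : m = 2 * b := by omega
        subst this
        rcases b with _ | b
        · exact good_zero
        · exact good_even hl b (by omega) (fun m' b' h h' => ih1 m' b' (by omega) h')
      · have : m = 2 * b + 1 := by omega
        subst this
        exact good_odd hl b (by omega) ih1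
    · obtain ⟨m, rfl⟩ : ∃ k, m = k + 2 := ⟨m - 2, by omega⟩
      exact good_step hl h2 m b (by omega) (by omega) ih1 ihb
  exact fun b hb => key _ b rfl hb

end TLData

namespace TLData

variable {l n : ℕ} [NeZero l] {R A : Type*} [CommRing R] [Ring A] [Algebra R A] {ξ : R}
  (D : TLData l n R A ξ)

/-- `v` is a highest weight vector of type `(N, b)` modulo `I`. -/
structure Hw (N b : ℕ) (v : A) (I : Submodule R A) : Prop where
  closed : ∀ x ∈ D.Alg N, ∀ z ∈ I, x * z ∈ I
  weight : ∀ j a, j < N → D.P j a * v = if a = resIni l b j then v else 0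
  ψ_high : ∀ j, 2 * b ≤ j → j + 1 < N → D.ψ j * v ∈ I
  ψ_pair : ∀ i, i < b → D.ψ (2 * i) * v ∈ I
  ψ_up : ∀ i, i < b → 2 * i + 2 < N → D.ψ (2 * i) * (D.ψ (2 * i + 1) * v) ∈ I
  ψ_down : ∀ i, i + 1 < b → D.ψ (2 * i + 2) * (D.ψ (2 * i + 1) * v) ∈ I
  y_eig : ∀ j, j < N → ∃ κ : R, D.y j * v - κ • v ∈ I

variable {D}

lemma ne_of_sub {M : Type*} [AddGroup M] {x y c : M} (hc : c ≠ 0) (h : x - y = c) : x ≠ y :=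
  fun e => hc (by rw [← h, e, sub_self])

lemma ne_of_sub' {M : Type*} [AddGroup M] {x y c : M} (hc : c ≠ 0) (h : y - x = c) : x ≠ y :=
  (ne_of_sub hc h).symm

lemma K_mono (hl : 5 ≤ l) (h2 : IsUnit (2 : R)) {m m' b : ℕ} (h : m ≤ m') (hn : m' ≤ n) :
    D.K m b ≤ D.K m' b := by
  induction m', h using Nat.le_induction with
  | base => exact le_rfl
  | succ k hk ih =>
    exact (ih (by omega)).trans (D.K_mono_of_good fun b' _ h => good hl h2 k (by omega) b' h)

lemma one_mem_K (hl : 5 ≤ l) (h2 : IsUnit (2 : R)) : (1 : A) ∈ D.K n 0 :=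
  K_mono hl h2 (Nat.zero_le n) le_rfl (D.J_mem_K (m := 0) (b := 0) le_rfl)

lemma J_lift_zero {m m' b : ℕ} (h : m ≤ m') {x : A} (hx : x * D.J b m = 0) :
    x * D.J b m' = 0 := by
  induction m', h using Nat.le_induction with
  | base => exact hx
  | succ k hk ih => rw [J_succ, ← mul_assoc, ih, zero_mul]

lemma J_lift_eq {m m' b : ℕ} (h : m ≤ m') {x y : A} (hx : x * D.J b m = y * D.J b m) :
    x * D.J b m' = y * D.J b m' := by
  have := J_lift_zero h (x := x - y) (by rw [sub_mul, hx, sub_self])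
  rwa [sub_mul, sub_eq_zero] at this

lemma J_lift_K (hl : 5 ≤ l) (h2 : IsUnit (2 : R)) {m m' b b' : ℕ} (h : m ≤ m') (hn : m' ≤ n)
    {x : A} (hx : x * D.J b m ∈ D.K m b') : x * D.J b m' ∈ D.K m' b' := by
  induction m', h using Nat.le_induction with
  | base => exact hx
  | succ k hk ih =>
    rw [J_succ, ← mul_assoc]
    exact (D.K_closed _ _ _ (D.P_mem (by omega) _) _
      (K_mono hl h2 (Nat.le_succ k) hn (ih (by omega)))).2

lemma P_J {m b j : ℕ} (h : j < m) (a : ZMod l) :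
    D.P j a * D.J b m = if a = resIni l b j then D.J b m else 0 := by
  have := D.P_E_self (resIni l b j) a (wordIni l b j)
  rw [wordIni_length, ← wordIni_succ] at this
  have := J_lift_eq (b := b) (m := j + 1) (m' := m) (by omega) this
  rw [this]; split_ifs <;> simp

lemma wordIni_two_of_lt {b i : ℕ} (h : i < b) : wordIni l b (2 * i + 2) =
    (1 - (i : ZMod l)) :: -(i : ZMod l) :: wordIni l i (2 * i) := by
  rw [wordIni_eq (b := i + 1) (by omega) (by omega), wordIni_two]

lemma wordIni_three_of_lt {b i : ℕ} (h : i < b) : wordIni l b (2 * i + 3) =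
    (-(i : ZMod l) - 1) :: (1 - (i : ZMod l)) :: -(i : ZMod l) :: wordIni l i (2 * i) := by
  rw [wordIni_eq (b := i + 1) (by omega) (by omega), wordIni_ge (by omega), wordIni_two,
    show 2 * i + 2 - (i + 1) = i + 1 by omega]
  push_cast
  congr 1; ring

lemma E_letter_zero (hl : 5 ≤ l) (h2 : IsUnit (2 : R)) {i : ℕ} (hi : 2 * i + 1 ≤ n) (r : ZMod l)
    (hr : r ≠ -(i : ZMod l)) : D.E (r :: wordIni l i (2 * i)) = 0 := by
  have := good (D := D) hl h2 (2 * i) hi i le_rfl r (by rwa [show 2 * i - i = i by omega])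
  rwa [Jt, if_neg (by omega)] at this

lemma E_suffix_zero {v w : List (ZMod l)} (h : D.E w = 0) : D.E (v ++ w) = 0 :=
  E_suffix (D.closed_bot (v.length + w.length)) le_rfl h

lemma ψ_high_J (hl : 5 ≤ l) (h2 : IsUnit (2 : R)) {j b : ℕ} (hb : 2 * b ≤ j) (hj : j + 1 < n) :
    D.ψ j * D.J b n ∈ D.K n (b + 1) := by
  obtain ⟨c1, c2, c3, c4⟩ := small_ne_zero hl
  refine J_lift_K hl h2 (m := j + 2) (by omega) le_rfl ?_
  set a : ZMod l := -((j + 1 - b : ℕ) : ZMod l) with ha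
  have hU : -((j - b : ℕ) : ZMod l) = a + 1 := by
    rw [ha, show j + 1 - b = (j - b) + 1 by omega]; push_cast; ring
  have e : D.J b (j + 2) = D.E (a :: (a + 1) :: wordIni l b j) := by
    rw [J, wordIni_ge (by omega), wordIni_ge hb, hU]
  have s := D.ψ_E (a + 1) a (wordIni l b j)
  rw [wordIni_length] at s
  rw [e, s]
  have g := good (D := D) hl h2 j (by omega) b hb a (by rw [hU]; grind)
  have : D.E (a :: wordIni l b j) ∈ D.K (j + 1) (b + 1) := by
    rw [Jt] at g
    split_ifs at g
    · exact g
    · rw [Submodule.mem_bot] at g; rw [g]; exact zero_mem _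
  have := K_mono hl h2 (Nat.le_succ (j + 1)) (by omega) this
  exact (D.K_closed _ _ _ (D.ψ_mem (by omega)) _
    (E_suffix (D.K_closed (j + 2) (b + 1)) (v := [a + 1]) (by simp; omega) this)).2

lemma ψ_pair_J (hl : 5 ≤ l) (h2 : IsUnit (2 : R)) {i b : ℕ} (hi : i < b) (hb : 2 * b ≤ n) :
    D.ψ (2 * i) * D.J b n = 0 := by
  obtain ⟨c1, c2, c3, c4⟩ := small_ne_zero hl
  refine J_lift_zero (m := 2 * i + 2) (by omega) ?_
  have s := D.ψ_E (-(i : ZMod l)) (1 - (i : ZMod l)) (wordIni l i (2 * i))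
  rw [wordIni_length] at s
  rw [J, wordIni_two_of_lt hi, s]
  have := E_suffix_zero (v := [-(i : ZMod l)])
    (E_letter_zero (D := D) hl h2 (i := i) (by omega) (1 - (i : ZMod l)) (ne_of_sub c1 (by ring)))
  simp only [List.cons_append, List.nil_append] at this
  rw [this, zero_mul]

lemma ψ_up_J (hl : 5 ≤ l) (h2 : IsUnit (2 : R)) {i b : ℕ} (hi : i < b) (hb : 2 * i + 2 < n) :
    D.ψ (2 * i) * D.ψ (2 * i + 1) * D.J b n = 0 := by
  obtain ⟨c1, c2, c3, c4⟩ := small_ne_zero hl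
  refine J_lift_zero (m := 2 * i + 3) (by omega) ?_
  set a : ZMod l := -(i : ZMod l) with ha
  have s := D.ψ_E (1 - (i : ZMod l)) (a - 1) (a :: wordIni l i (2 * i))
  have s' := D.ψ_E_append a (a - 1) (wordIni l i (2 * i)) [1 - (i : ZMod l)]
  simp only [List.length_cons, wordIni_length, List.cons_append, List.nil_append] at s s'
  rw [J, wordIni_three_of_lt hi, mul_assoc, s, ← mul_assoc, s']
  have := E_suffix_zero (v := [1 - (i : ZMod l), a])
    (E_letter_zero (D := D) hl h2 (i := i) (by omega) (a - 1) (ne_of_sub' c1 (by rw [ha]; ring)))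
  simp only [List.cons_append, List.nil_append] at this
  rw [this, zero_mul, zero_mul]

lemma ψ_down_J (hl : 5 ≤ l) (h2 : IsUnit (2 : R)) {i b : ℕ} (hi : i + 1 < b) (hb : 2 * b ≤ n) :
    D.ψ (2 * i + 2) * D.ψ (2 * i + 1) * D.J b n = 0 := by
  obtain ⟨c1, c2, c3, c4⟩ := small_ne_zero hl
  refine J_lift_zero (m := 2 * i + 4) (by omega) ?_
  set a : ZMod l := -(i : ZMod l) with ha
  have s := D.ψ_E_append (1 - (i : ZMod l)) (a - 1) (a :: wordIni l i (2 * i)) [a]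
  have s' := D.ψ_E (1 - (i : ZMod l)) a ((a - 1) :: a :: wordIni l i (2 * i))
  simp only [List.length_cons, wordIni_length, List.cons_append, List.nil_append] at s s'
  have e : wordIni l b (2 * i + 4) = a :: (a - 1) :: (1 - (i : ZMod l)) :: a ::
      wordIni l i (2 * i) := by
    rw [show 2 * i + 4 = 2 * (i + 1) + 2 by ring, wordIni_two_of_lt hi,
      wordIni_eq (b := i + 1) (b' := i + 1) (by omega) (by omega),
      show 2 * (i + 1) = 2 * i + 2 by ring, wordIni_two]
    push_cast
    rw [ha]
    congr 1
    · ring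
    · congr 1; ring
  rw [J, e, mul_assoc, s, ← mul_assoc, show 2 * i + 2 = 2 * i + 1 + 1 by ring, s']
  have hz := good (D := D) hl h2 (2 * i + 2) (by omega) i (by omega) a (by
    rw [show 2 * i + 2 - i = i + 2 by omega]; push_cast
    exact ne_of_sub c2 (by rw [ha]; ring))
  rw [Jt, if_neg (fun h => ne_of_sub' c1 (by rw [ha]; ring) h.1), Submodule.mem_bot, wordIni_ge (by omega), wordIni_ge (by omega),
    show 2 * i - i = i by omega, show 2 * i + 1 - i = i + 1 by omega] at hz
  push_cast at hz
  rw [show -((i : ZMod l) + 1) = a - 1 by rw [ha]; ring, ← ha] at hz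
  have := E_suffix_zero (v := [1 - (i : ZMod l)]) hz
  simp only [List.cons_append, List.nil_append] at this
  rw [this, zero_mul, zero_mul]

lemma y_J (hl : 5 ≤ l) (h2 : IsUnit (2 : R)) {b : ℕ} (hb : 2 * b ≤ n) :
    ∀ j, j < n → ∃ κ : R, D.y j * D.J b n - κ • D.J b n ∈ D.K n (b + 1) := by
  obtain ⟨c1, c2, c3, c4⟩ := small_ne_zero hl
  intro j
  induction j using Nat.strong_induction_on with
  | _ j ih =>
  intro hj
  have sm : ∀ z : A, algebraMap R A ξ * z = ξ • z := fun z => (Algebra.smul_def _ _).symm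
  rcases j with _ | j
  · exact ⟨0, by rw [D.y_zero]; simp⟩
  rcases Nat.lt_or_ge j (2 * b) with h | h
  · obtain ⟨i, hi⟩ : ∃ i, j = 2 * i ∨ j = 2 * i + 1 := ⟨j / 2, by omega⟩
    obtain ⟨κ, hκ⟩ := ih (2 * i) (by omega) (by omega)
    have hib : i < b := by omega
    rcases hi with rfl | rfl
    · refine ⟨κ + ξ, ?_⟩
      have q := D.psisq_E (-(i : ZMod l)) (1 - (i : ZMod l)) (wordIni l i (2 * i))
        (by rw [wordIni_length]; omega)
      rw [wordIni_length, if_neg (ne_of_sub c1 (by ring)), if_pos (by ring), ← wordIni_two_of_lt hib] at q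
      have q := J_lift_eq (m := 2 * i + 2) (m' := n) (by omega) q
      rw [mul_assoc, ψ_pair_J hl h2 hib hb, mul_zero, sub_mul, sub_mul, sm] at q
      have : D.y (2 * i + 1) * D.J b n = D.y (2 * i) * D.J b n + ξ • D.J b n := by
        rw [eq_comm, sub_sub, sub_eq_zero] at q
        exact q
      rw [this, add_smul, add_sub_add_right_eq_sub]
      exact hκ
    · refine ⟨κ - ξ, ?_⟩
      set w0 := wordIni l i (2 * i)
      set a : ZMod l := -(i : ZMod l) with ha
      have hw : wordIni l b (2 * i + 3) = (a - 1) :: (1 - (i : ZMod l)) :: a :: w0 :=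
        wordIni_three_of_lt hib
      have hl0 : w0.length = 2 * i := wordIni_length _ _ _
      have q := D.psisq_E (1 - (i : ZMod l)) (a - 1) (a :: w0)
        (by simp only [List.length_cons, hl0]; omega)
      rw [if_neg (ne_of_sub' c2 (by rw [ha]; ring)), if_neg (ne_of_sub' c3 (by rw [ha]; ring)), if_neg (ne_of_sub' c1 (by rw [ha]; ring)), one_mul, ← hw,
        List.length_cons, hl0] at q
      have q2 := D.yψ1_E (1 - (i : ZMod l)) (a - 1) (a :: w0)
        (by simp only [List.length_cons, hl0]; omega)
      rw [if_neg (ne_of_sub c2 (by rw [ha]; ring)), add_zero, List.length_cons, hl0] at q2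
      have q2' := D.yψ1_E (a - 1) (1 - (i : ZMod l)) (a :: w0)
        (by simp only [List.length_cons, hl0]; omega)
      rw [if_neg (ne_of_sub' c2 (by rw [ha]; ring)), add_zero, List.length_cons, hl0] at q2'
      have s := D.ψ_E (1 - (i : ZMod l)) (a - 1) (a :: w0)
      rw [List.length_cons, hl0] at s
      have q3 := D.E_append_eq (D.psisq_E a (a - 1) w0 (by omega)) [1 - (i : ZMod l)]
      simp only [List.cons_append, List.nil_append] at q3
      rw [if_neg (ne_of_sub' c1 (by ring)), if_neg (ne_of_sub' c2 (by ring)), if_pos trivial, hl0] at q3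
      have up : D.ψ (2 * i) * D.ψ (2 * i + 1) * D.E ((a - 1) :: (1 - (i : ZMod l)) :: a :: w0) = 0 := by
        have s' := D.ψ_E_append a (a - 1) w0 [1 - (i : ZMod l)]
        simp only [hl0, List.cons_append, List.nil_append] at s'
        rw [mul_assoc, s, ← mul_assoc, s']
        have := E_suffix_zero (v := [1 - (i : ZMod l), a])
          (E_letter_zero (D := D) hl h2 (i := i) (by omega) (a - 1) (ne_of_sub' c1 (by rw [ha]; ring)))
        simp only [List.cons_append, List.nil_append] at this
        rw [this, zero_mul, zero_mul]
      have main : D.y (2 * i + 2) * D.J b (2 * i + 3) = (D.y (2 * i) - algebraMap R A ξ) *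
          D.J b (2 * i + 3) := by
        rw [J, hw]
        rw [hw] at q
        set e := D.E ((a - 1) :: (1 - (i : ZMod l)) :: a :: w0)
        set e' := D.E ((1 - (i : ZMod l)) :: (a - 1) :: a :: w0)
        have t1 : D.y (2 * i + 1) * D.ψ (2 * i + 1) * e =
            (D.y (2 * i) - algebraMap R A ξ) * D.ψ (2 * i + 1) * e := by
          have : (D.y (2 * i) - D.y (2 * i + 1) - algebraMap R A ξ) * (e' * D.ψ (2 * i + 1)) = 0 := by
            rw [← mul_assoc, ← q3, mul_assoc, ← s, mul_assoc, ← mul_assoc (D.ψ (2 * i)) (D.ψ (2 * i + 1)), up,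
              mul_zero]
          rw [← s, sub_right_comm, sub_mul, sub_eq_zero, ← mul_assoc, ← mul_assoc] at this
          exact this.symm
        have t2 : D.ψ (2 * i + 1) * (D.y (2 * i) - algebraMap R A ξ) =
            (D.y (2 * i) - algebraMap R A ξ) * D.ψ (2 * i + 1) := by
          rw [mul_sub, sub_mul, D.ψy _ _ (by omega) (by omega), Algebra.commutes]
        calc D.y (2 * i + 2) * e = D.y (2 * i + 2) * (D.ψ (2 * i + 1) * D.ψ (2 * i + 1) * e) := by
              rw [q]
          _ = D.y (2 * i + 2) * D.ψ (2 * i + 1) * e' * D.ψ (2 * i + 1) := by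
              rw [mul_assoc (D.ψ _), s]; simp only [mul_assoc]
          _ = D.ψ (2 * i + 1) * (D.y (2 * i + 1) * D.ψ (2 * i + 1) * e) := by
              rw [q2', mul_assoc, ← s]; simp only [mul_assoc]
          _ = (D.y (2 * i) - algebraMap R A ξ) * (D.ψ (2 * i + 1) * D.ψ (2 * i + 1) * e) := by
              rw [t1, ← mul_assoc, ← mul_assoc, t2]; simp only [mul_assoc]
          _ = _ := by rw [q]
      have main := J_lift_eq (m := 2 * i + 3) (m' := n) (by omega) main
      rw [show 2 * i + 1 + 1 = 2 * i + 2 by ring, main, sub_mul, sm, sub_smul,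
        sub_sub_sub_cancel_right]
      exact hκ
  · obtain ⟨κ, hκ⟩ := ih j (by omega) (by omega)
    refine ⟨κ - ξ, ?_⟩
    set a : ZMod l := -((j + 1 - b : ℕ) : ZMod l) with ha
    have hU : -((j - b : ℕ) : ZMod l) = a + 1 := by
      rw [ha, show j + 1 - b = (j - b) + 1 by omega]; push_cast; ring
    have e : D.J b (j + 2) = D.E (a :: (a + 1) :: wordIni l b j) := by
      rw [J, wordIni_ge (by omega), wordIni_ge h, hU]
    have q := D.psisq_E (a + 1) a (wordIni l b j) (by rw [wordIni_length]; omega)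
    rw [wordIni_length, if_neg (ne_of_sub' c1 (by ring)), if_neg (ne_of_sub' c2 (by ring)), if_pos (by ring), ← e] at q
    have q := J_lift_eq (m := j + 2) (m' := n) (by omega) q
    have hK := ψ_high_J (D := D) hl h2 h hj
    have hK := (D.K_closed _ _ _ (D.ψ_mem hj) _ hK).1
    rw [← mul_assoc, q, sub_mul, sub_mul, sm] at hK
    have : D.y (j + 1) * D.J b n - (κ - ξ) • D.J b n = (D.y j * D.J b n - κ • D.J b n) -
      (D.y j * D.J b n - D.y (j + 1) * D.J b n - ξ • D.J b n) := by
      rw [sub_smul]; abel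
    rw [this]
    exact sub_mem hκ hK

theorem Hw_J (hl : 5 ≤ l) (h2 : IsUnit (2 : R)) {b : ℕ} (hb : 2 * b ≤ n) :
    D.Hw n b (D.J b n) (D.K n (b + 1)) where
  closed x hx z hz := (D.K_closed _ _ x hx z hz).1
  weight j a h := P_J h a
  ψ_high j h h' := ψ_high_J hl h2 h h'
  ψ_pair i h := by rw [ψ_pair_J hl h2 h hb]; exact zero_mem _
  ψ_up i h h' := by rw [← mul_assoc, ψ_up_J hl h2 h h']; exact zero_mem _
  ψ_down i h := by rw [← mul_assoc, ψ_down_J hl h2 h hb]; exact zero_mem _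
  y_eig := y_J hl h2 hb

end TLData

namespace TLData

variable {l n : ℕ} [NeZero l] {R A : Type*} [CommRing R] [Ring A] [Algebra R A] {ξ : R}
  (D : TLData l n R A ξ)

/-- The product `ψ (s+k-1) ⋯ ψ (s+1) ψ s`. -/
def Rk (s : ℕ) : ℕ → A
  | 0 => 1
  | k + 1 => D.ψ (s + k) * Rk s k

@[simp] lemma Rk_zero (s : ℕ) : D.Rk s 0 = 1 := rfl

lemma Rk_succ (s k : ℕ) : D.Rk s (k + 1) = D.ψ (s + k) * D.Rk s k := rfl

lemma Rk_add (s k m : ℕ) : D.Rk s (k + m) = D.Rk (s + k) m * D.Rk s k := by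
  induction m with
  | zero => simp
  | succ m ih => rw [← add_assoc, Rk_succ, ih, Rk_succ, mul_assoc, add_assoc]

lemma Rk_succ' (s k : ℕ) : D.Rk s (k + 1) = D.Rk (s + 1) k * D.ψ s := by
  rw [add_comm, Rk_add]; simp [Rk_succ]

lemma Rk_mem {s k m : ℕ} (h : k = 0 ∨ s + k < m) : D.Rk s k ∈ D.Alg m := by
  induction k with
  | zero => exact one_mem _
  | succ k ih => exact mul_mem (D.ψ_mem (by omega)) (ih (by omega))

lemma Rk_left_comm {s k : ℕ} {x : A} (hx : ∀ j, s ≤ j → j < s + k → x * D.ψ j = D.ψ j * x)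
    (v : A) : x * (D.Rk s k * v) = D.Rk s k * (x * v) := by
  induction k with
  | zero => simp
  | succ k ih =>
    rw [Rk_succ, mul_assoc, ← mul_assoc, hx _ (by omega) (by omega), mul_assoc,
      ih fun j h h' => hx j h (by omega), mul_assoc]

lemma Rk_ψ {s k j : ℕ} (h : j + 1 < s ∨ s + k < j) (v : A) :
    D.ψ j * (D.Rk s k * v) = D.Rk s k * (D.ψ j * v) := by
  refine D.Rk_left_comm (fun i hi hi' => ?_) v
  rcases h with h | h
  · exact D.ψψ _ _ (by omega)
  · exact (D.ψψ _ _ (by omega)).symm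

lemma Rk_y {s k j : ℕ} (h : j < s ∨ s + k < j) (v : A) :
    D.y j * (D.Rk s k * v) = D.Rk s k * (D.y j * v) :=
  D.Rk_left_comm (fun i hi hi' => (D.ψy i j (by omega) (by omega)).symm) v

/-- `v` is a simultaneous eigenvector of the idempotents with residues `f`. -/
def IsW (N : ℕ) (f : ℕ → ZMod l) (v : A) : Prop :=
  ∀ j a, j < N → D.P j a * v = if a = f j then v else 0

variable {D}

lemma IsW.eq {N : ℕ} {f : ℕ → ZMod l} {v : A} (h : D.IsW N f v) {j : ℕ} (hj : j < N) :
    D.P j (f j) * v = v := by rw [h j _ hj, if_pos rfl]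

lemma IsW.ψ {N : ℕ} {f : ℕ → ZMod l} {v : A} (h : D.IsW N f v) {r : ℕ} (hr : r + 1 < N) :
    D.IsW N (fun j => if j = r then f (r + 1) else if j = r + 1 then f r else f j)
      (D.ψ r * v) := by
  intro j a hj
  by_cases h1 : j = r
  · subst h1
    rw [← mul_assoc, ← D.ψP2, mul_assoc, h _ _ hr]
    simp
  by_cases h2 : j = r + 1
  · subst h2
    rw [← mul_assoc, ← D.ψP1, mul_assoc, h _ _ (by omega)]
    simp
  · rw [← mul_assoc, ← D.ψP _ _ _ h1 h2, mul_assoc, h _ _ hj]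
    simp [h1, h2]

lemma IsW.Rk {N : ℕ} {f : ℕ → ZMod l} {v : A} (h : D.IsW N f v) {s k : ℕ} (hk : s + k < N) :
    D.IsW N (fun j => if j < s then f j else if j < s + k then f (j + 1) else
      if j = s + k then f s else f j) (D.Rk s k * v) := by
  induction k with
  | zero =>
    intro j a hj
    rw [Rk_zero, one_mul, h j a hj]
    simp only [add_zero]
    split_ifs <;> first | rfl | omega | simp_all
  | succ k ih =>
    rw [Rk_succ, mul_assoc]
    intro j a hj
    rw [(ih (by omega)).ψ (by omega) j a hj]
    have e : (if j = s + k then (if s + k + 1 < s then f (s + k + 1) else if s + k + 1 < s + k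
        then f (s + k + 1 + 1) else if s + k + 1 = s + k then f s else f (s + k + 1)) else
        if j = s + k + 1 then (if s + k < s then f (s + k) else if s + k < s + k then f (s + k + 1)
        else if s + k = s + k then f s else f (s + k)) else
        if j < s then f j else if j < s + k then f (j + 1) else
      if j = s + k then f s else f j) = if j < s then f j else if j < s + (k + 1) then f (j + 1)
      else if j = s + (k + 1) then f s else f j := by
      clear ih h; grind
    exact if_congr (Eq.congr_right e) rfl rfl

lemma IsW.d_mul {N : ℕ} {f : ℕ → ZMod l} {v : A} (h : D.IsW N f v) {r : ℕ} (hr : r + 1 < N) :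
    ∃ κ : R, (∑ a, D.P r a * D.P (r + 1) a) * v = κ • v := by
  refine ⟨if f r = f (r + 1) then 1 else 0, ?_⟩
  have : ∀ a, D.P r a * D.P (r + 1) a * v =
      if a = f (r + 1) then (if f r = f (r + 1) then v else 0) else 0 := by
    intro a
    rw [mul_assoc, h _ _ hr]
    split_ifs with h1 h2
    · rw [h _ _ (by omega), if_pos (h1.trans h2.symm)]
    · rw [h _ _ (by omega), if_neg (fun e => h2 (e.symm.trans h1))]
    · rw [mul_zero]
  rw [Finset.sum_mul, Finset.sum_congr rfl fun a _ => this a]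
  simp

lemma IsW.yψ {N : ℕ} {f : ℕ → ZMod l} {v : A} (h : D.IsW N f v) {r : ℕ} (hr : r + 1 < N)
    (hN : N ≤ n) : ∃ κ : R, D.y (r + 1) * (D.ψ r * v) = D.ψ r * (D.y r * v) + κ • v := by
  obtain ⟨κ, hκ⟩ := h.d_mul hr
  exact ⟨κ, by rw [← mul_assoc, D.yψ1 _ (by omega), add_mul, hκ, mul_assoc]⟩

lemma IsW.yψ' {N : ℕ} {f : ℕ → ZMod l} {v : A} (h : D.IsW N f v) {r : ℕ} (hr : r + 1 < N)
    (hN : N ≤ n) : ∃ κ : R, D.y r * (D.ψ r * v) = D.ψ r * (D.y (r + 1) * v) - κ • v := by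
  obtain ⟨κ, hκ⟩ := h.d_mul hr
  exact ⟨κ, by rw [← mul_assoc (D.ψ r), D.ψy1 _ (by omega), add_mul, hκ, mul_assoc,
    add_sub_cancel_right]⟩

lemma IsW.psisq {N : ℕ} {f : ℕ → ZMod l} {v : A} (h : D.IsW N f v) {r : ℕ} (hr : r + 1 < N)
    (hN : N ≤ n) : ∃ α β γ : R,
      D.ψ r * (D.ψ r * v) = α • (D.y r * v) + β • (D.y (r + 1) * v) + γ • v := by
  have e : (D.P r (f r) * D.P (r + 1) (f (r + 1))) * v = v := by
    rw [mul_assoc, h.eq hr, h.eq (by omega)]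
  have q := congrArg (· * v) (D.psisq r (f r) (f (r + 1)) (by omega))
  rw [mul_assoc, e, mul_assoc _ (D.P r _ * _) v, e, mul_assoc] at q
  have sm : algebraMap R A ξ * v = ξ • v := (Algebra.smul_def _ _).symm
  rw [q]
  split_ifs
  · exact ⟨0, 0, 0, by simp⟩
  · exact ⟨-1, 1, -ξ, by rw [sub_mul, sub_mul, sm]; module⟩
  · exact ⟨1, -1, -ξ, by rw [sub_mul, sub_mul, sm]; module⟩
  · exact ⟨0, 0, 1, by simp⟩

lemma IsW.braid {N : ℕ} {f : ℕ → ZMod l} {v : A} (h : D.IsW N f v) {r : ℕ} (hr : r + 2 < N)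
    (hN : N ≤ n) : ∃ κ : R, D.ψ r * (D.ψ (r + 1) * (D.ψ r * v)) =
      D.ψ (r + 1) * (D.ψ r * (D.ψ (r + 1) * v)) + κ • v := by
  have e : (D.P r (f r) * D.P (r + 1) (f (r + 1)) * D.P (r + 2) (f (r + 2))) * v = v := by
    rw [mul_assoc, h.eq hr, mul_assoc, h.eq (by omega), h.eq (by omega)]
  have q := congrArg (· * v) (D.braid r (f r) (f (r + 1)) (f (r + 2)) (by omega))
  rw [mul_assoc, e, mul_assoc _ (D.P r _ * _ * _) v, e, mul_assoc, mul_assoc] at q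
  rw [q, add_mul]
  simp only [mul_assoc _ _ v]
  split_ifs
  · exact ⟨1, by simp [mul_assoc]⟩
  · exact ⟨-1, by simp [mul_assoc]⟩
  · exact ⟨0, by simp [mul_assoc]⟩

lemma Hw.isW {N b : ℕ} {v : A} {I : Submodule R A} (h : D.Hw N b v I) :
    D.IsW N (resIni l b) v := h.weight

/-- Pushing a second descending word through the first one. -/
lemma Hw.Rk_Rk_mem {c p q s k : ℕ} {v : A} {I I' : Submodule R A}
    (h : D.Hw (2 * c + 2 + p) (c + 1) v I) (hI : I ≤ I')
    (hI' : ∀ x ∈ D.Alg (2 * c + 1 + p), ∀ z ∈ I', x * z ∈ I') (hv : 0 < p → v ∈ I')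
    (hq : q < p) (hs : 2 * c + 2 + q ≤ s) (hk : s + k = 2 * c + 1 + p) :
    D.Rk s k * (D.Rk (2 * c + 1) q * v) ∈ I' := by
  rcases k with _ | k
  · rw [Rk_zero, one_mul]
    exact hI' _ (D.Rk_mem (by omega)) _ (hv (by omega))
  · rw [Rk_succ', mul_assoc, D.Rk_ψ (by omega)]
    exact hI (h.closed _ (D.Rk_mem (by omega)) _ (h.closed _ (D.Rk_mem (by omega)) _
      (h.ψ_high _ (by omega) (by omega))))

/-- Removing the last position from a highest weight vector, when it is in the second column. -/
theorem Hw.up {c p : ℕ} {v : A} {I I' : Submodule R A}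
    (h : D.Hw (2 * c + 2 + p) (c + 1) v I) (hn : 2 * c + 2 + p ≤ n) (hI : I ≤ I')
    (hI' : ∀ x ∈ D.Alg (2 * c + 1 + p), ∀ z ∈ I', x * z ∈ I') (hv : 0 < p → v ∈ I') :
    D.Hw (2 * c + 1 + p) c (D.Rk (2 * c + 1) p * v) I' where
  closed := hI'
  weight j a hj := by
    rw [h.isW.Rk (s := 2 * c + 1) (k := p) (by omega) j a (by omega)]
    congr 2
    dsimp only
    split_ifs with h1
    · rcases Nat.lt_or_ge j (2 * c) with h3 | h3
      · simp only [resIni, h3, show j < 2 * (c + 1) by omega, if_true]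
      · obtain rfl : j = 2 * c := by omega
        rw [resIni_even (by omega), resIni_ge le_rfl, show 2 * c - c = c by omega]
    · rw [resIni_ge (by omega), resIni_ge (by omega), show j + 1 - (c + 1) = j - c by omega]
  ψ_high j hj hj' := by
    obtain rfl | ⟨q, rfl⟩ : j = 2 * c ∨ ∃ q, j = 2 * c + 1 + q := by
      rcases Nat.eq_or_lt_of_le hj with h1 | h1
      · exact Or.inl h1.symm
      · exact Or.inr ⟨j - (2 * c + 1), by omega⟩
    · obtain ⟨p, rfl⟩ : ∃ p', p = p' + 1 := ⟨p - 1, by omega⟩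
      rw [Rk_succ', mul_assoc, D.Rk_ψ (by omega)]
      exact hI (h.closed _ (D.Rk_mem (by omega)) _ (h.ψ_up c (by omega) (by omega)))
    · obtain ⟨k, rfl⟩ : ∃ k, p = q + 1 + 1 + k := ⟨p - (q + 2), by omega⟩
      obtain ⟨κ, hκ⟩ := (h.isW.Rk (s := 2 * c + 1) (k := q) (by omega)).braid
        (r := 2 * c + 1 + q) (by omega) hn
      rw [Rk_add, Rk_succ, Rk_succ, mul_assoc, mul_assoc, mul_assoc, D.Rk_ψ (by omega),
        ← add_assoc (2 * c + 1) q 1, hκ, mul_add, mul_smul_comm]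
      refine add_mem ?_ (I'.smul_mem _ ?_)
      · rw [D.Rk_ψ (by omega)]
        exact hI (h.closed _ (D.Rk_mem (by omega)) _ (h.closed _ (D.ψ_mem (by omega)) _
          (h.closed _ (D.ψ_mem (by omega)) _ (h.closed _ (D.Rk_mem (by omega)) _
          (h.ψ_high _ (by omega) (by omega))))))
      · exact h.Rk_Rk_mem hI hI' hv (by omega) (by omega) (by omega)
  ψ_pair i hi := by
    rw [D.Rk_ψ (by omega)]
    exact hI (h.closed _ (D.Rk_mem (by omega)) _ (h.ψ_pair i (by omega)))
  ψ_up i hi hi' := by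
    rw [D.Rk_ψ (by omega), D.Rk_ψ (by omega)]
    exact hI (h.closed _ (D.Rk_mem (by omega)) _ (h.ψ_up i (by omega) (by omega)))
  ψ_down i hi := by
    rw [D.Rk_ψ (by omega), D.Rk_ψ (by omega)]
    exact hI (h.closed _ (D.Rk_mem (by omega)) _ (h.ψ_down i (by omega)))
  y_eig j hj := by
    have key : ∀ j' < 2 * c + 2 + p, ∃ κ : R, D.Rk (2 * c + 1) p * (D.y j' * v) -
        κ • (D.Rk (2 * c + 1) p * v) ∈ I' := by
      intro j' hj'
      obtain ⟨κ, hκ⟩ := h.y_eig j' hj'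
      refine ⟨κ, ?_⟩
      rw [← mul_smul_comm, ← mul_sub]
      exact hI (h.closed _ (D.Rk_mem (by omega)) _ hκ)
    rcases Nat.lt_or_ge j (2 * c + 1) with h1 | h1
    · obtain ⟨κ, hκ⟩ := key j (by omega)
      exact ⟨κ, by rwa [D.Rk_y (Or.inl h1)]⟩
    · obtain ⟨q, rfl⟩ := Nat.exists_eq_add_of_le h1
      obtain ⟨κ, hκ⟩ := key (2 * c + 1 + q + 1) (by omega)
      refine ⟨κ, ?_⟩
      obtain ⟨k, rfl⟩ : ∃ k, p = q + 1 + k := ⟨p - (q + 1), by omega⟩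
      obtain ⟨κ', hκ'⟩ := (h.isW.Rk (s := 2 * c + 1) (k := q) (by omega)).yψ'
        (r := 2 * c + 1 + q) (by omega) hn
      have e : D.y (2 * c + 1 + q) * (D.Rk (2 * c + 1) (q + 1 + k) * v) =
          D.Rk (2 * c + 1) (q + 1 + k) * (D.y (2 * c + 1 + q + 1) * v) -
          κ' • (D.Rk (2 * c + 1 + (q + 1)) k * (D.Rk (2 * c + 1) q * v)) := by
        rw [Rk_add, Rk_succ, mul_assoc, mul_assoc, D.Rk_y (by omega), hκ',
          D.Rk_y (by omega), mul_sub, mul_smul_comm]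
        simp only [mul_assoc]
      rw [e, sub_right_comm]
      exact sub_mem hκ (I'.smul_mem _ (h.Rk_Rk_mem hI hI' hv (by omega) (by omega) (by omega)))

end TLData

namespace TLData

variable {l n : ℕ} [NeZero l] {R A : Type*} [CommRing R] [Ring A] [Algebra R A] {ξ : R}
  (D : TLData l n R A ξ)

/-- The left `Alg m`-module generated by `v`. -/
def cyc (m : ℕ) (v : A) : Submodule R A :=
  (Subalgebra.toSubmodule (D.Alg m)).map (LinearMap.mulRight R v)

lemma cyc_closed {m : ℕ} {v : A} {x : A} (hx : x ∈ D.Alg m) {z : A} (hz : z ∈ D.cyc m v) :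
    x * z ∈ D.cyc m v := by
  obtain ⟨x', hx', rfl⟩ := hz
  exact ⟨x * x', (D.Alg m).mul_mem hx hx', mul_assoc _ _ _⟩

lemma self_mem_cyc (m : ℕ) (v : A) : v ∈ D.cyc m v := ⟨1, (D.Alg m).one_mem, one_mul _⟩

/-- Candidate for the `Alg (M+1)`-module generated by a highest weight vector of type
`(M+1, b)`. -/
def Tm (M b : ℕ) (v : A) (I : Submodule R A) : Submodule R A :=
  (⨆ _ : 2 * b ≤ M, D.cyc M v) ⊔
    (⨆ c, ⨆ _ : b = c + 1, D.cyc M (D.Rk (2 * c + 1) (M - (2 * c + 1)) * v)) ⊔ I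

variable {D} {M b : ℕ} {v : A} {I S : Submodule R A}

lemma Tm_le (h1 : 2 * b ≤ M → ∀ x ∈ D.Alg M, x * v ∈ S)
    (h2 : ∀ c p, b = c + 1 → M = 2 * c + 1 + p → ∀ x ∈ D.Alg M, x * (D.Rk (2 * c + 1) p * v) ∈ S)
    (h3 : I ≤ S) (hb : 2 * b ≤ M + 1) : D.Tm M b v I ≤ S := by
  refine sup_le (sup_le (iSup_le fun h => ?_) (iSup_le fun c => iSup_le fun h => ?_)) h3
  · rintro _ ⟨x, hx, rfl⟩
    exact h1 h x hx
  · rintro _ ⟨x, hx, rfl⟩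
    exact h2 c _ h (by omega) x hx

lemma mem_Tm_left (h : 2 * b ≤ M) {z : A} (hz : z ∈ D.cyc M v) : z ∈ D.Tm M b v I :=
  (le_sup_left.trans le_sup_left : _ ≤ D.Tm M b v I)
    ((le_iSup (fun _ : 2 * b ≤ M => D.cyc M v) h) hz)

lemma mem_Tm_right {c p : ℕ} (hb : b = c + 1) (hM : M = 2 * c + 1 + p) {z : A}
    (hz : z ∈ D.cyc M (D.Rk (2 * c + 1) p * v)) : z ∈ D.Tm M b v I := by
  refine (le_sup_right.trans le_sup_left : _ ≤ D.Tm M b v I)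
    (Submodule.mem_iSup_of_mem c (Submodule.mem_iSup_of_mem hb ?_))
  rwa [show M - (2 * c + 1) = p by omega]

lemma le_Tm : I ≤ D.Tm M b v I := le_sup_right

lemma self_mem_Tm (hb : 2 * b ≤ M + 1) : v ∈ D.Tm M b v I := by
  by_cases h : 2 * b ≤ M
  · exact mem_Tm_left h (D.self_mem_cyc M v)
  · refine mem_Tm_right (c := b - 1) (p := 0) (by omega) (by omega) ?_
    rw [Rk_zero, one_mul]
    exact D.self_mem_cyc M v

lemma Tm_closed (hb : 2 * b ≤ M + 1) (hI : ∀ x ∈ D.Alg (M + 1), ∀ z ∈ I, x * z ∈ I)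
    {x : A} (hx : x ∈ D.Alg M) : ∀ z ∈ D.Tm M b v I, x * z ∈ D.Tm M b v I := by
  refine fun z hz => (Tm_le (S := (D.Tm M b v I).comap (LinearMap.mulLeft R x))
    (fun h x' hx' => ?_) (fun c p hc hp x' hx' => ?_) (fun z hz => ?_) hb) hz
  · exact mem_Tm_left h (D.cyc_closed hx ⟨x', hx', rfl⟩)
  · exact mem_Tm_right hc hp (D.cyc_closed hx ⟨x', hx', rfl⟩)
  · exact le_Tm (hI _ (D.Alg_mono (Nat.le_succ M) hx) _ hz)

lemma Tm_closed_succ (hb : 2 * b ≤ M + 1) (hn : M + 1 ≤ n) (h : D.Hw (M + 1) b v I)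
    (hψ : ∀ j, j + 1 = M → ∀ z ∈ D.Tm M b v I, D.ψ j * z ∈ D.Tm M b v I)
    {x : A} (hx : x ∈ D.Alg (M + 1)) : ∀ z ∈ D.Tm M b v I, x * z ∈ D.Tm M b v I := by
  have hv : v ∈ D.Tm M b v I := self_mem_Tm hb
  have hc := fun x hx => Tm_closed (v := v) hb h.closed (x := x) hx
  have up : ∀ {x}, x ∈ D.Alg M → x ∈ D.Alg (M + 1) := fun hx => D.Alg_mono (Nat.le_succ M) hx
  have hyv : D.y M * v ∈ D.Tm M b v I := by
    obtain ⟨κ, hκ⟩ := h.y_eig M (by omega)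
    have := add_mem (le_Tm (D := D) (M := M) (b := b) (v := v) hκ)
      ((D.Tm M b v I).smul_mem κ hv)
    rwa [sub_add_cancel] at this
  refine D.Alg_induction_left _ (fun j a hj => ?_) (fun j hj => ?_) (fun j hj => ?_) hx
  · rcases Nat.lt_or_ge j M with h1 | h1
    · exact hc _ (D.P_mem h1 a)
    obtain rfl : j = M := by omega
    refine fun z hz => (Tm_le (S := (D.Tm j b v I).comap (LinearMap.mulLeft R (D.P j a)))
      (fun h' x' hx' => ?_) (fun c p h1 hp x' hx' => ?_) (fun z hz => ?_) hb) hz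
    · rw [Submodule.mem_comap, LinearMap.mulLeft_apply]
      rw [← mul_assoc, ← D.Alg_comm_P le_rfl a hx', mul_assoc, h.weight _ _ hj]
      refine hc _ hx' _ ?_
      split_ifs
      exacts [hv, zero_mem _]
    · rw [Submodule.mem_comap, LinearMap.mulLeft_apply]
      rw [← mul_assoc, ← D.Alg_comm_P le_rfl a hx', mul_assoc, h.isW.Rk (by omega) _ _ hj]
      refine hc _ hx' _ ?_
      split_ifs
      exacts [mem_Tm_right h1 hp (D.self_mem_cyc _ _), zero_mem _]
    · exact le_Tm (h.closed _ (D.P_mem hj a) _ hz)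
  · rcases Nat.lt_or_ge j M with h1 | h1
    · exact hc _ (D.y_mem h1)
    obtain rfl : j = M := by omega
    refine fun z hz => (Tm_le (S := (D.Tm j b v I).comap (LinearMap.mulLeft R (D.y j)))
      (fun h' x' hx' => ?_) (fun c p h1 hp x' hx' => ?_) (fun z hz => ?_) hb) hz
    · rw [Submodule.mem_comap, LinearMap.mulLeft_apply]
      rw [← mul_assoc, ← D.Alg_comm_y le_rfl hx', mul_assoc]
      exact hc _ hx' _ hyv
    · rw [Submodule.mem_comap, LinearMap.mulLeft_apply]
      rw [← mul_assoc, ← D.Alg_comm_y le_rfl hx', mul_assoc]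
      refine hc _ hx' _ ?_
      rcases p with _ | p
      · rwa [Rk_zero, one_mul]
      · obtain ⟨κ, hκ⟩ := (h.isW.Rk (s := 2 * c + 1) (k := p) (by omega)).yψ
          (r := 2 * c + 1 + p) (by omega) hn
        have hZ : D.Rk (2 * c + 1) p * v ∈ D.Tm j b v I :=
          mem_Tm_left (by omega) ⟨_, D.Rk_mem (by omega), rfl⟩
        rw [Rk_succ, mul_assoc]
        subst hp
        rw [← add_assoc, hκ]
        exact add_mem (hψ _ rfl _ (hc _ (D.y_mem (by omega)) _ hZ)) (Submodule.smul_mem _ _ hZ)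
    · exact le_Tm (h.closed _ (D.y_mem hj) _ hz)
  · rcases Nat.lt_or_ge (j + 1) M with h1 | h1
    · exact hc _ (D.ψ_mem h1)
    · exact hψ j (by omega)

lemma Hw.restrict (h : D.Hw (M + 1) b v I) : D.Hw M b v I where
  closed x hx := h.closed x (D.Alg_mono (Nat.le_succ M) hx)
  weight j a hj := h.weight j a (by omega)
  ψ_high j hj hj' := h.ψ_high j hj (by omega)
  ψ_pair := h.ψ_pair
  ψ_up i hi hi' := h.ψ_up i hi (by omega)
  ψ_down := h.ψ_down
  y_eig j hj := h.y_eig j (by omega)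

lemma Hw.Rk_Rk_step {e p q : ℕ} (hn : 2 * e + 4 + p ≤ n)
    (h : D.Hw (2 * e + 4 + p) (e + 2) v I) (hq : q < p)
    (hY : D.Rk (2 * e + 1) (p + 2) * (D.Rk (2 * e + 3) q * v) ∈ I) : ∃ κ : R,
    D.Rk (2 * e + 1) (p + 2) * (D.Rk (2 * e + 3) (q + 1) * v) + κ • (D.Rk (2 * e + 4 + q) (p - q - 1) *
      (D.Rk (2 * e + 1) (q + 1) * (D.Rk (2 * e + 3) q * v))) ∈ I := by
  obtain ⟨k, rfl⟩ : ∃ k, p = q + 1 + k := ⟨p - (q + 1), by omega⟩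
  obtain ⟨κ, hκ⟩ := ((h.isW.Rk (s := 2 * e + 3) (k := q) (by omega)).Rk (s := 2 * e + 1)
    (k := q + 1) (by omega)).braid (r := 2 * e + 2 + q) (by omega) hn
  refine ⟨κ, ?_⟩
  have hs : ∀ w : A, D.Rk (2 * e + 1) (q + 1 + k + 2) * w = D.Rk (2 * e + 4 + q) k *
      (D.ψ (2 * e + 2 + q + 1) * (D.ψ (2 * e + 2 + q) * (D.Rk (2 * e + 1) (q + 1) * w))) := by
    intro w
    rw [show q + 1 + k + 2 = q + 1 + 1 + 1 + k by ring, Rk_add, Rk_succ, Rk_succ,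
      show 2 * e + 1 + (q + 1 + 1 + 1) = 2 * e + 4 + q by ring,
      show 2 * e + 1 + (q + 1 + 1) = 2 * e + 2 + q + 1 by ring,
      show 2 * e + 1 + (q + 1) = 2 * e + 2 + q by ring]
    simp only [mul_assoc]
  rw [hs] at hY ⊢
  rw [D.Rk_succ (2 * e + 3) q, mul_assoc, show 2 * e + 3 + q = 2 * e + 2 + q + 1 by ring,
    ← D.Rk_ψ (s := 2 * e + 1) (k := q + 1) (j := 2 * e + 2 + q + 1) (by omega),
    show q + 1 + k - q - 1 = k by omega, ← mul_smul_comm, ← mul_add, ← hκ,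
    ← D.Rk_ψ (s := 2 * e + 4 + q) (k := k) (j := 2 * e + 2 + q) (by omega)]
  exact h.closed _ (D.ψ_mem (by omega)) _ hY

lemma Hw.Rk_Rk_mem_of_lt {e p : ℕ} (hn : 2 * e + 4 + p ≤ n)
    (h : D.Hw (2 * e + 4 + p) (e + 2) v I) : ∀ q, q < p ∨ q = 0 →
    D.Rk (2 * e + 1) (p + 2) * (D.Rk (2 * e + 3) q * v) ∈ I := by
  intro q
  induction q with
  | zero =>
    intro _
    rw [Rk_zero, one_mul, Rk_succ', Rk_succ', mul_assoc, mul_assoc]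
    exact h.closed _ (D.Rk_mem (by omega)) _ (h.ψ_down e (by omega))
  | succ q ih =>
    intro hq
    obtain ⟨κ, hκ⟩ := h.Rk_Rk_step hn (q := q) (by omega) (ih (by omega))
    obtain ⟨k, rfl⟩ : ∃ k, p = q + 1 + 1 + k := ⟨p - (q + 2), by omega⟩
    refine (Submodule.add_mem_iff_left _ (I.smul_mem κ ?_)).1 hκ
    rw [show q + 1 + 1 + k - q - 1 = k + 1 by omega, Rk_succ', mul_assoc, D.Rk_ψ (by omega),
      D.Rk_ψ (by omega)]
    exact h.closed _ (D.Rk_mem (by omega)) _ (h.closed _ (D.Rk_mem (by omega)) _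
      (h.closed _ (D.Rk_mem (by omega)) _ (h.ψ_high _ (by omega) (by omega))))

lemma Hw.Rk_Rk_up {e p : ℕ} (hn : 2 * e + 4 + p ≤ n)
    (h : D.Hw (2 * e + 4 + p) (e + 2) v I) :
    D.Rk (2 * e + 1) (p + 2) * (D.Rk (2 * e + 3) p * v) ∈ D.Tm (2 * e + 3 + p) (e + 2) v I := by
  rcases p with _ | p
  · exact le_Tm (h.Rk_Rk_mem_of_lt hn 0 (Or.inr rfl))
  · obtain ⟨κ, hκ⟩ := h.Rk_Rk_step hn (q := p) (by omega) (h.Rk_Rk_mem_of_lt hn p (by omega))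
    refine (Submodule.add_mem_iff_left _ (Submodule.smul_mem _ κ ?_)).1 (le_Tm hκ)
    rw [show p + 1 - p - 1 = 0 by omega, Rk_zero, one_mul]
    exact mem_Tm_left (by omega) (D.cyc_closed (D.Rk_mem (by omega))
      (D.cyc_closed (D.Rk_mem (by omega)) (D.self_mem_cyc _ _)))

lemma Hw.up_sup {c p : ℕ} (h : D.Hw (2 * c + 2 + p) (c + 1) v I) (hn : 2 * c + 2 + p ≤ n) :
    D.Hw (2 * c + 1 + p) c (D.Rk (2 * c + 1) p * v)
      ((⨆ _ : 2 * (c + 1) ≤ 2 * c + 1 + p, D.cyc (2 * c + 1 + p) v) ⊔ I) := by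
  refine Hw.up (I := I) h hn le_sup_right (fun x hx z hz => ?_) (fun hp => ?_)
  · obtain ⟨z1, h1, z2, h2, rfl⟩ := Submodule.mem_sup.1 hz
    rw [mul_add x]
    refine Submodule.add_mem_sup ?_ (h.closed _ (D.Alg_mono (by omega) hx) _ h2)
    by_cases h3 : 2 * (c + 1) ≤ 2 * c + 1 + p
    · simp only [h3, iSup_pos] at h1 ⊢
      exact D.cyc_closed hx h1
    · simp only [h3, iSup_neg, not_false_eq_true, Submodule.mem_bot] at h1 ⊢
      rw [h1, mul_zero]
  · exact Submodule.mem_sup_left (Submodule.mem_iSup_of_mem (by omega) (D.self_mem_cyc _ _))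

theorem Hw.Tm_closed : ∀ M, M + 1 ≤ n → ∀ b (v : A) (I : Submodule R A), 2 * b ≤ M + 1 →
    D.Hw (M + 1) b v I → ∀ x ∈ D.Alg (M + 1), ∀ z ∈ D.Tm M b v I, x * z ∈ D.Tm M b v I := by
  intro M
  induction M with
  | zero => exact fun hn b v I hb h x hx => Tm_closed_succ hb hn h (fun j hj => by omega) hx
  | succ m ih =>
    intro hn b v I hb h x hx
    refine Tm_closed_succ hb hn h (fun j hj => ?_) hx
    obtain rfl : j = m := by omega
    have hv : 2 * b ≤ j + 1 → ∀ x ∈ D.Alg (j + 1), D.ψ j * (x * v) ∈ D.Tm (j + 1) b v I := by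
      intro hb' x hx
      have hm := ih (by omega) b v I hb' h.restrict x hx v (self_mem_Tm hb')
      refine (Tm_le (S := (D.Tm (j + 1) b v I).comap (LinearMap.mulLeft R (D.ψ j)))
        (fun h' x' hx' => ?_) (fun c p hc hp x' hx' => ?_) (fun z hz => ?_) hb') hm
      · rw [Submodule.mem_comap, LinearMap.mulLeft_apply]
        rw [← mul_assoc, ← D.Alg_comm_ψ le_rfl hx', mul_assoc]
        exact le_Tm (h.closed _ (D.Alg_mono (by omega) hx') _ (h.ψ_high j h' (by omega)))
      · rw [Submodule.mem_comap, LinearMap.mulLeft_apply]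
        rw [← mul_assoc, ← D.Alg_comm_ψ le_rfl hx', mul_assoc]
        refine mem_Tm_right (p := p + 1) hc (by omega) ⟨x', D.Alg_mono (by omega) hx', ?_⟩
        rw [LinearMap.mulRight_apply, Rk_succ, hp, mul_assoc]
      · exact le_Tm (h.closed _ (D.ψ_mem (by omega)) _ hz)
    refine fun z hz => (Tm_le (S := (D.Tm (j + 1) b v I).comap (LinearMap.mulLeft R (D.ψ j)))
      (fun h' x' hx' => hv h' x' hx') (fun c p hc hp x' hx' => ?_) (fun z hz => ?_) hb) hz
    swap
    · exact le_Tm (h.closed _ (D.ψ_mem (by omega)) _ hz)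
    rw [Submodule.mem_comap, LinearMap.mulLeft_apply]
    subst hc
    obtain rfl : j = 2 * c + p := by omega
    have hu := Hw.up_sup (D := D) (c := c) (p := p) (v := v) (I := I)
      (by convert h using 1; omega) (by omega)
    rw [show 2 * c + 1 + p = 2 * c + p + 1 by ring] at hu
    have hm := ih (by omega) c _ _ (by omega) hu x' hx' _ (self_mem_Tm (by omega))
    refine (Tm_le (S := (D.Tm (2 * c + p + 1) (c + 1) v I).comap
      (LinearMap.mulLeft R (D.ψ (2 * c + p))))
      (fun h' x' hx' => ?_) (fun e p' he hp' x' hx' => ?_) (fun z hz => ?_) (by omega)) hm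
    · rw [Submodule.mem_comap, LinearMap.mulLeft_apply]
      rw [← mul_assoc, ← D.Alg_comm_ψ le_rfl hx', mul_assoc]
      refine TLData.Tm_closed hb h.closed (D.Alg_mono (Nat.le_succ _) hx') _ ?_
      rcases p with _ | p
      · rw [Rk_zero, one_mul]
        exact le_Tm (h.ψ_pair c (by omega))
      · obtain ⟨α, β, γ, hq⟩ := (h.isW.Rk (s := 2 * c + 1) (k := p) (by omega)).psisq
          (r := 2 * c + 1 + p) (by omega) hn
        have hZ : D.Rk (2 * c + 1) p * v ∈ D.Tm (2 * c + (p + 1) + 1) (c + 1) v I :=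
          mem_Tm_left (by omega) ⟨_, D.Rk_mem (by omega), rfl⟩
        rw [Rk_succ, mul_assoc, show 2 * c + (p + 1) = 2 * c + 1 + p by ring, hq]
        rw [show 2 * c + (p + 1) + 1 = 2 * c + 1 + p + 1 by ring] at hZ
        refine add_mem (add_mem (Submodule.smul_mem _ _ ?_) (Submodule.smul_mem _ _ ?_))
          (Submodule.smul_mem _ _ hZ)
        · exact TLData.Tm_closed (by omega) (by
            convert h.closed using 4; omega) (D.y_mem (by omega)) _ hZ
        · obtain ⟨κ, hκ⟩ := h.y_eig (2 * c + 1 + p + 1) (by omega)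
          have := h.closed _ (D.Rk_mem (s := 2 * c + 1) (k := p) (by omega)) _ hκ
          rw [mul_sub, mul_smul_comm, ← D.Rk_y (by omega)] at this
          have := add_mem (le_Tm (D := D) (M := 2 * c + 1 + p + 1) (b := c + 1) (v := v) this)
            (Submodule.smul_mem _ κ hZ)
          rwa [sub_add_cancel] at this
    · rw [Submodule.mem_comap, LinearMap.mulLeft_apply]
      rw [← mul_assoc, ← D.Alg_comm_ψ le_rfl hx', mul_assoc]
      refine TLData.Tm_closed hb h.closed (D.Alg_mono (Nat.le_succ _) hx') _ ?_
      subst he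
      obtain rfl : p' = p + 1 := by omega
      have := Hw.Rk_Rk_up (D := D) (e := e) (p := p) (v := v) (I := I) (by omega)
        (by convert h using 1; omega)
      rw [D.Rk_succ (2 * e + 1), mul_assoc] at this
      rwa [show 2 * (e + 1) + p + 1 = 2 * e + 3 + p by ring,
        show 2 * (e + 1) + p = 2 * e + 1 + (p + 1) by ring]
    · obtain ⟨z1, h1, z2, h2, rfl⟩ := Submodule.mem_sup.1 hz
      rw [Submodule.mem_comap, LinearMap.mulLeft_apply]
      rw [mul_add]
      refine add_mem ?_ (le_Tm (h.closed _ (D.ψ_mem (by omega)) _ h2))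
      by_cases h3 : 2 * (c + 1) ≤ 2 * c + p + 1
      · simp only [h3, iSup_pos] at h1
        obtain ⟨x, hx, rfl⟩ := h1
        exact hv h3 x hx
      · simp only [h3, iSup_neg, not_false_eq_true, Submodule.mem_bot] at h1
        rw [h1, mul_zero]
        exact zero_mem _

end TLData

/-- The number of indices below `k` at which `t` is `true`. -/
def cnt (t : ℕ → Bool) : ℕ → ℕ
  | 0 => 0
  | k + 1 => cnt t k + if t k then 1 else 0

/-- The ballot condition up to `N`. -/
def Ballot (N : ℕ) (t : ℕ → Bool) : Prop := ∀ k ≤ N, 2 * cnt t k ≤ k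

lemma cnt_congr {t t' : ℕ → Bool} {N : ℕ} (h : ∀ k < N, t k = t' k) : cnt t N = cnt t' N := by
  induction N with
  | zero => rfl
  | succ N ih => rw [cnt, cnt, ih fun k hk => h k (by omega), h N (by omega)]

lemma Ballot.congr {t t' : ℕ → Bool} {N : ℕ} (h : ∀ k < N, t k = t' k) (ht : Ballot N t) :
    Ballot N t' := fun k hk => by
  rw [← cnt_congr fun i hi => h i (by omega)]
  exact ht k hk

lemma Ballot.mono {t : ℕ → Bool} {N M : ℕ} (ht : Ballot N t) (h : M ≤ N) : Ballot M t :=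
  fun k hk => ht k (hk.trans h)

lemma update_eq_of_lt (t : ℕ → Bool) (N : ℕ) (a : Bool) : ∀ k < N, t k = Function.update t N a k :=
  fun k hk => by rw [Function.update_of_ne (by omega)]

lemma cnt_update (t : ℕ → Bool) (N : ℕ) (a : Bool) :
    cnt (Function.update t N a) (N + 1) = cnt t N + if a then 1 else 0 := by
  rw [cnt, Function.update_self, ← cnt_congr (update_eq_of_lt t N a)]

lemma Ballot.update {t : ℕ → Bool} {N : ℕ} (ht : Ballot N t) (a : Bool)
    (h : 2 * (cnt t N + if a then 1 else 0) ≤ N + 1) :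
    Ballot (N + 1) (Function.update t N a) := fun k hk => by
  rcases Nat.lt_or_ge N k with h1 | h1
  · obtain rfl : k = N + 1 := by omega
    rwa [cnt_update]
  · exact ht.congr (update_eq_of_lt t N a) k h1

namespace TLData

variable {l n : ℕ} [NeZero l] {R A : Type*} [CommRing R] [Ring A] [Algebra R A] {ξ : R}
  (D : TLData l n R A ξ)

/-- The product of the `ψ`s which carries the initial tableau to `t`. -/
def ψw (t : ℕ → Bool) : ℕ → A
  | 0 => 1
  | m + 1 => if t m then ψw t m * D.Rk (2 * cnt t m + 1) (m - 1 - 2 * cnt t m) else ψw t m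

lemma ψw_congr {t t' : ℕ → Bool} {N : ℕ} (h : ∀ k < N, t k = t' k) : D.ψw t N = D.ψw t' N := by
  induction N with
  | zero => rfl
  | succ N ih =>
    rw [ψw, ψw, ih fun k hk => h k (by omega), h N (by omega),
      cnt_congr fun k hk => h k (by omega : k < N + 1)]

lemma ψw_update (t : ℕ → Bool) (N : ℕ) (a : Bool) : D.ψw (Function.update t N a) (N + 1) =
    if a then D.ψw t N * D.Rk (2 * cnt t N + 1) (N - 1 - 2 * cnt t N) else D.ψw t N := by
  rw [ψw, Function.update_self, ← cnt_congr (update_eq_of_lt t N a),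
    ← D.ψw_congr (update_eq_of_lt t N a)]

/-- The span of the vectors `ψ_t v` for ballot sequences `t` of type `(N, b)`. -/
def Wd (N b : ℕ) (v : A) : Submodule R A :=
  Submodule.span R {z | ∃ t, Ballot N t ∧ cnt t N = b ∧ z = D.ψw t N * v}

variable {D}

theorem Hw.span : ∀ N, N ≤ n → ∀ b (v : A) (I : Submodule R A), 2 * b ≤ N →
    D.Hw N b v I → ∀ x ∈ D.Alg N, x * v ∈ D.Wd N b v ⊔ I := by
  intro N
  induction N with
  | zero =>
    intro _ b v I hb h x hx
    refine D.Alg_induction_left _ (fun j _ hj => by omega) (fun j hj => by omega)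
      (fun j hj => by omega) hx v (Submodule.mem_sup_left (Submodule.subset_span ?_))
    exact ⟨fun _ => false, fun k hk => by simp [Nat.le_zero.1 hk, cnt], by simp [cnt]; omega,
      (one_mul _).symm⟩
  | succ M ih =>
    intro hn b v I hb h x hx
    have h1 : 2 * b ≤ M → ∀ x ∈ D.Alg M, x * v ∈ D.Wd (M + 1) b v ⊔ I := by
      intro hb' x hx
      refine sup_le_sup_right ?_ I (ih (by omega) b v I hb' h.restrict x hx)
      refine Submodule.span_mono ?_
      rintro _ ⟨t, ht, hc, rfl⟩
      exact ⟨Function.update t M false, ht.update _ (by simp; omega), by simp [cnt_update, hc],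
        by simp [ψw_update]⟩
    refine Tm_le h1 (fun c p hc hp x' hx' => ?_) le_sup_right hb
      (h.Tm_closed M hn b v I hb x hx v (self_mem_Tm hb))
    subst hc hp
    have hu := Hw.up_sup (D := D) (c := c) (p := p) (v := v) (I := I)
      (by convert h using 1; omega) (by omega)
    refine (sup_le ?_ (sup_le (iSup_le fun h' => ?_) le_sup_right) :
      D.Wd _ c _ ⊔ _ ≤ D.Wd (2 * c + 1 + p + 1) (c + 1) v ⊔ I)
      (ih (by omega) c _ _ (by omega) hu x' hx')
    · refine le_sup_of_le_left (Submodule.span_mono ?_)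
      rintro _ ⟨t, ht, hc, rfl⟩
      refine ⟨Function.update t _ true, ht.update _ (by simp; omega), by simp [cnt_update, hc], ?_⟩
      rw [ψw_update, if_pos rfl, hc, show 2 * c + 1 + p - 1 - 2 * c = p by omega, mul_assoc]
    · rintro _ ⟨x, hx, rfl⟩
      exact h1 h' x hx

end TLData

open MulOpposite

/-- The indicator function of a set of entries. -/
def tab {n : ℕ} (S : Finset (Fin n)) (k : ℕ) : Bool := decide (∃ h : k < n, (⟨k, h⟩ : Fin n) ∈ S)

lemma cnt_tab {n : ℕ} (S : Finset (Fin n)) : ∀ k ≤ n,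
    cnt (tab S) k = (S.filter fun x => x.1 < k).card
  | 0, _ => by simp [cnt]
  | k + 1, hk => by
    rw [cnt, cnt_tab S k (by omega)]
    have h : (S.filter fun x => x.1 < k + 1) =
        (S.filter fun x => x.1 < k) ∪ (S.filter fun x => x.1 = k) := by
      ext x; simp only [Finset.mem_filter, Finset.mem_union]; grind
    rw [h, Finset.card_union_of_disjoint
      (Finset.disjoint_filter.2 fun x _ h1 h2 => by omega)]
    congr 1
    have hk' : k < n := by omega
    by_cases hm : (⟨k, hk'⟩ : Fin n) ∈ S
    · rw [if_pos (by simp [tab, hk', hm]), eq_comm, Finset.card_eq_one]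
      refine ⟨⟨k, hk'⟩, ?_⟩
      ext x; simp only [Finset.mem_filter, Finset.mem_singleton, Fin.ext_iff]
      refine ⟨fun h => h.2, fun h => ⟨?_, h⟩⟩
      rwa [show x = ⟨k, hk'⟩ from Fin.ext h]
    · rw [if_neg (by simp [tab, hk', hm]), eq_comm, Finset.card_eq_zero,
        Finset.filter_eq_empty_iff]
      rintro x hx rfl
      exact hm hx

lemma StdT.cnt_eq {n : ℕ} {lam : TwoCol n} (S : StdT n lam) : cnt (tab S.1) n = lam.1 := by
  rw [cnt_tab _ _ le_rfl]
  exact (congrArg Finset.card (Finset.filter_true_of_mem fun x _ => x.2)).trans S.2.1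

lemma StdT.ballot {n : ℕ} {lam : TwoCol n} (S : StdT n lam) : Ballot n (tab S.1) := by
  intro k hk
  rw [cnt_tab _ _ hk]
  rcases k with _ | k
  · simp
  · simpa [Fin.le_def, Nat.lt_succ_iff] using S.2.2 ⟨k, by omega⟩

/-- The standard tableau attached to a ballot sequence. -/
lemma exists_StdT {n : ℕ} {lam : TwoCol n} {t : ℕ → Bool} (h : Ballot n t) (hc : cnt t n = lam.1) :
    ∃ S : StdT n lam, ∀ k < n, tab S.1 k = t k := by
  set S : Finset (Fin n) := Finset.univ.filter fun x => t x.1 = true with hS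
  have e : ∀ k < n, tab S k = t k := fun k hk => by
    simp [tab, hS, hk]
  refine ⟨⟨S, ?_, fun k => ?_⟩, e⟩
  · rw [← hc, ← cnt_congr e, cnt_tab _ _ le_rfl]
    exact (congrArg Finset.card (Finset.filter_true_of_mem
      (p := fun x : Fin n => x.1 < n) fun x _ => x.2)).symm
  · have := h (k.1 + 1) k.2
    rw [← cnt_congr fun i hi => e i (by omega), cnt_tab _ _ k.2] at this
    have e' : (S.filter fun x => x ≤ k) = S.filter fun x => x.1 < k.1 + 1 :=
      Finset.filter_congr fun x _ => by rw [Fin.le_def, Nat.lt_succ_iff]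
    simpa only [e'] using this

lemma tcDom_of_le {n : ℕ} {lam mu : TwoCol n} (h : lam.1 ≤ mu.1) : tcDom n mu lam := by
  have key : ∀ b, 2 * b ≤ n → ∀ j, ∑ i ∈ Finset.range j, tcRow n b i = min j b + min j (n - b) := by
    intro b hb j
    induction j with
    | zero => simp
    | succ j ih =>
      rw [Finset.sum_range_succ, ih, tcRow]
      split_ifs <;> omega
  intro j
  rw [key _ lam.2, key _ mu.2]
  have := lam.2
  have := mu.2
  omega

namespace TLData

variable {l n : ℕ} [NeZero l] {R A : Type*} [CommRing R] [Ring A] [Algebra R A] {ξ : R}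
  (D : TLData l n R A ξ)

lemma P_ψ1 (r : ℕ) (a : ZMod l) (x : A) :
    D.P (r + 1) a * (D.ψ r * x) = D.ψ r * (D.P r a * x) := by
  rw [← mul_assoc, ← D.ψP1, mul_assoc]

lemma P_ψ2 (r : ℕ) (a : ZMod l) (x : A) :
    D.P r a * (D.ψ r * x) = D.ψ r * (D.P (r + 1) a * x) := by
  rw [← mul_assoc, ← D.ψP2, mul_assoc]

lemma P_ψ {r j : ℕ} (h : j ≠ r) (h' : j ≠ r + 1) (a : ZMod l) (x : A) :
    D.P j a * (D.ψ r * x) = D.ψ r * (D.P j a * x) := by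
  rw [← mul_assoc, ← D.ψP _ _ _ h h', mul_assoc]

lemma op_psisq (r : ℕ) (a b : ZMod l) (h : r + 1 < n) :
    MulOpposite.op (D.ψ r) * MulOpposite.op (D.ψ r) *
      (MulOpposite.op (D.P r a) * MulOpposite.op (D.P (r + 1) b)) =
    (if b = a then 0 else if b = a + 1 then MulOpposite.op (D.y (r + 1)) - MulOpposite.op (D.y r) -
        algebraMap R Aᵐᵒᵖ ξ
      else if b = a - 1 then MulOpposite.op (D.y r) - MulOpposite.op (D.y (r + 1)) -
        algebraMap R Aᵐᵒᵖ ξ else 1) *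
      (MulOpposite.op (D.P r a) * MulOpposite.op (D.P (r + 1) b)) := by
  have e : D.P (r + 1) b * D.P r a * (D.ψ r * D.ψ r) =
      D.ψ r * D.ψ r * (D.P r a * D.P (r + 1) b) := by
    rw [mul_assoc, D.P_ψ2, D.P_ψ1, ← D.ψP1, ← mul_assoc (D.P r b), ← D.ψP2]
    simp only [mul_assoc, D.P_comm (r + 1) r]
  have c : ∀ i, D.P (r + 1) b * D.P r a * D.y i = D.y i * (D.P r a * D.P (r + 1) b) := fun i => by
    rw [mul_assoc, D.Py, ← mul_assoc, D.Py, mul_assoc, D.P_comm r]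
  have c' : D.P (r + 1) b * D.P r a * algebraMap R A ξ =
      algebraMap R A ξ * (D.P r a * D.P (r + 1) b) := by
    rw [← Algebra.commutes, D.P_comm r]
  apply unop_injective
  have := D.psisq r a b h
  rw [← e] at this
  simp only [unop_mul, unop_op, this]
  split_ifs <;> simp [mul_sub, sub_mul, c, c', D.P_comm r (r + 1)]

lemma op_braid (r : ℕ) (a b c : ZMod l) (h : r + 2 < n) :
    MulOpposite.op (D.ψ r) * MulOpposite.op (D.ψ (r + 1)) * MulOpposite.op (D.ψ r) *
      (MulOpposite.op (D.P r a) * MulOpposite.op (D.P (r + 1) b) *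
        MulOpposite.op (D.P (r + 2) c)) =
    (MulOpposite.op (D.ψ (r + 1)) * MulOpposite.op (D.ψ r) * MulOpposite.op (D.ψ (r + 1)) +
      (if c = a ∧ b = a + 1 then 1 else if c = a ∧ b = a - 1 then -1 else 0)) *
      (MulOpposite.op (D.P r a) * MulOpposite.op (D.P (r + 1) b) *
        MulOpposite.op (D.P (r + 2) c)) := by
  have e1 : D.P (r + 2) c * (D.P (r + 1) b * D.P r a) * (D.ψ r * (D.ψ (r + 1) * D.ψ r)) =
      D.ψ r * D.ψ (r + 1) * D.ψ r * (D.P r c * D.P (r + 1) b * D.P (r + 2) a) := by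
    simp only [mul_assoc]
    rw [D.P_ψ2, D.P_ψ2, D.ψP r (r + 1 + 1) a (by omega) (by omega) |>.symm, D.P_ψ1,
      D.P_ψ (j := r) (by omega) (by omega), ← mul_assoc (D.P r b), ← D.ψP2,
      D.P_ψ (j := r + 2) (by omega) (by omega), D.P_ψ1 (r + 1), mul_assoc,
      ← mul_assoc (D.P (r + 1) c), ← D.ψP1, mul_assoc]
  have e2 : D.P (r + 2) c * (D.P (r + 1) b * D.P r a) * (D.ψ (r + 1) * (D.ψ r * D.ψ (r + 1))) =
      D.ψ (r + 1) * D.ψ r * D.ψ (r + 1) * (D.P r c * D.P (r + 1) b * D.P (r + 2) a) := by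
    simp only [mul_assoc]
    rw [show r + 2 = r + 1 + 1 from rfl, D.P_ψ (j := r) (r := r + 1) (by omega) (by omega),
      D.P_ψ2 (r + 1), D.P_ψ1 (r + 1), D.P_ψ2 r, D.P_ψ (j := r + 1 + 1) (r := r) (by omega) (by omega),
      D.P_ψ1 r, ← D.ψP2 (r + 1), D.P_ψ1 (r + 1), D.P_ψ (j := r) (r := r + 1) (by omega) (by omega)]
  apply unop_injective
  have := D.braid r c b a h
  rw [add_mul, ← e1, ← e2] at this
  simp only [unop_mul, unop_op, unop_add, this, mul_add]
  congr 1
  have e3 : D.P (r + 2) c * (D.P (r + 1) b * D.P r a) =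
      D.P r a * (D.P (r + 1) b * D.P (r + 2) c) := by
    rw [D.P_comm (r + 1) r, ← mul_assoc, D.P_comm (r + 2) r, mul_assoc, D.P_comm (r + 2) (r + 1)]
  by_cases hca : c = a
  · subst hca
    split_ifs <;> simp [e3, mul_assoc]
  · simp [hca, Ne.symm hca]

/-- The data for the opposite algebra. -/
def op : TLData l n R Aᵐᵒᵖ ξ where
  P j a := MulOpposite.op (D.P j a)
  y j := MulOpposite.op (D.y j)
  ψ j := MulOpposite.op (D.ψ j)
  P_comm i j a b := unop_injective (D.P_comm _ _ _ _)
  P_orth i a b h := unop_injective (D.P_orth _ _ _ h.symm)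
  P_idem i a := unop_injective (D.P_idem _ _)
  P_sum i := by rw [← Finset.op_sum, D.P_sum, op_one]
  Py i j a := unop_injective (D.Py _ _ _).symm
  yy i j := unop_injective (D.yy _ _)
  ψP1 r a := unop_injective (D.ψP2 _ _).symm
  ψP2 r a := unop_injective (D.ψP1 _ _).symm
  ψP r j a h h' := unop_injective (D.ψP _ _ _ h h').symm
  ψy r j h h' := unop_injective (D.ψy _ _ h h').symm
  ψψ r s h := unop_injective (D.ψψ _ _ h).symm
  ψy1 r h := by
    simp only [← op_mul, D.yψ1 r h, op_add, Finset.op_sum, D.P_comm (r + 1)]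
  yψ1 r h := by
    simp only [← op_mul, D.ψy1 r h, op_add, Finset.op_sum, D.P_comm (r + 1)]
  psisq r a b h := D.op_psisq r a b h
  braid r a b c h := D.op_braid r a b c h
  P_zero a h := by rw [D.P_zero a h, op_zero]
  y_zero := by rw [D.y_zero, op_zero]
  bad := by
    apply unop_injective
    have := D.bad
    rw [D.P_comm 0 1, mul_assoc, D.P_comm 0 2, ← mul_assoc, D.P_comm 1 2] at this
    simpa [mul_assoc] using this

lemma op_E (w : List (ZMod l)) : D.op.E w = MulOpposite.op (D.E w) := by
  induction w with
  | nil => rfl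
  | cons a w ih => rw [E_cons, E_cons, ih, D.E_comm_P]; rfl

lemma op_J (b m : ℕ) : D.op.J b m = MulOpposite.op (D.J b m) := D.op_E _

lemma unop_mem_Alg {m : ℕ} {x : Aᵐᵒᵖ} (hx : x ∈ D.op.Alg m) : x.unop ∈ D.Alg m := by
  induction hx using Algebra.adjoin_induction with
  | mem x hx =>
    rcases hx with (⟨j, a, h, rfl⟩ | ⟨j, h, rfl⟩) | ⟨j, h, rfl⟩
    exacts [D.P_mem h a, D.y_mem h, D.ψ_mem h]
  | algebraMap r => exact (D.Alg m).algebraMap_mem r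
  | add x y _ _ hx hy => exact add_mem hx hy
  | mul x y _ _ hx hy => exact mul_mem hy hx

lemma op_mem_Alg {m : ℕ} {x : A} (hx : x ∈ D.Alg m) : MulOpposite.op x ∈ D.op.Alg m := by
  induction hx using Algebra.adjoin_induction with
  | mem x hx =>
    rcases hx with (⟨j, a, h, rfl⟩ | ⟨j, h, rfl⟩) | ⟨j, h, rfl⟩
    exacts [D.op.P_mem h a, D.op.y_mem h, D.op.ψ_mem h]
  | algebraMap r => exact (D.op.Alg m).algebraMap_mem r
  | add x y _ _ hx hy => exact add_mem hx hy
  | mul x y _ _ hx hy => exact mul_mem hy hx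

lemma unop_mem_K {m b : ℕ} {z : Aᵐᵒᵖ} (hz : z ∈ D.op.K m b) : z.unop ∈ D.K m b := by
  refine (Submodule.span_le (p := (D.K m b).comap
    (MulOpposite.opLinearEquiv R).symm.toLinearMap)).2 ?_ hz
  rintro _ ⟨x, hx, y, hy, b', h1, h2, rfl⟩
  refine Submodule.subset_span ⟨y.unop, D.unop_mem_Alg hy, x.unop, D.unop_mem_Alg hx, b', h1, h2, ?_⟩
  rw [D.op_J]
  simp [mul_assoc]

lemma ψw_mem {t : ℕ → Bool} : ∀ {m : ℕ}, Ballot m t → D.ψw t m ∈ D.Alg m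
  | 0, _ => (D.Alg 0).one_mem
  | m + 1, h => by
    have := D.Alg_mono (Nat.le_succ m) (ψw_mem (h.mono (Nat.le_succ m)))
    rw [ψw]
    split_ifs with ht
    · refine (D.Alg _).mul_mem this (D.Rk_mem ?_)
      have := h (m + 1) le_rfl
      rw [cnt, if_pos ht] at this
      omega
    · exact this

/-- The reversed `ψ`-product. -/
def ψr (t : ℕ → Bool) : A := (D.op.ψw t n).unop

/-- The cellular basis elements. -/
def C (lam : TwoCol n) (s t : StdT n lam) : A :=
  D.ψw (tab s.1) n * D.J lam.1 n * D.ψr (tab t.1)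

/-- The span of the basis elements of shape at least `b`. -/
def Cs (b : ℕ) : Submodule R A :=
  Submodule.span R {z | ∃ lam : TwoCol n, b ≤ lam.1 ∧ ∃ s t, z = D.C lam s t}

lemma Wd_eq (lam : TwoCol n) (v : A) :
    D.Wd n lam.1 v = Submodule.span R (Set.range fun s : StdT n lam => D.ψw (tab s.1) n * v) := by
  refine le_antisymm (Submodule.span_mono ?_) (Submodule.span_mono ?_)
  · rintro _ ⟨t, ht, hc, rfl⟩
    obtain ⟨S, hS⟩ := exists_StdT ht hc
    exact ⟨S, by simp only [D.ψw_congr hS]⟩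
  · rintro _ ⟨S, rfl⟩
    exact ⟨_, S.ballot, S.cnt_eq, rfl⟩

variable (hl : 5 ≤ l) (h2 : IsUnit (2 : R))
include hl h2

lemma left_span (lam : TwoCol n) {x : A} (hx : x ∈ D.Alg n) : ∃ r : StdT n lam → R,
    x * D.J lam.1 n - ∑ u, r u • (D.ψw (tab u.1) n * D.J lam.1 n) ∈ D.K n (lam.1 + 1) := by
  have := (D.Hw_J hl h2 lam.2).span n le_rfl _ _ _ lam.2 x hx
  rw [Wd_eq] at this
  obtain ⟨w, hw, k, hk, e⟩ := Submodule.mem_sup.1 this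
  obtain ⟨r, rfl⟩ := (Submodule.mem_span_range_iff_exists_fun R).1 hw
  exact ⟨r, by rwa [← e, add_sub_cancel_left]⟩

lemma right_span (lam : TwoCol n) {x : A} (hx : x ∈ D.Alg n) : ∃ r : StdT n lam → R,
    D.J lam.1 n * x - ∑ u, r u • (D.J lam.1 n * D.ψr (tab u.1)) ∈ D.K n (lam.1 + 1) := by
  obtain ⟨r, hr⟩ := D.op.left_span hl h2 lam (D.op_mem_Alg hx)
  refine ⟨r, ?_⟩
  have := D.unop_mem_K hr
  rw [op_J] at this
  simpa [ψr] using this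

lemma K_le_Cs : ∀ d b, n + 1 ≤ b + d → D.K n b ≤ D.Cs b := by
  intro d
  induction d with
  | zero =>
    intro b hb
    refine Submodule.span_le.2 ?_
    rintro _ ⟨x, hx, y, hy, b', h1, h2, rfl⟩
    omega
  | succ d ih =>
    intro b hb
    have hKC : D.K n (b + 1) ≤ D.Cs b := (ih (b + 1) (by omega)).trans
      (Submodule.span_mono fun z ⟨lam, h, h'⟩ => ⟨lam, by omega, h'⟩)
    refine Submodule.span_le.2 ?_
    rintro _ ⟨x, hx, y, hy, b', h1, h2', rfl⟩
    rw [SetLike.mem_coe]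
    obtain ⟨r, hr⟩ := D.left_span hl h2 ⟨b', h2'⟩ hx
    obtain ⟨r', hr'⟩ := D.right_span hl h2 ⟨b', h2'⟩ hy
    set w := ∑ u : StdT n ⟨b', h2'⟩, r u • (D.ψw (tab u.1) n * D.J b' n) with hw
    set w' := ∑ u : StdT n ⟨b', h2'⟩, r' u • (D.J b' n * D.ψr (tab u.1)) with hw'
    have hwm : w ∈ D.Alg n := sum_mem fun u _ => (D.Alg n).smul_mem
      ((D.Alg n).mul_mem (D.ψw_mem u.ballot) (D.J_mem _ _)) _
    have hJ : D.J b' n * D.J b' n = D.J b' n := D.E_idem _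
    have e : x * D.J b' n * y = w * w' + (w * (D.J b' n * y - w') +
        (x * D.J b' n - w) * (D.J b' n * y)) := by
      have : x * D.J b' n * y = x * D.J b' n * (D.J b' n * y) := by
        rw [← mul_assoc (x * _), mul_assoc x (D.J b' n) (D.J b' n), hJ]
      rw [this]; noncomm_ring
    rw [e]
    refine add_mem ?_ (hKC (D.K_anti (Nat.succ_le_succ h1) (add_mem ?_ ?_)))
    · rw [hw, hw', Finset.sum_mul]
      refine sum_mem fun u _ => ?_
      rw [Finset.mul_sum]
      refine sum_mem fun u' _ => ?_
      rw [smul_mul_smul_comm]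
      refine Submodule.smul_mem _ _ (Submodule.subset_span ⟨⟨b', h2'⟩, h1, u, u', ?_⟩)
      rw [C, mul_assoc, ← mul_assoc (D.J b' n), hJ, mul_assoc]
    · exact (D.K_closed _ _ w hwm _ hr').1
    · exact (D.K_closed _ _ _ ((D.Alg n).mul_mem (D.J_mem _ _) hy) _ hr).2

theorem mem_Cs_zero {x : A} (hx : x ∈ D.Alg n) : x ∈ D.Cs 0 := by
  have := D.K_le_Cs hl h2 (n + 1) 0 (by omega)
    (D.K_closed n 0 x hx _ (D.one_mem_K hl h2)).1
  rwa [mul_one] at this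

theorem mul_C (lam : TwoCol n) (s : StdT n lam) {x : A} (hx : x ∈ D.Alg n) :
    ∃ r : StdT n lam → R, ∀ t, x * D.C lam s t - ∑ u, r u • D.C lam u t ∈ D.Cs (lam.1 + 1) := by
  obtain ⟨r, hr⟩ := D.left_span hl h2 lam ((D.Alg n).mul_mem hx (D.ψw_mem s.ballot))
  refine ⟨r, fun t => ?_⟩
  have := (D.K_closed _ _ (D.ψr (tab t.1)) (D.unop_mem_Alg (D.op.ψw_mem t.ballot)) _ hr).2
  rw [sub_mul, Finset.sum_mul] at this
  simpa only [C, smul_mul_assoc, mul_assoc] using D.K_le_Cs hl h2 (n + 1) _ (by omega) this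

end TLData

section Quotient

variable (l n : ℕ) [NeZero l] (hn : 3 ≤ n)

/-- The Temperley-Lieb quotient of the level-one cyclotomic KLR algebra. -/
abbrev TL := BQuot l n (Lam1 l) (badSet1 l n hn)

/-- The image of a KLR idempotent. -/
def eB (i : Res l n) : TL l n hn := bmk l n (Lam1 l) (badSet1 l n hn) (eG l n i)

/-- The image of a polynomial generator. -/
def yB (r : Fin n) : TL l n hn := bmk l n (Lam1 l) (badSet1 l n hn) (yG l n r)

/-- The image of a crossing generator. -/
def pB (r : Fin (n - 1)) : TL l n hn := bmk l n (Lam1 l) (badSet1 l n hn) (pG l n r)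

variable {l n}

lemma bmk_rel {a b : FreeAlgebra ℂ (KLRGen l n)} (h : KLRRel l n (Lam1 l) a b) :
    bmk l n (Lam1 l) (badSet1 l n hn) a = bmk l n (Lam1 l) (badSet1 l n hn) b := by
  rw [bmk, AlgHom.comp_apply, RingQuot.mkAlgHom_rel ℂ h]; rfl

lemma eB_bad {i : Res l n} (h : i ∈ badSet1 l n hn) : eB l n hn i = 0 := by
  have : quotRel l n (Lam1 l) (badSet1 l n hn) (RingQuot.mkAlgHom ℂ _ (eG l n i)) 0 :=
    ⟨rfl, i, h, rfl⟩
  have := RingQuot.mkAlgHom_rel ℂ this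
  rwa [map_zero] at this

lemma eB_zero {i : Res l n} (h : i ⟨0, by omega⟩ ≠ 0) : eB l n hn i = 0 := by
  have := bmk_rel hn (KLRRel.cyc1 (Lam := Lam1 l) i ⟨0, by omega⟩ rfl h)
  rwa [map_zero] at this

lemma eB_mul (i j : Res l n) : eB l n hn i * eB l n hn j = if i = j then eB l n hn i else 0 := by
  split_ifs with h
  · subst h
    have := bmk_rel hn (KLRRel.idem (Lam := Lam1 l) i)
    rwa [map_mul] at this
  · have := bmk_rel hn (KLRRel.orth (Lam := Lam1 l) i j h)
    rwa [map_mul, map_zero] at this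

lemma sum_eB : ∑ i, eB l n hn i = 1 := by
  have := bmk_rel hn (KLRRel.sum1 (l := l) (n := n) (Lam := Lam1 l))
  rwa [map_sum, map_one] at this

variable {hn} in
lemma eB_ext {X Y : TL l n hn} (h : ∀ i, X * eB l n hn i = Y * eB l n hn i) : X = Y := by
  rw [← mul_one X, ← mul_one Y, ← sum_eB, Finset.mul_sum, Finset.mul_sum]
  exact Finset.sum_congr rfl fun i _ => h i

lemma yB_eB (r : Fin n) (i : Res l n) : yB l n hn r * eB l n hn i = eB l n hn i * yB l n hn r := by
  have := bmk_rel hn (KLRRel.ye (Lam := Lam1 l) r i)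
  rwa [map_mul, map_mul] at this

lemma pB_eB (r : Fin (n - 1)) (i : Res l n) : pB l n hn r * eB l n hn i =
    eB l n hn (i ∘ Equiv.swap (lo r) (hi r)) * pB l n hn r := by
  have := bmk_rel hn (KLRRel.psie (Lam := Lam1 l) r i)
  rwa [map_mul, map_mul] at this

variable (l n) in
/-- The idempotent projecting on residue `a` at position `j`. -/
def PB (j : ℕ) (a : ZMod l) : TL l n hn :=
  if h : j < n then ∑ i ∈ Finset.univ.filter fun i : Res l n => i ⟨j, h⟩ = a, eB l n hn i
  else if a = 0 then 1 else 0

lemma PB_of_ge {j : ℕ} (h : n ≤ j) (a : ZMod l) : PB l n hn j a = if a = 0 then 1 else 0 := by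
  rw [PB, dif_neg (by omega)]

lemma PB_eB {j : ℕ} (h : j < n) (a : ZMod l) (i : Res l n) :
    PB l n hn j a * eB l n hn i = if i ⟨j, h⟩ = a then eB l n hn i else 0 := by
  rw [PB, dif_pos h, Finset.sum_mul]
  simp only [eB_mul, Finset.sum_ite_eq', Finset.mem_filter, Finset.mem_univ, true_and]

variable (l n) in
/-- The polynomial generators, extended by zero. -/
def yT (j : ℕ) : TL l n hn := if h : j < n then yB l n hn ⟨j, h⟩ else 0

variable (l n) in
/-- The crossings, extended by zero. -/
def pT (j : ℕ) : TL l n hn := if h : j + 1 < n then pB l n hn ⟨j, by omega⟩ else 0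

lemma pT_of_lt {j : ℕ} (h : j + 1 < n) : pT l n hn j = pB l n hn ⟨j, by omega⟩ := dif_pos h

lemma yT_of_lt {j : ℕ} (h : j < n) : yT l n hn j = yB l n hn ⟨j, h⟩ := dif_pos h

lemma PB_comm_yT (j r : ℕ) (a : ZMod l) :
    PB l n hn j a * yT l n hn r = yT l n hn r * PB l n hn j a := by
  rw [PB, yT]
  split_ifs <;> simp [Finset.sum_mul, Finset.mul_sum, yB_eB]

/-- The residue sequence with two neighbours exchanged. -/
abbrev swp {r : ℕ} (h : r + 1 < n) (i : Res l n) : Res l n :=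
  i ∘ Equiv.swap ⟨r, by omega⟩ ⟨r + 1, h⟩

lemma pT_eB {r : ℕ} (h : r + 1 < n) (i : Res l n) : pT l n hn r * eB l n hn i =
    eB l n hn (swp h i) * pT l n hn r := by
  rw [pT_of_lt hn h]
  exact pB_eB hn ⟨r, by omega⟩ i

lemma PB_pT_eB {r j : ℕ} (h : r + 1 < n) (hj : j < n) (a : ZMod l) (i : Res l n) :
    PB l n hn j a * pT l n hn r * eB l n hn i =
      if swp h i ⟨j, hj⟩ = a then pT l n hn r * eB l n hn i else 0 := by
  rw [mul_assoc, pT_eB hn h, ← mul_assoc, PB_eB hn hj]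
  split_ifs <;> simp

lemma pT_PB {r j k : ℕ} (a : ZMod l) (hjk : ∀ h : r + 1 < n, ∀ hj : j < n, ∃ hk : k < n,
    ∀ i : Res l n, swp h i ⟨k, hk⟩ = i ⟨j, hj⟩)
    (hj : r + 1 < n → j < n) : pT l n hn r * PB l n hn j a = PB l n hn k a * pT l n hn r := by
  by_cases h : r + 1 < n
  · obtain ⟨hk, e⟩ := hjk h (hj h)
    refine eB_ext fun i => ?_
    rw [mul_assoc, PB_eB hn (hj h), PB_pT_eB hn h hk, e, mul_ite, mul_zero]
  · simp [pT, h]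

lemma PB_two_eB {r : ℕ} (h : r + 1 < n) (a b : ZMod l) (i : Res l n) :
    PB l n hn r a * PB l n hn (r + 1) b * eB l n hn i =
      if i ⟨r, by omega⟩ = a ∧ i ⟨r + 1, h⟩ = b then eB l n hn i else 0 := by
  rw [mul_assoc, PB_eB hn h, mul_ite, PB_eB hn (by omega), ite_and]
  split_ifs <;> simp

lemma PB_three_eB {r : ℕ} (h : r + 2 < n) (a b c : ZMod l) (i : Res l n) :
    PB l n hn r a * PB l n hn (r + 1) b * PB l n hn (r + 2) c * eB l n hn i =
      if (i ⟨r, by omega⟩ = a ∧ i ⟨r + 1, by omega⟩ = b) ∧ i ⟨r + 2, h⟩ = c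
        then eB l n hn i else 0 := by
  rw [mul_assoc, PB_eB hn h, mul_ite, PB_two_eB hn (by omega)]
  split_ifs <;> first | rfl | simp_all

lemma sum_PB_two_eB {r : ℕ} (h : r + 1 < n) (i : Res l n) :
    (∑ a, PB l n hn r a * PB l n hn (r + 1) a) * eB l n hn i =
      if i ⟨r, by omega⟩ = i ⟨r + 1, h⟩ then eB l n hn i else 0 := by
  rw [Finset.sum_mul]
  simp only [PB_two_eB hn h, ite_and]
  rw [Finset.sum_ite_eq]
  simp [eq_comm]

variable (l n) in
/-- The Temperley-Lieb data carried by the KLR quotient. -/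
def tlData : TLData l n ℂ (TL l n hn) 0 where
  P := PB l n hn
  y := yT l n hn
  ψ := pT l n hn
  P_comm j k a b := by
    by_cases hj : j < n
    · by_cases hk : k < n
      · refine eB_ext fun i => ?_
        rw [mul_assoc, mul_assoc, PB_eB hn hj, PB_eB hn hk, mul_ite, mul_ite, PB_eB hn hj,
          PB_eB hn hk]
        split_ifs <;> simp
      · rw [PB_of_ge hn (by omega : n ≤ k)]; split_ifs <;> simp
    · rw [PB_of_ge hn (by omega : n ≤ j)]; split_ifs <;> simp
  P_orth j a b hab := by
    by_cases hj : j < n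
    · refine eB_ext fun i => ?_
      rw [mul_assoc, PB_eB hn hj, mul_ite, PB_eB hn hj]
      split_ifs with h1 h2 <;> simp
      exact (hab (h2.symm.trans h1)).elim
    · rw [PB_of_ge hn (by omega : n ≤ j), PB_of_ge hn (by omega : n ≤ j)]
      split_ifs <;> simp_all
  P_idem j a := by
    by_cases hj : j < n
    · refine eB_ext fun i => ?_
      rw [mul_assoc, PB_eB hn hj, mul_ite, PB_eB hn hj]
      split_ifs <;> simp
    · rw [PB_of_ge hn (by omega : n ≤ j)]; split_ifs <;> simp
  P_sum j := by
    by_cases hj : j < n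
    · refine eB_ext fun i => ?_
      rw [Finset.sum_mul]
      simp [PB_eB hn hj]
    · simp [PB_of_ge hn (by omega : n ≤ j)]
  Py j r a := PB_comm_yT hn j r a
  yy j k := by
    by_cases hj : j < n
    · by_cases hk : k < n
      · have := bmk_rel hn (KLRRel.yy (Lam := Lam1 l) ⟨j, hj⟩ ⟨k, hk⟩)
        rw [map_mul, map_mul] at this
        rwa [yT_of_lt hn hj, yT_of_lt hn hk]
      · simp [yT, hk]
    · simp [yT, hj]
  ψP1 r a := pT_PB hn a (fun h _ => ⟨h, fun i => by simp⟩) (by omega)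
  ψP2 r a := pT_PB hn a (fun h hj => ⟨by omega, fun i => by simp⟩) (by omega)
  ψP r j a h1 h2 := by
    by_cases hj : j < n
    · refine pT_PB hn a (fun h hj => ⟨hj, fun i => ?_⟩) fun _ => hj
      exact congrArg i (Equiv.swap_apply_of_ne_of_ne (by simpa using h1) (by simpa using h2))
    · rw [PB_of_ge hn (by omega : n ≤ j)]; split_ifs <;> simp
  ψy r j h1 h2 := by
    by_cases hj : j < n
    · by_cases hr : r + 1 < n
      · have := bmk_rel hn (KLRRel.psiy (Lam := Lam1 l) ⟨r, by omega⟩ ⟨j, hj⟩ h1 h2)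
        rw [map_mul, map_mul] at this
        rwa [pT_of_lt hn hr, yT_of_lt hn hj]
      · simp [pT, hr]
    · simp [yT, hj]
  ψψ r s h := by
    by_cases hs : s + 1 < n
    · have := bmk_rel hn (KLRRel.pp (Lam := Lam1 l) ⟨r, by omega⟩ ⟨s, by omega⟩ (Or.inl h))
      rw [map_mul, map_mul] at this
      rwa [pT_of_lt hn hs, pT_of_lt hn (by omega)]
    · simp [pT, hs]
  ψy1 r h := by
    refine eB_ext fun i => ?_
    have := bmk_rel hn (KLRRel.py (Lam := Lam1 l) ⟨r, by omega⟩ i)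
    rw [add_mul _ (Finset.sum _ _), sum_PB_two_eB hn h, pT_of_lt hn h, yT_of_lt hn h,
      yT_of_lt hn (by omega)]
    simp only [map_mul, map_add, apply_ite (bmk l n (Lam1 l) (badSet1 l n hn)), map_one, map_zero,
      add_mul, ite_mul, one_mul, zero_mul, ← mul_assoc] at this
    exact this
  yψ1 r h := by
    refine eB_ext fun i => ?_
    have := bmk_rel hn (KLRRel.yp (Lam := Lam1 l) ⟨r, by omega⟩ i)
    rw [add_mul _ (Finset.sum _ _), sum_PB_two_eB hn h, pT_of_lt hn h, yT_of_lt hn h,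
      yT_of_lt hn (by omega)]
    simp only [map_mul, map_add, apply_ite (bmk l n (Lam1 l) (badSet1 l n hn)), map_one, map_zero,
      add_mul, ite_mul, one_mul, zero_mul, ← mul_assoc] at this
    exact this
  psisq r a b h := by
    refine eB_ext fun i => ?_
    have := bmk_rel hn (KLRRel.psisq (Lam := Lam1 l) ⟨r, by omega⟩ i)
    rw [mul_assoc _ (_ * _), mul_assoc _ (_ * _), PB_two_eB hn h, pT_of_lt hn h, yT_of_lt hn h,
      yT_of_lt hn (by omega)]
    by_cases h1 : i ⟨r, by omega⟩ = a ∧ i ⟨r + 1, h⟩ = b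
    · rw [if_pos h1]
      obtain ⟨rfl, rfl⟩ := h1
      simp only [map_mul, map_sub, apply_ite (bmk l n (Lam1 l) (badSet1 l n hn)), map_one,
        map_zero] at this
      have e (x : TL l n hn) : x - algebraMap ℂ (TL l n hn) 0 = x := by
        rw [map_zero]; exact sub_zero x
      rw [e, e]
      exact this
    · rw [if_neg h1, mul_zero, mul_zero]
  braid r a b c h := by
    refine eB_ext fun i => ?_
    have := bmk_rel hn (KLRRel.braid (Lam := Lam1 l) ⟨r, by omega⟩ ⟨r + 1, by omega⟩ rfl i)
    rw [mul_assoc _ (_ * _), mul_assoc _ (_ * _), PB_three_eB hn h, pT_of_lt hn h,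
      pT_of_lt hn (by omega)]
    by_cases h1 : (i ⟨r, by omega⟩ = a ∧ i ⟨r + 1, by omega⟩ = b) ∧ i ⟨r + 2, h⟩ = c
    · rw [if_pos h1]
      obtain ⟨⟨rfl, rfl⟩, rfl⟩ := h1
      simp only [map_mul, map_add, apply_ite (bmk l n (Lam1 l) (badSet1 l n hn)), map_one,
        map_zero, map_neg] at this ⊢
      exact this
    · rw [if_neg h1, mul_zero, mul_zero]
  P_zero a ha := by
    refine eB_ext fun i => ?_
    rw [PB_eB hn (by omega), zero_mul]
    split_ifs with h
    · exact eB_zero hn (by rwa [h])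
    · rfl
  y_zero := by
    refine eB_ext fun i => ?_
    rw [zero_mul]
    by_cases h : i ⟨0, by omega⟩ = 0
    · have := bmk_rel hn (KLRRel.cyc2 (Lam := Lam1 l) i ⟨0, by omega⟩ rfl h)
      rw [map_mul, map_zero] at this
      rwa [yT_of_lt hn (by omega)]
    · rw [eB_zero hn h, mul_zero]
  bad := by
    refine eB_ext fun i => ?_
    rw [PB_three_eB hn (r := 0) (by omega), zero_mul]
    split_ifs with h
    · exact eB_bad hn ⟨h.1.1, h.1.2, h.2⟩
    · rfl

end Quotient

section Compat

variable {l n : ℕ} [NeZero l] {R A R' A' : Type*} [CommRing R] [Ring A] [Algebra R A]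
  [CommRing R'] [Ring A'] [Algebra R' A'] {ξ : R} {ξ' : R'}

/-- A ring homomorphism matching the idempotents and the crossings of two sets of data. -/
structure Compat (D : TLData l n R A ξ) (D' : TLData l n R' A' ξ') (f : A →+* A') : Prop where
  P : ∀ j a, j < n → f (D.P j a) = D'.P j a
  ψ : ∀ j, j + 1 < n → f (D.ψ j) = D'.ψ j

variable {D : TLData l n R A ξ} {D' : TLData l n R' A' ξ'} {f : A →+* A'}

namespace Compat

lemma op (h : Compat D D' f) : Compat D.op D'.op (RingHom.op f) where
  P j a hj := congrArg MulOpposite.op (h.P j a hj)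
  ψ j hj := congrArg MulOpposite.op (h.ψ j hj)

lemma J (h : Compat D D' f) (b : ℕ) {m : ℕ} (hm : m ≤ n) : f (D.J b m) = D'.J b m := by
  induction m with
  | zero => exact map_one f
  | succ m ih => rw [TLData.J_succ, TLData.J_succ, map_mul, ih (by omega), h.P _ _ (by omega)]

lemma Rk (h : Compat D D' f) {s k : ℕ} (hk : k = 0 ∨ s + k < n) : f (D.Rk s k) = D'.Rk s k := by
  induction k with
  | zero => exact map_one f
  | succ k ih => rw [TLData.Rk_succ, TLData.Rk_succ, map_mul, ih (by omega), h.ψ _ (by omega)]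

lemma ψw (h : Compat D D' f) {t : ℕ → Bool} {m : ℕ} (hm : m ≤ n) (ht : Ballot m t) :
    f (D.ψw t m) = D'.ψw t m := by
  induction m with
  | zero => exact map_one f
  | succ m ih =>
    have := ht (m + 1) le_rfl
    rw [cnt] at this
    rw [TLData.ψw, TLData.ψw]
    split_ifs with h1
    · rw [if_pos h1] at this
      rw [map_mul, ih (by omega) (ht.mono (by omega)), h.Rk (by omega)]
    · exact ih (by omega) (ht.mono (by omega))

lemma ψr (h : Compat D D' f) {t : ℕ → Bool} (ht : Ballot n t) : f (D.ψr t) = D'.ψr t :=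
  congrArg MulOpposite.unop (h.op.ψw le_rfl ht)

lemma C (h : Compat D D' f) (lam : TwoCol n) (s t : StdT n lam) :
    f (D.C lam s t) = D'.C lam s t := by
  rw [TLData.C, TLData.C, map_mul, map_mul, h.ψw le_rfl s.ballot, h.J _ le_rfl, h.ψr t.ballot]

end Compat

end Compat

section Words

variable {l : ℕ} [NeZero l]

/-- A residue sequence, extended by zero. -/
def ext {m : ℕ} (i : Res l m) (j : ℕ) : ZMod l := if h : j < m then i ⟨j, h⟩ else 0

lemma ext_of_lt {m : ℕ} (i : Res l m) {j : ℕ} (h : j < m) : ext i j = i ⟨j, h⟩ := dif_pos h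

lemma ext_swp {n r : ℕ} (h : r + 1 < n) (i : Res l n) {j : ℕ} (hj : j < n) : ext (swp h i) j =
    if j = r then ext i (r + 1) else if j = r + 1 then ext i r else ext i j := by
  rw [ext_of_lt _ hj]
  split_ifs with h1 h2
  · subst h1; rw [ext_of_lt _ h]; simp
  · subst h2; rw [ext_of_lt _ (by omega)]; simp
  · rw [ext_of_lt _ hj]
    exact congrArg i (Equiv.swap_apply_of_ne_of_ne (by simpa using h1) (by simpa using h2))

end Words

namespace TLData

variable {l n : ℕ} [NeZero l] {R A : Type*} [CommRing R] [Ring A] [Algebra R A] {ξ : R}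
  (D : TLData l n R A ξ)

/-- The idempotent of a residue word, given as a function. -/
def Ew (f : ℕ → ZMod l) : ℕ → A
  | 0 => 1
  | m + 1 => Ew f m * D.P m (f m)

lemma Ew_congr {f g : ℕ → ZMod l} {m : ℕ} (h : ∀ j < m, f j = g j) : D.Ew f m = D.Ew g m := by
  induction m with
  | zero => rfl
  | succ m ih => rw [Ew, Ew, ih fun j hj => h j (by omega), h m (by omega)]

lemma Ew_P (f : ℕ → ZMod l) (m j : ℕ) (a : ZMod l) :
    D.Ew f m * D.P j a = D.P j a * D.Ew f m := by
  induction m with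
  | zero => simp [Ew]
  | succ m ih => rw [Ew, mul_assoc, D.P_comm, ← mul_assoc, ih, mul_assoc]

lemma Ew_y (f : ℕ → ZMod l) (m j : ℕ) : D.Ew f m * D.y j = D.y j * D.Ew f m := by
  induction m with
  | zero => simp [Ew]
  | succ m ih => rw [Ew, mul_assoc, D.Py, ← mul_assoc, ih, mul_assoc]

lemma Ew_isW (f : ℕ → ZMod l) (m : ℕ) : D.IsW m f (D.Ew f m) := by
  induction m with
  | zero => intro j a hj; omega
  | succ m ih =>
    intro j a hj
    rcases Nat.lt_succ_iff_lt_or_eq.1 hj with h | rfl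
    · rw [Ew, ← mul_assoc, ih j a h]; split_ifs <;> simp
    · rw [Ew, ← mul_assoc, ← Ew_P, mul_assoc]
      split_ifs with h
      · subst h; rw [D.P_idem]
      · rw [D.P_orth _ _ _ h, mul_zero]

lemma Ew_mul {f g : ℕ → ZMod l} {m : ℕ} {v : A} (hv : D.IsW m g v) :
    D.Ew f m * v = if ∀ j < m, f j = g j then v else 0 := by
  split_ifs with h
  · have : ∀ k ≤ m, D.Ew f k * v = v := by
      intro k
      induction k with
      | zero => intro _; simp [Ew]
      | succ k ih =>
        intro hk
        rw [Ew, mul_assoc, hv k _ (by omega), if_pos (h k (by omega)), ih (by omega)]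
    exact this m le_rfl
  · push Not at h
    obtain ⟨j, hj, hne⟩ := h
    have : ∀ k ≤ m, j < k → D.Ew f k * v = 0 := by
      intro k
      induction k with
      | zero => intro _ h; omega
      | succ k ih =>
        intro hk hjk
        rw [Ew, mul_assoc, hv k _ (by omega)]
        split_ifs with h
        · refine ih (by omega) ?_
          rcases Nat.lt_succ_iff_lt_or_eq.1 hjk with h' | rfl
          · exact h'
          · exact (hne h).elim
        · exact mul_zero _
    exact this m le_rfl hj

/-- The idempotent of a residue sequence. -/
def EI {m : ℕ} (i : Res l m) : A := D.Ew (ext i) m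

lemma sum_EI (m : ℕ) : ∑ i : Res l m, D.EI i = 1 := by
  induction m with
  | zero => simp [EI, Ew]
  | succ m ih =>
    rw [← (Fin.snocEquiv fun _ => ZMod l).sum_comp, Fintype.sum_prod_type]
    have : ∀ (a : ZMod l) (i : Res l m),
        D.EI (Fin.snocEquiv (fun _ => ZMod l) (a, i)) = D.EI i * D.P m a := by
      intro a i
      rw [EI, EI, Ew, ext_of_lt _ (Nat.lt_succ_self m)]
      congr 1
      · refine D.Ew_congr fun j hj => ?_
        rw [ext_of_lt _ hj, ext_of_lt _ (by omega : j < m + 1)]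
        exact Fin.snoc_castSucc (α := fun _ => ZMod l) a i ⟨j, hj⟩
      · congr 1
        exact Fin.snoc_last (α := fun _ => ZMod l) a i
    simp only [this, ← Finset.sum_mul, ih, one_mul]
    exact D.P_sum m

variable {D}

lemma EI_ext {X Y : A} (h : ∀ i : Res l n, X * D.EI i = Y * D.EI i) : X = Y := by
  rw [← mul_one X, ← mul_one Y, ← D.sum_EI n, Finset.mul_sum, Finset.mul_sum]
  exact Finset.sum_congr rfl fun i _ => h i

variable (D)

lemma EI_isW {m : ℕ} (i : Res l m) : D.IsW m (ext i) (D.EI i) := D.Ew_isW _ _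

lemma EI_mul {m : ℕ} (i j : Res l m) {v : A} (hv : D.IsW m (ext j) v) :
    D.EI i * v = if i = j then v else 0 := by
  rw [EI, D.Ew_mul hv]
  congr 1
  refine propext ⟨fun h => funext fun k => ?_, fun h k _ => by rw [h]⟩
  have := h k k.2
  rwa [ext_of_lt _ k.2, ext_of_lt _ k.2] at this

lemma EI_mul_EI {m : ℕ} (i j : Res l m) : D.EI i * D.EI j = if i = j then D.EI i else 0 := by
  rw [D.EI_mul i j (D.EI_isW j)]
  split_ifs with h
  · rw [h]
  · rfl

lemma ψ_EI_isW {r : ℕ} (h : r + 1 < n) (i : Res l n) :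
    D.IsW n (ext (swp h i)) (D.ψ r * D.EI i) := by
  intro j a hj
  rw [(D.EI_isW i).ψ h j a hj, ext_swp h i hj]

lemma ψ_EI {r : ℕ} (h : r + 1 < n) (i : Res l n) :
    D.ψ r * D.EI i = D.EI (swp h i) * D.ψ r := by
  refine EI_ext (D := D) fun j => ?_
  rw [mul_assoc, EI_mul_EI, mul_assoc, D.EI_mul _ _ (D.ψ_EI_isW h j)]
  have e : swp h i = swp h j ↔ i = j :=
    (Equiv.swap (⟨r, by omega⟩ : Fin n) ⟨r + 1, h⟩).surjective.injective_comp_right.eq_iff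
  simp only [e]
  split_ifs with h1
  · rw [h1]
  · rw [mul_zero]

lemma EI_two {r : ℕ} (h : r + 1 < n) (i : Res l n) :
    D.P r (ext i r) * D.P (r + 1) (ext i (r + 1)) * D.EI i = D.EI i := by
  rw [mul_assoc, (D.EI_isW i).eq h, (D.EI_isW i).eq (by omega)]

lemma EI_three {r : ℕ} (h : r + 2 < n) (i : Res l n) :
    D.P r (ext i r) * D.P (r + 1) (ext i (r + 1)) * D.P (r + 2) (ext i (r + 2)) * D.EI i =
      D.EI i := by
  rw [mul_assoc, (D.EI_isW i).eq h, D.EI_two (by omega)]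

lemma sum_two_EI {r : ℕ} (h : r + 1 < n) (i : Res l n) :
    (∑ a, D.P r a * D.P (r + 1) a) * D.EI i = if ext i r = ext i (r + 1) then D.EI i else 0 := by
  rw [Finset.sum_mul]
  have : ∀ a, D.P r a * D.P (r + 1) a * D.EI i =
      if a = ext i (r + 1) then (if ext i r = ext i (r + 1) then D.EI i else 0) else 0 := by
    intro a
    rw [mul_assoc, D.EI_isW i (r + 1) a h]
    split_ifs with h1 h2
    · rw [h1, D.EI_isW i _ _ (by omega), if_pos h2.symm]
    · rw [h1, D.EI_isW i _ _ (by omega), if_neg (Ne.symm h2)]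
    · exact mul_zero _
  simp only [this, Finset.sum_ite_eq', Finset.mem_univ, if_true]

end TLData

section Lift

variable {l n : ℕ} [NeZero l] (hn : 3 ≤ n) {B : Type*} [Ring B] [Algebra ℂ B]
  (D : TLData l n ℂ B 0)

/-- The values of the universal homomorphism on generators. -/
def genMap : KLRGen l n → B
  | .e i => D.EI i
  | .y r => D.y r
  | .psi r => D.ψ r

lemma genMap_rel {a b : FreeAlgebra ℂ (KLRGen l n)} (h : KLRRel l n (Lam1 l) a b) :
    FreeAlgebra.lift ℂ (genMap D) a = FreeAlgebra.lift ℂ (genMap D) b := by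
  have lo_lt (r : Fin (n - 1)) : r.1 < n := by have := r.2; omega
  have hi_lt (r : Fin (n - 1)) : r.1 + 1 < n := by have := r.2; omega
  cases h with
  | cyc1 i r hr h =>
    simp only [eG, FreeAlgebra.lift_ι_apply, genMap, map_zero]
    have := D.EI_isW i r (i r) r.2
    rw [ext_of_lt _ r.2, if_pos rfl, hr, D.P_zero _ (fun h' => h h'), zero_mul] at this
    exact this.symm
  | cyc2 i r hr h =>
    simp only [eG, yG, map_mul, FreeAlgebra.lift_ι_apply, genMap, map_zero]
    rw [hr, D.y_zero, zero_mul]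
  | orth i j h =>
    simp only [eG, map_mul, FreeAlgebra.lift_ι_apply, genMap, map_zero]
    rw [D.EI_mul_EI, if_neg h]
  | idem i =>
    simp only [eG, map_mul, FreeAlgebra.lift_ι_apply, genMap]
    rw [D.EI_mul_EI, if_pos rfl]
  | sum1 =>
    simp only [eG, map_sum, FreeAlgebra.lift_ι_apply, genMap, map_one]
    exact D.sum_EI n
  | ye r i =>
    simp only [eG, yG, map_mul, FreeAlgebra.lift_ι_apply, genMap]
    exact (D.Ew_y _ _ _).symm
  | psie r i =>
    simp only [eG, pG, map_mul, FreeAlgebra.lift_ι_apply, genMap]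
    exact D.ψ_EI (hi_lt r) i
  | yy r s =>
    simp only [yG, map_mul, FreeAlgebra.lift_ι_apply, genMap]
    exact D.yy _ _
  | psiy r s h1 h2 =>
    simp only [yG, pG, map_mul, FreeAlgebra.lift_ι_apply, genMap]
    exact D.ψy _ _ h1 h2
  | pp r s h =>
    simp only [pG, map_mul, FreeAlgebra.lift_ι_apply, genMap]
    rcases h with h | h
    · exact D.ψψ _ _ h
    · exact (D.ψψ _ _ h).symm
  | py r i =>
    simp only [eG, yG, pG, map_mul, map_add, apply_ite (FreeAlgebra.lift ℂ (genMap D)), map_one,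
      map_zero, FreeAlgebra.lift_ι_apply, genMap]
    have := D.ψy1 r (hi_lt r)
    have e := D.sum_two_EI (hi_lt r) i
    rw [ext_of_lt _ (lo_lt r), ext_of_lt _ (hi_lt r)] at e
    change D.ψ r * (D.y (r + 1) * D.EI i) = _
    rw [← mul_assoc, this, add_mul, e, add_mul, ite_mul, one_mul, zero_mul]
    rfl
  | yp r i =>
    simp only [eG, yG, pG, map_mul, map_add, apply_ite (FreeAlgebra.lift ℂ (genMap D)), map_one,
      map_zero, FreeAlgebra.lift_ι_apply, genMap]
    have := D.yψ1 r (hi_lt r)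
    have e := D.sum_two_EI (hi_lt r) i
    rw [ext_of_lt _ (lo_lt r), ext_of_lt _ (hi_lt r)] at e
    change D.y (r + 1) * (D.ψ r * D.EI i) = _
    rw [← mul_assoc, this, add_mul, e, add_mul, ite_mul, one_mul, zero_mul]
    rfl
  | psisq r i =>
    simp only [eG, yG, pG, map_mul, map_sub, apply_ite (FreeAlgebra.lift ℂ (genMap D)), map_one,
      map_zero, FreeAlgebra.lift_ι_apply, genMap]
    have := D.psisq r (ext i r) (ext i (r + 1)) (hi_lt r)
    simp only [map_zero, sub_zero] at this
    rw [← D.EI_two (hi_lt r) i, ← mul_assoc, this, mul_assoc, ext_of_lt _ (lo_lt r),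
      ext_of_lt _ (hi_lt r)]
    rfl
  | braid r s h i =>
    simp only [eG, pG, map_mul, map_add, apply_ite (FreeAlgebra.lift ℂ (genMap D)), map_one,
      map_neg, map_zero, FreeAlgebra.lift_ι_apply, genMap]
    have hr2 : r.1 + 2 < n := by have := s.2; omega
    obtain ⟨s, hs⟩ := s
    obtain rfl : s = r.1 + 1 := h
    have := D.braid r (ext i r) (ext i (r + 1)) (ext i (r + 2)) hr2
    rw [← D.EI_three hr2 i, ← mul_assoc, this, mul_assoc, ext_of_lt _ (lo_lt r),
      ext_of_lt _ (hi_lt r), ext_of_lt _ hr2]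
    rfl

/-- The universal property of the Temperley-Lieb quotient on KLR algebras. -/
def klrLift : KLR l n (Lam1 l) →ₐ[ℂ] B :=
  RingQuot.liftAlgHom ℂ ⟨FreeAlgebra.lift ℂ (genMap D), fun _ _ h => genMap_rel D h⟩

lemma klrLift_mk (x : FreeAlgebra ℂ (KLRGen l n)) :
    klrLift D (RingQuot.mkAlgHom ℂ _ x) = FreeAlgebra.lift ℂ (genMap D) x :=
  RingQuot.liftAlgHom_mkAlgHom_apply ..

lemma klrLift_rel ⦃a b : KLR l n (Lam1 l)⦄ (h : quotRel l n (Lam1 l) (badSet1 l n hn) a b) :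
    klrLift D a = klrLift D b := by
  obtain ⟨rfl, i, ⟨h0, h1, h2⟩, rfl⟩ := h
  rw [klrLift_mk, map_zero, eG, FreeAlgebra.lift_ι_apply, genMap]
  have := D.EI_three (r := 0) (by omega) i
  rw [ext_of_lt _ (by omega), ext_of_lt _ (by omega), ext_of_lt _ (by omega), h0] at this
  change D.P 0 0 * D.P 1 (i ⟨1, _⟩) * D.P 2 (i ⟨2, _⟩) * _ = _ at this
  rw [h1, h2, D.bad, zero_mul] at this
  exact this.symm

/-- The universal property of the Temperley-Lieb quotient. -/
def tlLift : TL l n hn →ₐ[ℂ] B := RingQuot.liftAlgHom ℂ ⟨klrLift D, klrLift_rel hn D⟩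

lemma tlLift_bmk (x : FreeAlgebra ℂ (KLRGen l n)) :
    tlLift hn D (bmk l n (Lam1 l) (badSet1 l n hn) x) = FreeAlgebra.lift ℂ (genMap D) x :=
  (RingQuot.liftAlgHom_mkAlgHom_apply ..).trans (klrLift_mk D x)

lemma tlLift_eB (i : Res l n) : tlLift hn D (eB l n hn i) = D.EI i := by
  rw [eB, tlLift_bmk, eG, FreeAlgebra.lift_ι_apply, genMap]

lemma tlLift_yB (r : Fin n) : tlLift hn D (yB l n hn r) = D.y r := by
  rw [yB, tlLift_bmk, yG, FreeAlgebra.lift_ι_apply, genMap]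

lemma tlLift_pB (r : Fin (n - 1)) : tlLift hn D (pB l n hn r) = D.ψ r := by
  rw [pB, tlLift_bmk, pG, FreeAlgebra.lift_ι_apply, genMap]

lemma tlLift_y {j : ℕ} (h : j < n) : tlLift hn D ((tlData l n hn).y j) = D.y j := by
  change tlLift hn D (yT l n hn j) = _
  rw [yT_of_lt hn h, tlLift_yB]

lemma tlLift_compat : Compat (tlData l n hn) D (tlLift hn D : TL l n hn →+* B) where
  P j a hj := by
    change tlLift hn D (PB l n hn j a) = _
    rw [PB, dif_pos hj, map_sum]
    refine TLData.EI_ext (D := D) fun i => ?_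
    rw [D.EI_isW i j a hj, Finset.sum_mul, ext_of_lt _ hj]
    simp only [RingHom.coe_coe, tlLift_eB, D.EI_mul_EI]
    rw [Finset.sum_congr rfl fun x _ => (by split_ifs with h <;> [rw [h]; rfl] :
      (if x = i then D.EI x else 0) = if x = i then D.EI i else 0), Finset.sum_ite_eq']
    simp only [Finset.mem_filter, Finset.mem_univ, true_and, eq_comm]
  ψ j hj := by
    change tlLift hn D (pT l n hn j) = _
    rw [pT_of_lt hn hj, tlLift_pB]

/-- The residue idempotents are the products of the positional ones. -/
lemma eB_eq_EI (i : Res l n) : eB l n hn i = (tlData l n hn).EI i := by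
  refine eB_ext fun j => ?_
  rw [eB_mul, TLData.EI_mul _ i j]
  · split_ifs with h
    · rw [h]
    · rfl
  · intro k a hk
    change PB l n hn k a * _ = _
    rw [PB_eB hn hk, ext_of_lt _ hk]
    simp only [eq_comm]

lemma tlAlg_eq_top : (tlData l n hn).Alg n = ⊤ := by
  have hs : Function.Surjective (bmk l n (Lam1 l) (badSet1 l n hn)) := by
    rw [bmk, AlgHom.coe_comp]
    exact (RingQuot.mkAlgHom_surjective ℂ _).comp (RingQuot.mkAlgHom_surjective ℂ _)
  refine eq_top_iff.2 fun x _ => ?_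
  obtain ⟨z, rfl⟩ := hs x
  clear * -
  induction z using FreeAlgebra.induction with
  | grade0 r => rw [AlgHom.commutes]; exact algebraMap_mem _ _
  | grade1 g =>
    cases g with
    | e i =>
      change eB l n hn i ∈ _
      rw [eB_eq_EI, TLData.EI]
      suffices ∀ m ≤ n, (tlData l n hn).Ew (ext i) m ∈ (tlData l n hn).Alg n from this n le_rfl
      intro m
      induction m with
      | zero => intro _; exact one_mem _
      | succ m ih => intro hm; exact mul_mem (ih (by omega)) (TLData.P_mem _ (by omega) _)
    | y r =>
      change yB l n hn r ∈ _
      rw [← yT_of_lt hn r.2]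
      exact (tlData l n hn).y_mem r.2
    | psi r =>
      change pB l n hn r ∈ _
      have hr : r.1 + 1 < n := by have := r.2; omega
      have := (tlData l n hn).ψ_mem hr
      change pT l n hn r ∈ _ at this
      rwa [pT_of_lt hn hr] at this
  | mul x y hx hy => rw [map_mul]; exact mul_mem hx hy
  | add x y hx hy => rw [map_add]; exact add_mem hx hy

end Lift

section Anti

variable {l n : ℕ} [NeZero l] (hn : 3 ≤ n)

/-- The anti-involution of the Temperley-Lieb quotient fixing the generators. -/
def tlAnti : TL l n hn →ₗ[ℂ] TL l n hn :=
  (opLinearEquiv ℂ).symm.toLinearMap ∘ₗ (tlLift hn (tlData l n hn).op).toLinearMap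

lemma tlAnti_apply (x : TL l n hn) : tlAnti hn x = (tlLift hn (tlData l n hn).op x).unop := rfl

lemma tlAnti_mul (x y : TL l n hn) : tlAnti hn (x * y) = tlAnti hn y * tlAnti hn x := by
  rw [tlAnti_apply, map_mul]; rfl

lemma tlAnti_tlAnti (x : TL l n hn) : tlAnti hn (tlAnti hn x) = x := by
  have hx : x ∈ (tlData l n hn).Alg n := by rw [tlAlg_eq_top]; trivial
  have h := tlLift_compat hn (tlData l n hn).op
  have hP (j a) (hj : j < n) : tlAnti hn ((tlData l n hn).P j a) = (tlData l n hn).P j a :=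
    congrArg unop (h.P j a hj)
  have hψ (j) (hj : j + 1 < n) : tlAnti hn ((tlData l n hn).ψ j) = (tlData l n hn).ψ j :=
    congrArg unop (h.ψ j hj)
  have hy (j) (hj : j < n) : tlAnti hn ((tlData l n hn).y j) = (tlData l n hn).y j :=
    congrArg unop (tlLift_y hn (tlData l n hn).op hj)
  induction hx using Algebra.adjoin_induction with
  | mem x hx =>
    rcases hx with ((⟨j, a, hj, rfl⟩ | ⟨j, hj, rfl⟩) | ⟨j, hj, rfl⟩)
    · rw [hP _ _ hj, hP _ _ hj]
    · rw [hy _ hj, hy _ hj]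
    · rw [hψ _ hj, hψ _ hj]
  | algebraMap r =>
    have : tlAnti hn (algebraMap ℂ (TL l n hn) r) = algebraMap ℂ (TL l n hn) r := by
      rw [tlAnti_apply, AlgHom.commutes]; rfl
    rw [this, this]
  | add x y _ _ hx hy => rw [map_add, map_add, hx, hy]
  | mul x y _ _ hx hy => rw [tlAnti_mul, tlAnti_mul, hx, hy]

lemma tlAnti_J (b : ℕ) : tlAnti hn ((tlData l n hn).J b n) = (tlData l n hn).J b n := by
  have := (tlLift_compat hn (tlData l n hn).op).J b le_rfl
  rw [TLData.op_J] at this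
  exact congrArg unop this

lemma tlAnti_ψw {t : ℕ → Bool} (ht : Ballot n t) :
    tlAnti hn ((tlData l n hn).ψw t n) = (tlData l n hn).ψr t :=
  congrArg unop ((tlLift_compat hn (tlData l n hn).op).ψw le_rfl ht)

lemma tlAnti_C (lam : TwoCol n) (s t : StdT n lam) :
    tlAnti hn ((tlData l n hn).C lam s t) = (tlData l n hn).C lam t s := by
  rw [TLData.C, tlAnti_mul, tlAnti_mul, tlAnti_J, tlAnti_ψw hn s.ballot, ← tlAnti_ψw hn t.ballot,
    tlAnti_tlAnti, ← mul_assoc]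
  rfl

/-- The anti-involution as a linear equivalence. -/
def tlAntiEquiv : TL l n hn ≃ₗ[ℂ] TL l n hn :=
  LinearEquiv.ofInvolutive (tlAnti hn) (tlAnti_tlAnti hn)

end Anti

lemma cartan_self (l : ℕ) (a : ZMod l) : cartan l a a = 2 := if_pos rfl

lemma cartan_comm (l : ℕ) (a b : ZMod l) : cartan l a b = cartan l b a := by
  have h : (b = a + 1 ∨ b = a - 1) ↔ (a = b + 1 ∨ a = b - 1) := by
    constructor <;> rintro (rfl | rfl) <;> simp
  simp only [cartan, h, eq_comm (a := a) (b := b)]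

lemma cartan_succ {l : ℕ} {a b : ZMod l} (h : b ≠ a) (h' : b = a + 1 ∨ b = a - 1) :
    cartan l a b = -1 := by rw [cartan, if_neg (Ne.symm h), if_pos h']

namespace TLData

variable {l n : ℕ} [NeZero l] {R A : Type*} [CommRing R] [Ring A] [Algebra R A] {ξ : R}
  (D : TLData l n R A ξ)

/-- A residue word with two neighbours exchanged. -/
def swf (f : ℕ → ZMod l) (r : ℕ) (j : ℕ) : ZMod l :=
  if j = r then f (r + 1) else if j = r + 1 then f r else f j

lemma swf_left (f : ℕ → ZMod l) (r : ℕ) : swf f r r = f (r + 1) := if_pos rfl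

lemma swf_right (f : ℕ → ZMod l) (r : ℕ) : swf f r (r + 1) = f r := by
  rw [swf, if_neg (by omega), if_pos rfl]

lemma swf_of_ne (f : ℕ → ZMod l) {r j : ℕ} (h : j ≠ r) (h' : j ≠ r + 1) : swf f r j = f j := by
  rw [swf, if_neg h, if_neg h']

variable {D}

lemma IsW.ψ_swf {N : ℕ} {f : ℕ → ZMod l} {v : A} (h : D.IsW N f v) {r : ℕ} (hr : r + 1 < N) :
    D.IsW N (swf f r) (D.ψ r * v) := h.ψ hr

lemma IsW.y_mul {N : ℕ} {f : ℕ → ZMod l} {v : A} (h : D.IsW N f v) (r : ℕ) :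
    D.IsW N f (D.y r * v) := by
  intro j a hj
  rw [← mul_assoc, D.Py, mul_assoc, h j a hj, mul_ite, mul_zero]

lemma IsW.two {N : ℕ} {f : ℕ → ZMod l} {v : A} (h : D.IsW N f v) {r : ℕ} (hr : r + 1 < N) :
    D.P r (f r) * D.P (r + 1) (f (r + 1)) * v = v := by
  rw [mul_assoc, h.eq hr, h.eq (by omega)]

lemma IsW.three {N : ℕ} {f : ℕ → ZMod l} {v : A} (h : D.IsW N f v) {r : ℕ} (hr : r + 2 < N) :
    D.P r (f r) * D.P (r + 1) (f (r + 1)) * D.P (r + 2) (f (r + 2)) * v = v := by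
  rw [mul_assoc, h.eq hr, h.two (by omega)]

lemma IsW.two_ite {N : ℕ} {f : ℕ → ZMod l} {v : A} (h : D.IsW N f v) {r : ℕ} (hr : r + 1 < N)
    (a b : ZMod l) : D.P r a * D.P (r + 1) b * v = if a = f r ∧ b = f (r + 1) then v else 0 := by
  rw [mul_assoc, h _ b hr]
  by_cases hb : b = f (r + 1)
  · rw [if_pos hb, h _ a (by omega)]; simp [hb]
  · rw [if_neg hb, mul_zero, if_neg fun h' => hb h'.2]

lemma IsW.three_ite {N : ℕ} {f : ℕ → ZMod l} {v : A} (h : D.IsW N f v) {r : ℕ} (hr : r + 2 < N)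
    (a b c : ZMod l) : D.P r a * D.P (r + 1) b * D.P (r + 2) c * v =
      if (a = f r ∧ b = f (r + 1)) ∧ c = f (r + 2) then v else 0 := by
  rw [mul_assoc, h _ c hr]
  by_cases hc : c = f (r + 2)
  · rw [if_pos hc, h.two_ite (by omega)]; simp [hc]
  · rw [if_neg hc, mul_zero, if_neg fun h' => hc h'.2]

lemma IsW.sum_two {N : ℕ} {f : ℕ → ZMod l} {v : A} (h : D.IsW N f v) {r : ℕ} (hr : r + 1 < N) :
    (∑ a, D.P r a * D.P (r + 1) a) * v = if f r = f (r + 1) then v else 0 := by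
  rw [Finset.sum_mul]
  simp only [h.two_ite hr, ite_and]
  rw [Finset.sum_ite_eq']
  simp

lemma IsW.ψ_sq {N : ℕ} {f : ℕ → ZMod l} {v : A} (h : D.IsW N f v) {r : ℕ} (hr : r + 1 < N)
    (hn : r + 1 < n) : D.ψ r * (D.ψ r * v) =
    if f (r + 1) = f r then 0 else if f (r + 1) = f r + 1 then
      D.y (r + 1) * v - D.y r * v - ξ • v else if f (r + 1) = f r - 1 then
      D.y r * v - D.y (r + 1) * v - ξ • v else v := by
  have := congrArg (· * v) (D.psisq r (f r) (f (r + 1)) hn)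
  simp only [mul_assoc (_ * _ : A) (_ * _ : A) v, mul_assoc (ite _ _ _) _ v, h.two hr] at this
  rw [← mul_assoc, this]
  split_ifs <;> simp [sub_mul, Algebra.smul_def]

lemma IsW.ψ_braid {N : ℕ} {f : ℕ → ZMod l} {v : A} (h : D.IsW N f v) {r : ℕ} (hr : r + 2 < N)
    (hn : r + 2 < n) : D.ψ r * (D.ψ (r + 1) * (D.ψ r * v)) =
    D.ψ (r + 1) * (D.ψ r * (D.ψ (r + 1) * v)) +
      (if f (r + 2) = f r ∧ f (r + 1) = f r + 1 then 1
        else if f (r + 2) = f r ∧ f (r + 1) = f r - 1 then -1 else 0) * v := by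
  have := congrArg (· * v) (D.braid r (f r) (f (r + 1)) (f (r + 2)) hn)
  simp only [mul_assoc (_ * _ : A) (_ * _ : A) v, mul_assoc (_ + _ : A) _ v, h.three hr] at this
  simpa only [add_mul, mul_assoc] using this

end TLData

namespace TLData

open LaurentPolynomial AddMonoidAlgebra

variable {l n : ℕ} [NeZero l] {R A : Type*} [CommRing R] [Ring A] [Algebra R A]
  (D : TLData l n R A (0 : R))

/-- The crossings, with their degrees recorded by powers of `T`. -/
def ψL (r : ℕ) : A[T;T⁻¹] :=
  ∑ a, ∑ b, single (-cartan l a b) (D.ψ r * (D.P r a * D.P (r + 1) b))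

variable {D} in
lemma IsW.ψL {N : ℕ} {f : ℕ → ZMod l} {v : A} (h : D.IsW N f v) {r : ℕ} (hr : r + 1 < N) (k : ℤ) :
    D.ψL r * single k v = single (k - cartan l (f r) (f (r + 1))) (D.ψ r * v) := by
  have e (a b : ZMod l) : (single (-cartan l a b) (D.ψ r * (D.P r a * D.P (r + 1) b)) : A[T;T⁻¹]) *
      single k v = if a = f r then (if b = f (r + 1) then
        single (k - cartan l (f r) (f (r + 1))) (D.ψ r * v) else 0) else 0 := by
    rw [single_mul_single, mul_assoc, h.two_ite hr, ← ite_and]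
    split_ifs with h1
    · obtain ⟨rfl, rfl⟩ := h1
      rw [neg_add_eq_sub]
    · rw [mul_zero, single_zero]
  simp only [TLData.ψL, Finset.sum_mul, e, Finset.sum_ite_eq', Finset.mem_univ, if_true,
    Finset.sum_ite_irrel, Finset.sum_const_zero]

lemma sum_single {ι : Type*} (k : ℤ) (s : Finset ι) (f : ι → A) :
    ∑ x ∈ s, (single k (f x) : A[T;T⁻¹]) = single k (∑ x ∈ s, f x) :=
  (map_sum (singleAddHom k) f s).symm

lemma ψL_comm {r : ℕ} {x x' : A} (k : ℤ) (h : D.ψ r * x = x' * D.ψ r)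
    (hP : ∀ j a, D.P j a * x = x * D.P j a) :
    D.ψL r * single k x = single k x' * D.ψL r := by
  simp only [ψL, Finset.sum_mul, Finset.mul_sum, single_mul_single]
  refine Finset.sum_congr rfl fun a _ => Finset.sum_congr rfl fun b _ => ?_
  rw [add_comm, mul_assoc, mul_assoc, hP, ← mul_assoc (D.P r a), hP, mul_assoc, ← mul_assoc, h,
    mul_assoc]

variable {D} in
lemma laurent_ext (m : ℕ) {X Y : A[T;T⁻¹]}
    (h : ∀ i : Res l m, X * single 0 (D.EI i) = Y * single 0 (D.EI i)) : X = Y := by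
  have e : ∑ i : Res l m, (single 0 (D.EI i) : A[T;T⁻¹]) = 1 := by
    rw [sum_single, D.sum_EI]; rfl
  rw [← mul_one X, ← mul_one Y, ← e, Finset.mul_sum, Finset.mul_sum]
  exact Finset.sum_congr rfl fun i _ => h i

/-- The data over Laurent polynomials recording degrees. -/
def laurent (hl : 2 ≤ l) : TLData l n R A[T;T⁻¹] (0 : R) where
  P j a := single 0 (D.P j a)
  y j := single 2 (D.y j)
  ψ := D.ψL
  P_comm i j a b := by rw [single_mul_single, single_mul_single, D.P_comm]
  P_orth i a b h := by rw [single_mul_single, D.P_orth _ _ _ h, single_zero]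
  P_idem i a := by rw [single_mul_single, D.P_idem, add_zero]
  P_sum i := by
    rw [sum_single, D.P_sum]; rfl
  Py i j a := by rw [single_mul_single, single_mul_single, D.Py, add_comm]
  yy i j := by rw [single_mul_single, single_mul_single, D.yy]
  ψP1 r a := D.ψL_comm 0 (D.ψP1 r a) fun _ _ => D.P_comm _ _ _ _
  ψP2 r a := D.ψL_comm 0 (D.ψP2 r a) fun _ _ => D.P_comm _ _ _ _
  ψP r j a h h' := D.ψL_comm 0 (D.ψP r j a h h') fun _ _ => D.P_comm _ _ _ _
  ψy r j h h' := D.ψL_comm 2 (D.ψy r j h h') fun _ _ => D.Py _ _ _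
  ψψ r s h := by
    refine laurent_ext (D := D) (s + 2) fun i => ?_
    have hv := D.EI_isW i
    rw [mul_assoc, mul_assoc, hv.ψL (by omega), hv.ψL (by omega),
      (hv.ψ_swf (by omega)).ψL (by omega), (hv.ψ_swf (by omega)).ψL (by omega),
      swf_of_ne _ (by omega) (by omega), swf_of_ne _ (by omega) (by omega),
      swf_of_ne _ (by omega) (by omega), swf_of_ne _ (by omega) (by omega), ← mul_assoc,
      ← mul_assoc, D.ψψ _ _ h, sub_right_comm]
  ψy1 r h := by
    refine laurent_ext (D := D) (r + 2) fun i => ?_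
    have hv := D.EI_isW i
    have e := congrArg (· * D.EI i) (D.ψy1 r h)
    simp only [add_mul _ (Finset.sum _ _), mul_assoc, hv.sum_two (Nat.lt_succ_self (r + 1))] at e
    simp only [single_mul_single]
    rw [sum_single, add_zero]
    rw [add_mul, mul_assoc, mul_assoc, single_mul_single, (hv.y_mul _).ψL (by omega), hv.ψL (by omega),
      single_mul_single, e, single_mul_single, hv.sum_two (by omega)]
    split_ifs with h1
    · rw [h1, cartan_self, add_zero, add_zero, single_add, sub_self, zero_sub, add_neg_cancel]
    · rw [add_zero, add_zero, single_zero, add_zero, zero_sub, ← sub_eq_add_neg]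
  yψ1 r h := by
    refine laurent_ext (D := D) (r + 2) fun i => ?_
    have hv := D.EI_isW i
    have e := congrArg (· * D.EI i) (D.yψ1 r h)
    simp only [add_mul _ (Finset.sum _ _), mul_assoc, hv.sum_two (Nat.lt_succ_self (r + 1))] at e
    simp only [single_mul_single]
    rw [sum_single, add_zero]
    rw [add_mul, mul_assoc, mul_assoc, hv.ψL (by omega), single_mul_single, e, single_mul_single,
      (hv.y_mul _).ψL (by omega), single_mul_single, hv.sum_two (by omega)]
    split_ifs with h1
    · rw [h1, cartan_self, add_zero, add_zero, single_add, sub_self, zero_sub, add_neg_cancel]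
    · rw [add_zero, add_zero, single_zero, add_zero, zero_sub, ← sub_eq_add_neg]
  psisq r a b h := by
    refine laurent_ext (D := D) (r + 2) fun i => ?_
    have hv := D.EI_isW i
    rw [single_mul_single, mul_assoc, mul_assoc, mul_assoc, single_mul_single, zero_add,
      hv.two_ite (by omega)]
    split_ifs with h0 h1 h2 h3
    all_goals try rw [add_zero, single_zero, mul_zero, mul_zero, mul_zero]
    all_goals
      obtain ⟨rfl, rfl⟩ := h0
      rw [add_zero, hv.ψL (by omega), (hv.ψ_swf (by omega)).ψL (by omega), swf_left, swf_right,
        cartan_comm l (ext i (r + 1)), hv.ψ_sq (by omega) h]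
    · rw [if_pos h1, single_zero, zero_mul]
    · rw [if_neg h1, if_pos h2, cartan_succ h1 (Or.inl h2)]
      simp only [zero_smul, sub_zero, map_zero, sub_mul, single_mul_single, single_sub]
      norm_num
    · rw [if_neg h1, if_neg h2, if_pos h3, cartan_succ h1 (Or.inr h3)]
      simp only [zero_smul, sub_zero, map_zero, sub_mul, single_mul_single, single_sub]
      norm_num
    · rw [if_neg h1, if_neg h2, if_neg h3, cartan, if_neg (Ne.symm h1), if_neg (by tauto)]
      simp
  braid r a b c h := by
    have : Fact (1 < l) := ⟨hl⟩
    refine laurent_ext (D := D) (r + 3) fun i => ?_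
    have hv := D.EI_isW i
    rw [single_mul_single, single_mul_single, mul_assoc _ (single _ _), mul_assoc _ (single _ _),
      single_mul_single, hv.three_ite (by omega)]
    split_ifs with h0
    all_goals try rw [single_zero, mul_zero, mul_zero]
    all_goals
      obtain ⟨⟨rfl, rfl⟩, rfl⟩ := h0
      simp only [add_mul, mul_assoc]
      rw [hv.ψL (by omega), hv.ψL (by omega), (hv.ψ_swf (by omega)).ψL (by omega),
        (hv.ψ_swf (by omega)).ψL (by omega), ((hv.ψ_swf (by omega)).ψ_swf (by omega)).ψL (by omega),
        ((hv.ψ_swf (by omega)).ψ_swf (by omega)).ψL (by omega), hv.ψ_braid (by omega) h]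
      rw [swf_left, swf_right, swf_left, swf_of_ne (r := r) _ (by omega) (by omega),
        swf_of_ne (r := r + 1) _ (by omega) (by omega), swf_of_ne (r := r + 1) (j := r) _ (by omega) (by omega)]
      rw [swf_left, swf_right, swf_of_ne (r := r + 1) (j := r) _ (by omega) (by omega),
        swf_of_ne (r := r) (j := r + 1 + 1) _ (by omega) (by omega), swf_right, single_add,
        sub_right_comm _ _ (cartan l (ext i (r + 1)) (ext i (r + 1 + 1))),
        sub_right_comm _ _ (cartan l (ext i (r + 1)) (ext i (r + 1 + 1))),
        sub_right_comm _ (cartan l (ext i r) (ext i (r + 1 + 1)))]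
    · rename_i hc
      have h1 : ext i (r + 1) ≠ ext i r := by rw [hc.2]; simpa using one_ne_zero
      rw [if_pos hc, hc.1, cartan_self, cartan_comm l (ext i (r + 1)), cartan_succ h1 (Or.inl hc.2)]
      norm_num
    · rename_i hc' hc
      have h1 : ext i (r + 1) ≠ ext i r := by rw [hc.2]; simpa using one_ne_zero
      rw [if_neg hc', if_pos hc, hc.1, cartan_self, cartan_comm l (ext i (r + 1)),
        cartan_succ h1 (Or.inr hc.2)]
      norm_num
    · rename_i hc hc'
      rw [if_neg hc, if_neg hc', zero_mul, single_zero, zero_mul]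
  P_zero a h := by rw [D.P_zero a h, single_zero]
  y_zero := by rw [D.y_zero, single_zero]
  bad := by rw [single_mul_single, single_mul_single, D.bad, single_zero]

end TLData

lemma TLData.PP_mul_PP {l n : ℕ} [NeZero l] {R A : Type*} [CommRing R] [Ring A] [Algebra R A]
    {ξ : R} (D : TLData l n R A ξ) (r : ℕ) (a b a' b' : ZMod l) :
    D.P r a' * D.P (r + 1) b' * (D.P r a * D.P (r + 1) b) =
      if a' = a ∧ b' = b then D.P r a * D.P (r + 1) b else 0 := by
  rw [mul_assoc, ← mul_assoc (D.P (r + 1) b'), D.P_comm, mul_assoc, ← mul_assoc]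
  split_ifs with h
  · rw [h.1, h.2, D.P_idem, D.P_idem]
  · by_cases ha : a' = a
    · rw [D.P_orth (r + 1) b' b (fun hb => h ⟨ha, hb⟩), mul_zero]
    · rw [D.P_orth r a' a ha, zero_mul]

section Grading

open AddMonoidAlgebra

variable {l n : ℕ} [NeZero l] (hl : 2 ≤ l) (hn : 3 ≤ n)

/-- The homogeneous components of the Temperley-Lieb quotient. -/
def tlDeg (k : ℤ) : Submodule ℂ (TL l n hn) where
  carrier := {x | tlLift hn ((tlData l n hn).laurent hl) x = single k x}
  add_mem' {x y} hx hy := by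
    simp only [Set.mem_ofPred_eq] at *
    rw [map_add, hx, hy, single_add]
  zero_mem' := by simp only [Set.mem_ofPred_eq]; rw [map_zero, single_zero]
  smul_mem' c x hx := by
    simp only [Set.mem_ofPred_eq] at *
    rw [map_smul, hx, smul_single]

lemma mem_tlDeg {k : ℤ} {x : TL l n hn} :
    x ∈ tlDeg hl hn k ↔ tlLift hn ((tlData l n hn).laurent hl) x = single k x := Iff.rfl

instance tlDeg_gradedMonoid : SetLike.GradedMonoid (tlDeg hl hn) where
  one_mem := by rw [mem_tlDeg, map_one]; rfl
  mul_mem i j x y hx hy := by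
    rw [mem_tlDeg] at *
    rw [map_mul, hx, hy, single_mul_single]

lemma P_mem_tlDeg {j : ℕ} (h : j < n) (a : ZMod l) : (tlData l n hn).P j a ∈ tlDeg hl hn 0 :=
  (tlLift_compat hn ((tlData l n hn).laurent hl)).P j a h

lemma y_mem_tlDeg {j : ℕ} (h : j < n) : (tlData l n hn).y j ∈ tlDeg hl hn 2 :=
  tlLift_y hn ((tlData l n hn).laurent hl) h

lemma ψ_mem_tlDeg {r : ℕ} (h : r + 1 < n) (a b : ZMod l) :
    (tlData l n hn).ψ r * ((tlData l n hn).P r a * (tlData l n hn).P (r + 1) b) ∈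
      tlDeg hl hn (-cartan l a b) := by
  have hc := tlLift_compat hn ((tlData l n hn).laurent hl)
  have h1 : tlLift hn ((tlData l n hn).laurent hl) ((tlData l n hn).ψ r) =
    (tlData l n hn).ψL r := hc.ψ r h
  have h2 := P_mem_tlDeg hl hn (by omega : r < n) a
  have h3 := P_mem_tlDeg hl hn h b
  rw [mem_tlDeg] at *
  rw [map_mul, map_mul, h1, h2, h3, single_mul_single, TLData.ψL]
  simp only [Finset.sum_mul, single_mul_single]
  have e (a' b' : ZMod l) : (tlData l n hn).ψ r *
      ((tlData l n hn).P r a' * (tlData l n hn).P (r + 1) b') *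
      ((tlData l n hn).P r a * (tlData l n hn).P (r + 1) b) =
      if a' = a then (if b' = b then (tlData l n hn).ψ r *
        ((tlData l n hn).P r a * (tlData l n hn).P (r + 1) b) else 0) else 0 := by
    rw [mul_assoc, (tlData l n hn).PP_mul_PP, ite_and, mul_ite, mul_ite, mul_zero]
  simp only [e, apply_ite (single _), single_zero, Finset.sum_ite_irrel, Finset.sum_const_zero,
    Finset.sum_ite_eq', Finset.mem_univ, if_true, add_zero]

lemma tlLift_coe_coeff (x : DirectSum ℤ fun k => tlDeg hl hn k) (k : ℤ) :
    (tlLift hn ((tlData l n hn).laurent hl)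
      (DirectSum.coeAddMonoidHom (tlDeg hl hn) x)).coeff k = (x k : TL l n hn) := by
  induction x using DirectSum.induction_on with
  | zero => rw [map_zero, map_zero]; rfl
  | of i x =>
    rw [DirectSum.coeAddMonoidHom_of, (mem_tlDeg hl hn).1 x.2, coeff_single, Finsupp.single_apply,
      DirectSum.coe_of_apply]
    split_ifs <;> rfl
  | add x y hx hy =>
    rw [map_add, map_add, coeff_add, Finsupp.add_apply, hx, hy, DirectSum.add_apply]; rfl

lemma mul_mem_iSup_tlDeg {k : ℤ} {x z : TL l n hn} (hx : x ∈ tlDeg hl hn k)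
    (hz : z ∈ ⨆ i, tlDeg hl hn i) : x * z ∈ ⨆ i, tlDeg hl hn i := by
  induction hz using Submodule.iSup_induction' with
  | mem i z hz => exact Submodule.mem_iSup_of_mem (k + i) (SetLike.GradedMul.mul_mem hx hz)
  | zero => rw [mul_zero]; exact zero_mem _
  | add y z _ _ hy hz => rw [mul_add]; exact add_mem hy hz

lemma TLData.sum_ψ_PP {R A : Type*} [CommRing R] [Ring A] [Algebra R A]
    {ξ : R} (D : TLData l n R A ξ) (r : ℕ) :
    ∑ a, ∑ b, D.ψ r * (D.P r a * D.P (r + 1) b) = D.ψ r := by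
  simp only [← Finset.mul_sum, D.P_sum, mul_one]

lemma iSup_tlDeg : ⨆ i, tlDeg hl hn i = ⊤ := by
  refine eq_top_iff.2 fun x _ => ?_
  have hx : x ∈ (tlData l n hn).Alg n := by rw [tlAlg_eq_top]; trivial
  have h1 : (1 : TL l n hn) ∈ ⨆ i, tlDeg hl hn i :=
    Submodule.mem_iSup_of_mem 0 SetLike.GradedOne.one_mem
  rw [← mul_one x]
  refine (tlData l n hn).Alg_induction_left _ (fun j a hj z hz => ?_) (fun j hj z hz => ?_)
    (fun r hr z hz => ?_) hx 1 h1
  · exact mul_mem_iSup_tlDeg hl hn (P_mem_tlDeg hl hn hj a) hz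
  · exact mul_mem_iSup_tlDeg hl hn (y_mem_tlDeg hl hn hj) hz
  · rw [← TLData.sum_ψ_PP, Finset.sum_mul]
    refine sum_mem fun a _ => ?_
    rw [Finset.sum_mul]
    exact sum_mem fun b _ => mul_mem_iSup_tlDeg hl hn (ψ_mem_tlDeg hl hn hr a b) hz

lemma tlDeg_isInternal : DirectSum.IsInternal (tlDeg hl hn) := by
  refine ⟨fun x x' hx => DFinsupp.ext fun k => Subtype.ext ?_, ?_⟩
  · rw [← tlLift_coe_coeff, hx, tlLift_coe_coeff]
  · have h : LinearMap.range (DirectSum.coeLinearMap (tlDeg hl hn)) = ⊤ := by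
      rw [DirectSum.range_coeLinearMap, iSup_tlDeg]
    exact LinearMap.range_eq_top.1 h

/-- The grading of the Temperley-Lieb quotient. -/
@[reducible]
def tlGraded : GradedAlgebra (tlDeg hl hn) where
  __ := tlDeg_gradedMonoid hl hn
  __ := (tlDeg_isInternal hl hn).chooseDecomposition

end Grading

namespace TLData

variable {l n : ℕ} [NeZero l] {R A : Type*} [CommRing R] [Ring A] [Algebra R A] {ξ : R}

/-- The family of submodules `M` behaves like a grading for which the generators have their
usual degrees. -/
structure Homog (D : TLData l n R A ξ) (M : ℤ → Submodule R A) : Prop where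
  one : 1 ∈ M 0
  mul : ∀ i j x y, x ∈ M i → y ∈ M j → x * y ∈ M (i + j)
  P : ∀ j a, j < n → D.P j a ∈ M 0
  ψ : ∀ r a b, r + 1 < n → D.ψ r * (D.P r a * D.P (r + 1) b) ∈ M (-cartan l a b)

/-- The residue word obtained after applying `Rk s k`. -/
def RkWord (f : ℕ → ZMod l) (s : ℕ) : ℕ → ℕ → ZMod l
  | 0 => f
  | k + 1 => swf (RkWord f s k) (s + k)

/-- The degree of `Rk s k` on a vector of residue word `f`. -/
def RkDeg (f : ℕ → ZMod l) (s : ℕ) : ℕ → ℤ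
  | 0 => 0
  | k + 1 => RkDeg f s k - cartan l (RkWord f s k (s + k)) (RkWord f s k (s + k + 1))

/-- The degree of `ψw t m` on a vector of residue word `f`. -/
def wDeg (t : ℕ → Bool) : ℕ → (ℕ → ZMod l) → ℤ
  | 0, _ => 0
  | m + 1, f => if t m then RkDeg f (2 * cnt t m + 1) (m - 1 - 2 * cnt t m) +
      wDeg t m (RkWord f (2 * cnt t m + 1) (m - 1 - 2 * cnt t m)) else wDeg t m f

namespace Homog

variable {D : TLData l n R A ξ} {M : ℤ → Submodule R A} (h : Homog D M)
include h

lemma op : Homog D.op fun k => (M k).comap ((opLinearEquiv R).symm : Aᵐᵒᵖ ≃ₗ[R] A).toLinearMap where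
  one := h.one
  mul i j x y hx hy := by
    rw [add_comm]
    exact h.mul _ _ _ _ hy hx
  P j a hj := h.P j a hj
  ψ r a b hr := by
    have := h.ψ r b a hr
    rw [cartan_comm, ← mul_assoc, D.ψP1, mul_assoc, D.ψP2, ← mul_assoc] at this
    exact this

lemma ψ_mul {N : ℕ} {f : ℕ → ZMod l} {v : A} (hv : D.IsW N f v) {r : ℕ} (hr : r + 1 < N)
    (hn : r + 1 < n) {k : ℤ} (hk : v ∈ M k) :
    D.ψ r * v ∈ M (k - cartan l (f r) (f (r + 1))) := by
  rw [← hv.two hr, ← mul_assoc, sub_eq_neg_add]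
  exact h.mul _ _ _ _ (h.ψ r _ _ hn) hk

lemma Rk_mul {N : ℕ} (hN : N ≤ n) {f : ℕ → ZMod l} {v : A} (hv : D.IsW N f v) {k : ℤ}
    (hk : v ∈ M k) (s p : ℕ) (hp : p = 0 ∨ s + p < N) :
    D.IsW N (RkWord f s p) (D.Rk s p * v) ∧ D.Rk s p * v ∈ M (RkDeg f s p + k) := by
  induction p with
  | zero => exact ⟨by rw [Rk_zero, one_mul]; exact hv, by simpa [RkDeg] using hk⟩
  | succ p ih =>
    obtain ⟨h1, h2⟩ := ih (by omega)
    rw [Rk_succ, mul_assoc]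
    refine ⟨h1.ψ_swf (by omega), ?_⟩
    rw [RkDeg, sub_add_eq_add_sub]
    exact h.ψ_mul h1 (by omega) (by omega) h2

lemma ψw_mul {N : ℕ} (hN : N ≤ n) (t : ℕ → Bool) (m : ℕ) (hm : m ≤ N) :
    ∀ (f : ℕ → ZMod l) (v : A) (k : ℤ), D.IsW N f v → v ∈ M k →
      D.ψw t m * v ∈ M (wDeg t m f + k) := by
  induction m with
  | zero => intro f v k hv hk; simpa [ψw, wDeg] using hk
  | succ m ih =>
    intro f v k hv hk
    rw [ψw, wDeg]
    split_ifs
    · obtain ⟨h1, h2⟩ := h.Rk_mul hN hv hk (2 * cnt t m + 1) (m - 1 - 2 * cnt t m) (by omega)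
      rw [mul_assoc, add_comm (RkDeg _ _ _), add_assoc]
      exact ih (by omega) _ _ _ h1 h2
    · exact ih (by omega) _ _ _ hv hk

lemma J_mem (b m : ℕ) (hm : m ≤ n) : D.J b m ∈ M 0 := by
  induction m with
  | zero => exact h.one
  | succ m ih =>
    rw [J_succ]
    exact h.mul 0 0 _ _ (ih (by omega)) (h.P _ _ (by omega))

lemma ψw_J (b : ℕ) (t : ℕ → Bool) : D.ψw t n * D.J b n ∈ M (wDeg t n (resIni l b)) := by
  have := h.ψw_mul le_rfl t n le_rfl (resIni l b) (D.J b n) 0 (fun j a hj => D.P_J hj a)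
    (h.J_mem b n le_rfl)
  rwa [add_zero] at this

lemma C_mem (lam : TwoCol n) (s t : StdT n lam) : D.C lam s t ∈
    M (wDeg (tab s.1) n (resIni l lam.1) + wDeg (tab t.1) n (resIni l lam.1)) := by
  have h1 := h.ψw_J lam.1 (tab s.1)
  have h2 := h.op.ψw_J lam.1 (tab t.1)
  rw [op_J] at h2
  have h3 : D.J lam.1 n * D.ψr (tab t.1) ∈ M (wDeg (tab t.1) n (resIni l lam.1)) := h2
  have := h.mul _ _ _ _ h1 h3
  rwa [mul_assoc, ← mul_assoc (D.J _ _), show D.J lam.1 n * D.J lam.1 n = D.J lam.1 n from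
    D.E_idem _, ← mul_assoc] at this

lemma Ew_mem (f : ℕ → ZMod l) (m : ℕ) (hm : m ≤ n) : D.Ew f m ∈ M 0 := by
  induction m with
  | zero => exact h.one
  | succ m ih =>
    rw [Ew]
    exact h.mul 0 0 _ _ (ih (by omega)) (h.P _ _ (by omega))

end Homog

end TLData

section Degrees

variable {l n : ℕ} [NeZero l] (hl : 2 ≤ l) (hn : 3 ≤ n)

lemma tlDeg_homog : (tlData l n hn).Homog (tlDeg hl hn) where
  one := SetLike.GradedOne.one_mem
  mul _ _ _ _ hx hy := SetLike.GradedMul.mul_mem hx hy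
  P _ a hj := P_mem_tlDeg hl hn hj a
  ψ _ a b hr := ψ_mem_tlDeg hl hn hr a b

lemma eB_mem_tlDeg (i : Res l n) : eB l n hn i ∈ tlDeg hl hn 0 := by
  rw [eB_eq_EI]
  exact (tlDeg_homog hl hn).Ew_mem _ n le_rfl

lemma yB_mem_tlDeg (r : Fin n) : yB l n hn r ∈ tlDeg hl hn 2 := by
  have := y_mem_tlDeg hl hn r.2
  rwa [show (tlData l n hn).y r = yB l n hn r from yT_of_lt hn r.2] at this

lemma pB_mul_eB_mem_tlDeg (r : Fin (n - 1)) (i : Res l n) :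
    pB l n hn r * eB l n hn i ∈ tlDeg hl hn (-cartan l (i (lo r)) (i (hi r))) := by
  have hr : r.1 + 1 < n := by omega
  have := (tlDeg_homog hl hn).ψ_mul ((tlData l n hn).EI_isW i) hr hr
    (by rw [← eB_eq_EI]; exact eB_mem_tlDeg hl hn i)
  rw [← eB_eq_EI, ext_of_lt i hr, ext_of_lt i (by omega), zero_sub,
    show (tlData l n hn).ψ r = pB l n hn r from pT_of_lt hn hr] at this
  exact this

end Degrees

/-- Exchange the letters at positions `r` and `r + 1`. -/
def sw (r : ℕ) (t : ℕ → Bool) (k : ℕ) : Bool :=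
  if k = r then t (r + 1) else if k = r + 1 then t r else t k

lemma sw_left (r : ℕ) (t : ℕ → Bool) : sw r t r = t (r + 1) := if_pos rfl

lemma sw_right (r : ℕ) (t : ℕ → Bool) : sw r t (r + 1) = t r := by
  rw [sw, if_neg (by omega), if_pos rfl]

lemma sw_of_ne {r k : ℕ} (t : ℕ → Bool) (h : k ≠ r) (h' : k ≠ r + 1) : sw r t k = t k := by
  rw [sw, if_neg h, if_neg h']

lemma sw_sw (r : ℕ) (t : ℕ → Bool) : sw r (sw r t) = t := by
  funext k
  by_cases h : k = r
  · rw [h, sw_left, sw_right]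
  · by_cases h' : k = r + 1
    · rw [h', sw_right, sw_left]
    · rw [sw_of_ne _ h h', sw_of_ne _ h h']

lemma sw_comm {r s : ℕ} (h : r + 1 < s) (t : ℕ → Bool) : sw r (sw s t) = sw s (sw r t) := by
  funext k
  simp only [sw]
  split_ifs <;> first | rfl | omega

lemma cnt_sw {r k : ℕ} (t : ℕ → Bool) (h : k ≠ r + 1) : cnt (sw r t) k = cnt t k := by
  rcases Nat.lt_or_ge k (r + 1) with h' | h'
  · exact cnt_congr fun j hj => sw_of_ne _ (by omega) (by omega)
  · obtain ⟨m, rfl⟩ : ∃ m, k = r + 2 + m := ⟨k - (r + 2), by omega⟩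
    clear h h'
    induction m with
    | zero =>
      have e : cnt (sw r t) r = cnt t r :=
        cnt_congr fun j hj => sw_of_ne _ (by omega) (by omega)
      simp only [add_zero, cnt, sw_left, sw_right, e]
      omega
    | succ m ih => rw [← add_assoc, cnt, cnt, ih, sw_of_ne _ (by omega) (by omega)]

lemma cnt_sw_succ (r : ℕ) (t : ℕ → Bool) :
    cnt (sw r t) (r + 1) = cnt t r + if t (r + 1) then 1 else 0 := by
  rw [cnt, cnt_sw _ (by omega), sw_left]

/-- The content of the entry `j` of the tableau `t`. -/
def ct (t : ℕ → Bool) (j : ℕ) : ℤ := if t j then 1 - cnt t j else cnt t j - j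

lemma ct_sw_left {r : ℕ} {t : ℕ → Bool} (h : t r ≠ t (r + 1)) : ct (sw r t) r = ct t (r + 1) := by
  rw [ct, ct, sw_left, cnt_sw _ (by omega), cnt]
  cases h1 : t r <;> cases h2 : t (r + 1) <;> simp_all

lemma ct_sw_right {r : ℕ} {t : ℕ → Bool} (h : t r ≠ t (r + 1)) :
    ct (sw r t) (r + 1) = ct t r := by
  rw [ct, ct, sw_right, cnt_sw_succ]
  cases h1 : t r <;> cases h2 : t (r + 1) <;> simp_all

lemma ct_sw_of_ne {r j : ℕ} (t : ℕ → Bool) (h : j ≠ r) (h' : j ≠ r + 1) :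
    ct (sw r t) j = ct t j := by
  rw [ct, ct, sw_of_ne _ h h', cnt_sw _ h']

lemma ct_succ_of_eq {r : ℕ} {t : ℕ → Bool} (h : t r = t (r + 1)) : ct t (r + 1) = ct t r - 1 := by
  rw [ct, ct, ← h, cnt]
  cases t r <;> simp <;> ring

lemma ct_zero {n : ℕ} {t : ℕ → Bool} (ht : Ballot n t) (hn : 0 < n) : ct t 0 = 0 := by
  have := ht 1 hn
  cases h : t 0 <;> simp_all [ct, cnt]

/-- In a ballot sequence, contents in the second column exceed contents in the first one. -/
lemma Ballot.ct_lt {n r : ℕ} {t : ℕ → Bool} (ht : Ballot n t) (hr : r + 1 < n) (h : t r = false)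
    (h' : t (r + 1) = true) : ct t r < ct t (r + 1) := by
  have := ht (r + 1 + 1) hr
  simp only [ct, h, h', cnt] at *
  simp at *
  omega

lemma Ballot.ct_lt' {n r : ℕ} {t : ℕ → Bool} (ht : Ballot n t) (hr : r + 1 < n) (h : t r = true)
    (h' : t (r + 1) = false) : ct t (r + 1) + 1 < ct t r := by
  have := ht (r + 1) (by omega)
  simp only [ct, h, h', cnt] at *
  simp at *
  omega

lemma ballot_sw_of {n r : ℕ} {t : ℕ → Bool} (ht : Ballot n t)
    (h : 2 * (cnt t r + if t (r + 1) then 1 else 0) ≤ r + 1) :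
    Ballot n (sw r t) := fun k hk => by
  by_cases h' : k = r + 1
  · subst h'
    rwa [cnt_sw_succ]
  · rw [cnt_sw _ h']; exact ht k hk

/-- A ballot sequence stays ballot when a letter `true` is moved to the right. -/
lemma Ballot.sw {n r : ℕ} {t : ℕ → Bool} (ht : Ballot n t) (hr : r + 1 < n) (h' : t (r + 1) = false) :
    Ballot n (sw r t) := by
  refine ballot_sw_of ht ?_
  have := ht r (by omega)
  rw [h']; simp; omega

lemma Ballot.sw_of_ct {n r : ℕ} {t : ℕ → Bool} (ht : Ballot n t) (hr : r + 1 < n) (h : t r = false)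
    (h' : t (r + 1) = true) (hc : ct t (r + 1) ≠ ct t r + 1) : Ballot n (Statement2.sw r t) := by
  have := ht (r + 1 + 1) hr
  refine ballot_sw_of ht ?_
  simp only [ct, h, h', cnt] at *
  simp at *
  omega

/-- A ballot sequence is determined by its contents. -/
lemma Ballot.eq_of_ct {n : ℕ} {t t' : ℕ → Bool} (ht : Ballot n t) (ht' : Ballot n t')
    (h : ∀ j < n, ct t j = ct t' j) : ∀ j < n, t j = t' j := by
  intro j
  induction j using Nat.strong_induction_on with
  | _ j ih =>
    intro hj
    have e : cnt t j = cnt t' j := cnt_congr fun k hk => ih k hk (by omega)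
    have h0 := h j hj
    have h1 := ht j hj.le
    have h2 := ht (j + 1) hj
    have h3 := ht' (j + 1) hj
    rw [cnt] at h2 h3
    rw [ct, ct] at h0
    cases h4 : t j <;> cases h5 : t' j <;> simp [h4, h5] at * <;> omega

/-- Ballot sequences of length `n`, extended by `false`. -/
abbrev Bal (n : ℕ) := {t : ℕ → Bool // Ballot n t ∧ ∀ k, n ≤ k → t k = false}

namespace Model

variable (l n : ℕ) [NeZero l] {K : Type*} [Field K] (x : K)

open Classical in
/-- The basis vector of a ballot sequence (zero for other sequences). -/
def vec (t : ℕ → Bool) : Bal n →₀ K :=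
  if h : Ballot n t ∧ ∀ k, n ≤ k → t k = false then Finsupp.single ⟨t, h⟩ 1 else 0

/-- The operator sending the basis vector of `t` to `f t`. -/
def opr (f : (ℕ → Bool) → (Bal n →₀ K)) : Module.End K (Bal n →₀ K) :=
  Finsupp.linearCombination K fun t : Bal n => f t.1

variable {n} in
lemma opr_vec {f : (ℕ → Bool) → (Bal n →₀ K)} (hf : ∀ t, vec n (K := K) t = 0 → f t = 0)
    (t : ℕ → Bool) : opr n f (vec n t) = f t := by
  by_cases h : Ballot n t ∧ ∀ k, n ≤ k → t k = false
  · rw [vec, dif_pos h, opr, Finsupp.linearCombination_single, one_smul]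
  · rw [hf t (dif_neg h), vec, dif_neg h, map_zero]

variable {n} in
lemma vec_ne_zero (t : Bal n) : vec n (K := K) t.1 ≠ 0 := by
  rw [vec, dif_pos t.2]
  exact fun h => one_ne_zero (Finsupp.single_eq_zero.1 h)

variable {n} in
lemma end_ext {f g : Module.End K (Bal n →₀ K)}
    (h : ∀ t, Ballot n t → f (vec n t) = g (vec n t)) : f = g := by
  refine Finsupp.lhom_ext' fun t => LinearMap.ext_ring ?_
  have := h t.1 t.2.1
  rwa [vec, dif_pos t.2] at this

/-- The operator acting on basis vectors by scalars. -/
def dg (f : (ℕ → Bool) → K) : Module.End K (Bal n →₀ K) := opr n fun t => f t • vec n t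

lemma dg_vec (f : (ℕ → Bool) → K) (t : ℕ → Bool) : dg n f (vec n t) = f t • vec n t :=
  opr_vec (fun t ht => by rw [ht, smul_zero]) t

/-- Contents, truncated to positions below `n`. -/
def ctn (t : ℕ → Bool) (j : ℕ) : ℤ := if j < n then ct t j else 0

/-- The diagonal coefficient of a crossing. -/
def dl (h : ℤ) : K := if (h : ZMod l) = 0 then (x * h)⁻¹ else 0

/-- The product of the two off-diagonal coefficients of a crossing. -/
def kp (h : ℤ) : K :=
  if (h : ZMod l) = 0 then -((x * h)⁻¹ * (x * h)⁻¹) else if (h : ZMod l) = 1 then x * (h - 1)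
    else if (h : ZMod l) = -1 then -(x * (h + 1)) else 1

/-- The off-diagonal coefficient of a crossing. -/
def od (b : Bool) (h : ℤ) : K := if b then 1 else kp l x h

/-- The difference of two consecutive contents. -/
def hd (r : ℕ) (t : ℕ → Bool) : ℤ := ct t (r + 1) - ct t r

lemma dl_neg (h : ℤ) : dl l x (-h) = -dl l x h := by
  simp only [dl, Int.cast_neg, neg_eq_zero]
  split_ifs
  · rw [mul_neg, inv_neg]
  · rw [neg_zero]

lemma two_ne (hl : 3 ≤ l) : (1 : ZMod l) ≠ -1 := by
  intro h
  have h2 : ((2 : ℕ) : ZMod l) = 0 := by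
    push_cast; linear_combination h
  have := Nat.le_of_dvd (by norm_num) ((ZMod.natCast_eq_zero_iff 2 l).1 h2)
  omega

lemma kp_neg (hl : 3 ≤ l) (h : ℤ) : kp l x (-h) = kp l x h := by
  have h2 := two_ne l hl
  simp only [kp, Int.cast_neg, neg_eq_zero, neg_inj, neg_eq_iff_eq_neg (b := (1 : ZMod l))]
  split_ifs with h0 h1 h3 h3
  · rw [mul_neg, inv_neg, neg_mul_neg]
  · exact absurd (h3.symm.trans h1) h2
  · ring
  · ring
  · rfl

lemma hd_sw {r : ℕ} {t : ℕ → Bool} (h : t r ≠ t (r + 1)) : hd r (sw r t) = -hd r t := by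
  rw [hd, hd, ct_sw_left h, ct_sw_right h, neg_sub]

/-- The action of a crossing on basis vectors. -/
def psiFun (r : ℕ) (t : ℕ → Bool) : Bal n →₀ K :=
  if t r = t (r + 1) then 0 else dl l x (hd r t) • vec n t + od l x (t (r + 1)) (hd r t) •
    vec n (sw r t)

/-- The operator of a crossing. -/
def psi (r : ℕ) : Module.End K (Bal n →₀ K) := if r + 1 < n then opr n (psiFun l n x r) else 0

variable {n}

lemma vec_eq_zero {t : ℕ → Bool} (h : vec n (K := K) t = 0) :
    ¬ (Ballot n t ∧ ∀ k, n ≤ k → t k = false) := fun h' => vec_ne_zero ⟨t, h'⟩ h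

lemma tail_sw {r : ℕ} (hr : r + 1 < n) {t : ℕ → Bool} (h : ∀ k, n ≤ k → sw r t k = false) (k : ℕ)
    (hk : n ≤ k) : t k = false := by
  rw [← h k hk, sw_of_ne _ (by omega) (by omega)]

lemma psi_vec (hl : 3 ≤ l) {r : ℕ} (hr : r + 1 < n) (t : ℕ → Bool) :
    psi l n x r (vec n t) = psiFun l n x r t := by
  rw [psi, if_pos hr]
  refine opr_vec (fun t ht => ?_) t
  rw [psiFun]
  split_ifs with h
  · rfl
  · rw [ht, smul_zero, zero_add]
    by_cases h' : Ballot n (sw r t) ∧ ∀ k, n ≤ k → sw r t k = false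
    · have h1 := vec_eq_zero ht
      have h2 : ¬ Ballot n t := fun h2 => h1 ⟨h2, tail_sw hr h'.2⟩
      rw [← sw_sw r t] at h2
      cases h3 : t (r + 1) with
      | true =>
        refine absurd (h'.1.sw hr ?_) h2
        rw [sw_right]; rw [h3] at h; simpa using h
      | false =>
        by_cases h4 : ct (sw r t) (r + 1) = ct (sw r t) r + 1
        · rw [ct_sw_left h, ct_sw_right h] at h4
          have e : hd r t = -1 := by rw [hd]; omega
          have : Fact (1 < l) := ⟨by omega⟩
          rw [e, od, if_neg (by simp), kp_neg l x hl, kp]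
          simp
        · refine absurd (h'.1.sw_of_ct hr ?_ ?_ h4) h2
          · rw [sw_left, h3]
          · rw [sw_right]; rw [h3] at h; simpa using h
    · rw [vec, dif_neg h', smul_zero]

end Model

namespace Model

variable (l : ℕ) {n : ℕ} [NeZero l] {K : Type*} [Field K] (x : K)

lemma hd_sw_far {r s : ℕ} (t : ℕ → Bool) (h : r + 1 < s ∨ s + 1 < r) :
    hd r (sw s t) = hd r t := by
  rw [hd, hd, ct_sw_of_ne _ (by omega) (by omega), ct_sw_of_ne _ (by omega) (by omega)]

lemma od_neg (hl : 3 ≤ l) (b : Bool) (h : ℤ) : od l x b (-h) = od l x b h := by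
  rw [od, od, kp_neg l x hl]

lemma od_mul_od {b b' : Bool} (hb : b ≠ b') (h : ℤ) : od l x b h * od l x b' h = kp l x h := by
  cases b <;> cases b' <;> simp_all [od]

lemma psi_vec_eq (r : ℕ) {t : ℕ → Bool} (hl : 3 ≤ l) (h : t r = t (r + 1)) :
    psi l n x r (vec n t) = 0 := by
  by_cases hr : r + 1 < n
  · rw [psi_vec l x hl hr, psiFun, if_pos h]
  · rw [psi, if_neg hr, LinearMap.zero_apply]

lemma psi_vec_ne {r : ℕ} {t : ℕ → Bool} (hl : 3 ≤ l) (hr : r + 1 < n) (h : t r ≠ t (r + 1)) :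
    psi l n x r (vec n t) = dl l x (hd r t) • vec n t + od l x (t (r + 1)) (hd r t) •
    vec n (sw r t) := by
  rw [psi_vec l x hl hr, psiFun, if_neg h]

lemma psi_vec_sw {r : ℕ} {t : ℕ → Bool} (hl : 3 ≤ l) (hr : r + 1 < n) (h : t r ≠ t (r + 1)) :
    psi l n x r (vec n (sw r t)) = -dl l x (hd r t) • vec n (sw r t) +
      od l x (t r) (hd r t) • vec n t := by
  rw [psi_vec_ne l x hl hr (by rwa [sw_left, sw_right, ne_comm]), sw_right, hd_sw h, dl_neg,
    od_neg l x hl, sw_sw]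

lemma psi_mul_dg (hl : 3 ≤ l) (r : ℕ) (f g : (ℕ → Bool) → K)
    (h : r + 1 < n → ∀ t, Ballot n t → t r ≠ t (r + 1) →
      f t = g (sw r t) ∧ (dl l x (hd r t) ≠ 0 → f t = g t)) :
    psi l n x r * dg n f = dg n g * psi l n x r := by
  by_cases hr : r + 1 < n
  · refine end_ext fun t ht => ?_
    rw [Module.End.mul_apply, Module.End.mul_apply, dg_vec, map_smul]
    by_cases hd' : t r = t (r + 1)
    · rw [psi_vec_eq l x r hl hd', map_zero, smul_zero]
    · obtain ⟨h1, h2⟩ := h hr t ht hd'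
      rw [psi_vec_ne l x hl hr hd', map_add, map_smul, map_smul, dg_vec, dg_vec, ← h1, smul_add,
        smul_comm (f t), smul_comm (f t)]
      congr 1
      by_cases h3 : dl l x (hd r t) = 0
      · rw [h3, zero_smul, zero_smul]
      · rw [h2 h3]
  · rw [psi, if_neg hr, zero_mul, mul_zero]

lemma dg_mul (f g : (ℕ → Bool) → K) : dg n f * dg n g = dg n (f * g) :=
  end_ext fun t _ => by
    rw [Module.End.mul_apply, dg_vec, map_smul, dg_vec, dg_vec, smul_smul, mul_comm]; rfl

lemma psi_comm (hl : 3 ≤ l) {r s : ℕ} (h : r + 1 < s) :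
    psi l n x r * psi l n x s = psi l n x s * psi l n x r := by
  by_cases hs : s + 1 < n
  · refine end_ext fun t ht => ?_
    rw [Module.End.mul_apply, Module.End.mul_apply]
    have hr : r + 1 < n := by omega
    have e1 : sw s t r = t r := sw_of_ne _ (by omega) (by omega)
    have e2 : sw s t (r + 1) = t (r + 1) := sw_of_ne _ (by omega) (by omega)
    have e3 : sw r t s = t s := sw_of_ne _ (by omega) (by omega)
    have e4 : sw r t (s + 1) = t (s + 1) := sw_of_ne _ (by omega) (by omega)
    by_cases h1 : t r = t (r + 1)
    · rw [psi_vec_eq l x r hl h1, map_zero]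
      by_cases h2 : t s = t (s + 1)
      · rw [psi_vec_eq l x s hl h2, map_zero]
      · rw [psi_vec_ne l x hl hs h2, map_add, map_smul, map_smul, psi_vec_eq l x r hl h1,
          psi_vec_eq l x r hl (by rw [e1, e2, h1]), smul_zero, smul_zero, add_zero]
    · by_cases h2 : t s = t (s + 1)
      · rw [psi_vec_eq l x s hl h2, map_zero, psi_vec_ne l x hl hr h1, map_add, map_smul, map_smul,
          psi_vec_eq l x s hl h2,
          psi_vec_eq l x s hl (by rw [e3, e4, h2]), smul_zero, smul_zero, add_zero]
      · rw [psi_vec_ne l x hl hr h1, psi_vec_ne l x hl hs h2, map_add, map_smul, map_smul, map_add,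
          map_smul, map_smul, psi_vec_ne l x hl hr h1, psi_vec_ne l x hl hs h2,
          psi_vec_ne l x hl hr (by rwa [e1, e2]), psi_vec_ne l x hl hs (by rwa [e3, e4]),
          hd_sw_far _ (Or.inl h), hd_sw_far _ (Or.inr h), e2, e4, sw_comm h]
        module
  · rw [psi, psi, if_neg hs, zero_mul, mul_zero]

lemma psi_sq (hl : 3 ≤ l) {r : ℕ} {t : ℕ → Bool} (hr : r + 1 < n) (h : t r ≠ t (r + 1)) :
    psi l n x r (psi l n x r (vec n t)) =
      (dl l x (hd r t) * dl l x (hd r t) + kp l x (hd r t)) • vec n t := by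
  rw [psi_vec_ne l x hl hr h, map_add, map_smul, map_smul, psi_vec_ne l x hl hr h,
    psi_vec_sw l x hl hr h, ← od_mul_od l x h]
  module

lemma dl_mul_dl (hl : 3 ≤ l) (h : ℤ) : dl l x h * dl l x (h - 1) = 0 := by
  have : Fact (1 < l) := ⟨by omega⟩
  rw [dl, dl]
  split_ifs with h1 h2
  · rw [Int.cast_sub, h1] at h2; simp at h2
  · rw [mul_zero]
  · rw [zero_mul]
  · rw [zero_mul]

section
variable (hl : 3 ≤ l) {r : ℕ} {t : ℕ → Bool} (hr : r + 2 < n) (h : t r ≠ t (r + 1))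
  (h' : t (r + 2) = t (r + 1))
include hl hr h h'

omit [NeZero l] hl hr in
lemma hd_succ_sw : hd (r + 1) (sw r t) = hd r t - 1 := by
  have := ct_succ_of_eq (r := r + 1) h'.symm
  rw [hd, hd, ct_sw_right h, ct_sw_of_ne _ (by omega) (by omega), this]
  ring

lemma psi_succ_vec_sw : psi l n x (r + 1) (vec n (sw r t)) =
    dl l x (hd r t - 1) • vec n (sw r t) +
      od l x (t (r + 1)) (hd r t - 1) • vec n (sw (r + 1) (sw r t)) := by
  rw [psi_vec_ne l x hl hr, hd_succ_sw h h', sw_of_ne _ (by omega) (by omega), h']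
  rw [sw_right, sw_of_ne _ (by omega) (by omega), h']
  exact h

lemma psi_succ_vec_sw_sw : psi l n x (r + 1) (vec n (sw (r + 1) (sw r t))) =
    -dl l x (hd r t - 1) • vec n (sw (r + 1) (sw r t)) +
      od l x (t r) (hd r t - 1) • vec n (sw r t) := by
  rw [psi_vec_sw l x hl hr, hd_succ_sw h h', sw_right]
  rw [sw_right, sw_of_ne _ (by omega) (by omega), h']
  exact h

lemma psi_vec_sw_sw : psi l n x r (vec n (sw (r + 1) (sw r t))) = 0 := by
  refine psi_vec_eq l x _ hl ?_
  rw [sw_left, sw_of_ne _ (by omega) (by omega), sw_left, sw_of_ne _ (by omega) (by omega), h']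

lemma braid_left_zero : psi l n x r (psi l n x (r + 1) (psi l n x r (vec n t))) =
    (kp l x (hd r t) * dl l x (hd r t - 1)) • vec n t := by
  have e := dl_mul_dl l x hl (hd r t)
  rw [psi_vec_ne l x hl (by omega) h, map_add, map_smul, map_smul, psi_vec_eq l x (r + 1) hl h'.symm,
    psi_succ_vec_sw l x hl hr h h', smul_zero, zero_add, map_smul, map_add, map_smul, map_smul,
    psi_vec_sw_sw l x hl hr h h', psi_vec_sw l x hl (by omega) h, ← od_mul_od l x h]
  match_scalars
  · linear_combination (-od l x (t (r + 1)) (hd r t)) * e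
  · ring

omit hr h in
lemma braid_right_zero : psi l n x (r + 1) (psi l n x r (psi l n x (r + 1) (vec n t))) = 0 := by
  rw [psi_vec_eq l x (r + 1) hl h'.symm, map_zero, map_zero]

lemma braid_left_one : psi l n x r (psi l n x (r + 1) (psi l n x r (vec n (sw r t)))) = 0 := by
  have e := dl_mul_dl l x hl (hd r t)
  rw [psi_vec_sw l x hl (by omega) h, map_add, map_smul, map_smul,
    psi_vec_eq l x (r + 1) hl h'.symm, psi_succ_vec_sw l x hl hr h h', smul_zero, add_zero, smul_add,
    smul_smul, neg_mul, e, neg_zero, zero_smul, zero_add, map_smul, map_smul,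
    psi_vec_sw_sw l x hl hr h h', smul_zero, smul_zero]

lemma braid_right_one :
    psi l n x (r + 1) (psi l n x r (psi l n x (r + 1) (vec n (sw r t)))) = 0 := by
  have e := dl_mul_dl l x hl (hd r t)
  rw [psi_succ_vec_sw l x hl hr h h', map_add, map_smul, map_smul, psi_vec_sw_sw l x hl hr h h',
    psi_vec_sw l x hl (by omega) h, smul_zero, add_zero, smul_add, smul_smul, mul_neg,
    mul_comm (dl _ _ _), e, neg_zero, zero_smul, zero_add, map_smul, map_smul,
    psi_vec_eq l x (r + 1) hl h'.symm, smul_zero, smul_zero]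

lemma braid_left_two :
    psi l n x r (psi l n x (r + 1) (psi l n x r (vec n (sw (r + 1) (sw r t))))) = 0 := by
  rw [psi_vec_sw_sw l x hl hr h h', map_zero, map_zero]

lemma braid_right_two :
    psi l n x (r + 1) (psi l n x r (psi l n x (r + 1) (vec n (sw (r + 1) (sw r t))))) =
    -(dl l x (hd r t) * kp l x (hd r t - 1)) • vec n (sw (r + 1) (sw r t)) := by
  have e := dl_mul_dl l x hl (hd r t)
  rw [psi_succ_vec_sw_sw l x hl hr h h', map_add, map_smul, map_smul, psi_vec_sw_sw l x hl hr h h',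
    psi_vec_sw l x hl (by omega) h, smul_zero, zero_add, map_smul, map_add, map_smul, map_smul,
    psi_vec_eq l x (r + 1) hl h'.symm, psi_succ_vec_sw l x hl hr h h', ← od_mul_od l x h]
  match_scalars
  · linear_combination (-od l x (t r) (hd r t - 1)) * e
  · ring

end

end Model

namespace Model

variable (l : ℕ) {n : ℕ} [NeZero l] {K : Type*} [Field K] (x : K)

/-- The projection on the tableaux with content `a` modulo `l` at position `j`. -/
def pr (n j : ℕ) (a : ZMod l) : Module.End K (Bal n →₀ K) :=
  dg n fun t => if (ctn n t j : ZMod l) = a then 1 else 0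

/-- The content operators. -/
def jm (n j : ℕ) : Module.End K (Bal n →₀ K) := dg n fun t => x * ctn n t j

lemma ctn_of_lt {j : ℕ} (h : j < n) (t : ℕ → Bool) : ctn n t j = ct t j := if_pos h

lemma ctn_sw_left {r : ℕ} {t : ℕ → Bool} (hr : r + 1 < n) (h : t r ≠ t (r + 1)) :
    ctn n (sw r t) r = ctn n t (r + 1) := by
  rw [ctn_of_lt hr, ctn_of_lt (by omega), ct_sw_left h]

lemma ctn_sw_right {r : ℕ} {t : ℕ → Bool} (hr : r + 1 < n) (h : t r ≠ t (r + 1)) :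
    ctn n (sw r t) (r + 1) = ctn n t r := by
  rw [ctn_of_lt hr, ctn_of_lt (by omega), ct_sw_right h]

lemma ctn_sw_of_ne {r j : ℕ} (t : ℕ → Bool) (h : j ≠ r) (h' : j ≠ r + 1) :
    ctn n (sw r t) j = ctn n t j := by
  rw [ctn, ctn, ct_sw_of_ne t h h']

lemma ctn_eq_of_dl {r : ℕ} {t : ℕ → Bool} (hr : r + 1 < n) (h : dl l x (hd r t) ≠ 0) :
    (ctn n t (r + 1) : ZMod l) = ctn n t r := by
  rw [dl] at h
  have := (ite_ne_right_iff.1 h).1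
  rw [hd, Int.cast_sub, sub_eq_zero] at this
  rw [ctn_of_lt hr, ctn_of_lt (by omega), this]

lemma pr_vec (j : ℕ) (a : ZMod l) (t : ℕ → Bool) : pr (K := K) l n j a (vec n t) =
    if (ctn n t j : ZMod l) = a then vec n t else 0 := by
  rw [pr, dg_vec, ite_smul, one_smul, zero_smul]

lemma mul_pr_pr {X Y : Module.End K (Bal n →₀ K)} {i j : ℕ} {a b : ZMod l}
    (h : ∀ t, Ballot n t → (ctn n t i : ZMod l) = a → (ctn n t j : ZMod l) = b →
      X (vec n t) = Y (vec n t)) : X * (pr l n i a * pr l n j b) = Y * (pr l n i a * pr l n j b) :=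
  end_ext fun t ht => by
    simp only [Module.End.mul_apply, pr_vec]
    split_ifs with h1
    · rw [pr_vec]
      split_ifs with h2
      · exact h t ht h2 h1
      · rw [map_zero, map_zero]
    · rw [map_zero, map_zero, map_zero]

lemma mul_pr_pr_pr {X Y : Module.End K (Bal n →₀ K)} {i j k : ℕ} {a b c : ZMod l}
    (h : ∀ t, Ballot n t → (ctn n t i : ZMod l) = a → (ctn n t j : ZMod l) = b →
      (ctn n t k : ZMod l) = c → X (vec n t) = Y (vec n t)) :
    X * (pr l n i a * pr l n j b * pr l n k c) = Y * (pr l n i a * pr l n j b * pr l n k c) :=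
  end_ext fun t ht => by
    simp only [Module.End.mul_apply, pr_vec]
    split_ifs with h1
    · rw [pr_vec]
      split_ifs with h2
      · rw [pr_vec]
        split_ifs with h3
        · exact h t ht h3 h2 h1
        · rw [map_zero, map_zero]
      · rw [map_zero, map_zero, map_zero]
    · rw [map_zero, map_zero, map_zero, map_zero]

lemma sum_pr_pr_vec (i j : ℕ) (t : ℕ → Bool) :
    (∑ a, pr l n i a * pr l n j a : Module.End K (Bal n →₀ K)) (vec n t) =
      if (ctn n t i : ZMod l) = ctn n t j then vec (K := K) n t else 0 := by
  rw [LinearMap.sum_apply, Finset.sum_eq_single (ctn n t j : ZMod l)]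
  · rw [Module.End.mul_apply, pr_vec, if_pos rfl, pr_vec]
  · intro b _ hb
    rw [Module.End.mul_apply, pr_vec, if_neg hb.symm, map_zero]
  · simp

lemma hd_ne_zero {r : ℕ} {t : ℕ → Bool} (ht : Ballot n t) (hr : r + 1 < n)
    (h : t r ≠ t (r + 1)) : hd r t ≠ 0 := by
  rw [hd]
  cases h1 : t r <;> cases h2 : t (r + 1) <;> simp only [h1, h2, ne_eq, not_true] at h
  · have := ht.ct_lt hr h1 h2; omega
  · have := ht.ct_lt' hr h1 h2; omega

variable {x} [CharZero K]

omit [NeZero l] in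
lemma dl_mul_self (hx : x ≠ 0) {h : ℤ} (hh : h ≠ 0) :
    dl l x h * (x * h) = if (h : ZMod l) = 0 then 1 else 0 := by
  have : (h : K) ≠ 0 := by exact_mod_cast hh
  rw [dl]
  split_ifs
  · exact inv_mul_cancel₀ (mul_ne_zero hx this)
  · exact zero_mul _

omit [NeZero l] in
lemma res_iff {r : ℕ} (hr : r + 1 < n) (t : ℕ → Bool) :
    ((ctn n t r : ZMod l) = ctn n t (r + 1)) ↔ (hd r t : ZMod l) = 0 := by
  rw [ctn_of_lt hr, ctn_of_lt (by omega), hd, Int.cast_sub, sub_eq_zero, eq_comm]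

omit [CharZero K] in
lemma jm_vec (j : ℕ) (t : ℕ → Bool) : jm x n j (vec n t) = (x * ctn n t j) • vec n t := by
  rw [jm, dg_vec]

omit [NeZero l] in
lemma zmod_int_ne {m : ℤ} (h : m ≠ 0) (h' : |m| < l) : (m : ZMod l) ≠ 0 := by
  rw [Ne, ZMod.intCast_zmod_eq_zero_iff_dvd]
  exact fun h2 => h (Int.eq_zero_of_abs_lt_dvd h2 h')

lemma psi_jm (hl : 3 ≤ l) (hx : x ≠ 0) {r : ℕ} (hr : r + 1 < n) :
    psi l n x r * jm x n (r + 1) = jm x n r * psi l n x r + ∑ a, pr l n r a * pr l n (r + 1) a := by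
  refine end_ext fun t ht => ?_
  rw [LinearMap.add_apply, Module.End.mul_apply, Module.End.mul_apply, sum_pr_pr_vec, jm_vec,
    map_smul]
  by_cases h : t r = t (r + 1)
  · rw [psi_vec_eq l x r hl h, map_zero, smul_zero, zero_add, if_neg]
    have := ct_succ_of_eq h
    have : Fact (1 < l) := ⟨by omega⟩
    rw [res_iff l hr, hd, (by omega : ct t (r + 1) - ct t r = -1)]
    simp
  · have e := dl_mul_self l hx (hd_ne_zero ht hr h)
    simp only [← res_iff l hr] at e
    rw [psi_vec_ne l x hl hr h, map_add, map_smul, map_smul, jm_vec, jm_vec, ctn_sw_left hr h]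
    have e2 : (ctn n t (r + 1) : K) = ctn n t r + hd r t := by
      rw [ctn_of_lt hr, ctn_of_lt (by omega), hd]; push_cast; ring
    split_ifs at e ⊢
    · match_scalars
      · rw [e2]; linear_combination e
      · ring
    · match_scalars
      · rw [e2]; linear_combination e
      · ring

lemma jm_psi (hl : 3 ≤ l) (hx : x ≠ 0) {r : ℕ} (hr : r + 1 < n) :
    jm x n (r + 1) * psi l n x r = psi l n x r * jm x n r + ∑ a, pr l n r a * pr l n (r + 1) a := by
  refine end_ext fun t ht => ?_
  rw [LinearMap.add_apply, Module.End.mul_apply, Module.End.mul_apply, sum_pr_pr_vec, jm_vec,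
    map_smul]
  by_cases h : t r = t (r + 1)
  · rw [psi_vec_eq l x r hl h, map_zero, smul_zero, zero_add, if_neg]
    have := ct_succ_of_eq h
    have : Fact (1 < l) := ⟨by omega⟩
    rw [res_iff l hr, hd, (by omega : ct t (r + 1) - ct t r = -1)]
    simp
  · have e := dl_mul_self l hx (hd_ne_zero ht hr h)
    simp only [← res_iff l hr] at e
    rw [psi_vec_ne l x hl hr h, map_add, map_smul, map_smul, jm_vec, jm_vec, ctn_sw_right hr h]
    have e2 : (ctn n t (r + 1) : K) = ctn n t r + hd r t := by
      rw [ctn_of_lt hr, ctn_of_lt (by omega), hd]; push_cast; ring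
    split_ifs at e ⊢
    · match_scalars
      · rw [e2]; linear_combination e
      · ring
    · match_scalars
      · rw [e2]; linear_combination e
      · ring

lemma psi_psi (hl : 3 ≤ l) {r : ℕ} (hr : r + 1 < n) (a b : ZMod l) :
    psi l n x r * psi l n x r * (pr l n r a * pr l n (r + 1) b) =
    (if b = a then 0 else if b = a + 1 then jm x n (r + 1) - jm x n r - algebraMap K _ x
      else if b = a - 1 then jm x n r - jm x n (r + 1) - algebraMap K _ x else 1) *
      (pr l n r a * pr l n (r + 1) b) := by
  have : Fact (1 < l) := ⟨by omega⟩
  have h2 := two_ne l hl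
  refine mul_pr_pr l fun t ht ha hb => ?_
  have e2 : (ctn n t (r + 1) : K) = ctn n t r + hd r t := by
      rw [ctn_of_lt hr, ctn_of_lt (by omega), hd]; push_cast; ring
  have e3 : b = a + (hd r t : ZMod l) := by
    rw [← ha, ← hb, ctn_of_lt hr, ctn_of_lt (by omega), hd]; push_cast; ring
  subst e3
  rw [Module.End.mul_apply]
  by_cases h : t r = t (r + 1)
  · have h3 : hd r t = -1 := by rw [hd, ct_succ_of_eq h]; ring
    rw [psi_vec_eq l x r hl h, map_zero, h3, if_neg (by simp), if_neg (by simpa using h2.symm),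
      if_pos (by simp; ring), LinearMap.sub_apply, LinearMap.sub_apply, jm_vec, jm_vec,
      Module.algebraMap_end_apply, e2, h3]
    match_scalars
    push_cast
    ring
  · have e4 : ∀ u : ZMod l, a + (hd r t : ZMod l) = a + u ↔ (hd r t : ZMod l) = u :=
      fun u => add_right_inj a
    rw [psi_sq l x hl hr h, kp, dl, sub_eq_add_neg a]
    simp only [e4, add_eq_left]
    by_cases h3 : (hd r t : ZMod l) = 0
    · rw [if_pos h3, if_pos h3, if_pos h3, add_neg_cancel, zero_smul, LinearMap.zero_apply]
    · rw [if_neg h3, if_neg h3, if_neg h3, mul_zero, zero_add]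
      by_cases h4 : (hd r t : ZMod l) = 1
      · rw [if_pos h4, if_pos h4, LinearMap.sub_apply, LinearMap.sub_apply, jm_vec, jm_vec,
          Module.algebraMap_end_apply, e2]
        match_scalars
        ring
      · rw [if_neg h4, if_neg h4]
        by_cases h5 : (hd r t : ZMod l) = -1
        · rw [if_pos h5, if_pos h5, LinearMap.sub_apply, LinearMap.sub_apply,
            jm_vec, jm_vec, Module.algebraMap_end_apply, e2]
          match_scalars
          ring
        · rw [if_neg h5, if_neg h5, one_smul, Module.End.one_apply]

end Model

namespace Model

variable (l : ℕ) {n : ℕ} [NeZero l] {K : Type*} [Field K] {x : K} [CharZero K]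

lemma two_ne_zero_mod (hl : 3 ≤ l) : (2 : ZMod l) ≠ 0 := fun h => two_ne l hl <| by
  linear_combination h

lemma kp_mul_dl (hl : 3 ≤ l) (hx : x ≠ 0) {h : ℤ} (hh : h ≠ 1) :
    kp l x h * dl l x (h - 1) = if (h : ZMod l) = 1 then 1 else 0 := by
  have : Fact (1 < l) := ⟨by omega⟩
  rw [dl, kp, Int.cast_sub, Int.cast_one]
  simp only [sub_eq_zero (b := (1 : ZMod l))]
  by_cases h1 : (h : ZMod l) = 1
  · have h2 : (h : K) - 1 ≠ 0 := by rw [sub_ne_zero]; exact_mod_cast hh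
    rw [if_neg (by rw [h1]; simp), if_pos h1, if_pos h1, if_pos h1, Int.cast_sub, Int.cast_one]
    exact mul_inv_cancel₀ (mul_ne_zero hx h2)
  · rw [if_neg h1, if_neg h1, if_neg h1, mul_zero]

lemma dl_mul_kp (hl : 3 ≤ l) (hx : x ≠ 0) {h : ℤ} (hh : h ≠ 0) :
    dl l x h * kp l x (h - 1) = if (h : ZMod l) = 0 then -1 else 0 := by
  have : Fact (1 < l) := ⟨by omega⟩
  rw [dl, kp, Int.cast_sub, Int.cast_one]
  by_cases h1 : (h : ZMod l) = 0
  · have h2 : (h : K) ≠ 0 := by exact_mod_cast hh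
    rw [if_pos h1, h1, if_neg (by simp), if_neg (by simpa using (two_ne l hl).symm),
      if_pos (by simp), if_pos rfl, Int.cast_sub, Int.cast_one, sub_add_cancel, mul_neg,
      inv_mul_cancel₀ (mul_ne_zero hx h2)]
  · rw [if_neg h1, if_neg h1, zero_mul]

lemma hd_ne_one {r : ℕ} {t : ℕ → Bool} (ht : Ballot n t) (hr : r + 2 < n) (h : t r ≠ t (r + 1))
    (h' : t (r + 2) = t (r + 1)) : hd r t ≠ 1 := by
  have h3 := ht (r + 2 + 1) hr
  rw [hd]
  cases h1 : t r <;> cases h2 : t (r + 1) <;> simp only [h1, h2, ne_eq, not_true] at h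
  · rw [h2] at h'
    simp only [cnt, ct, h1, h2, h'] at *
    simp at *
    omega
  · have := ht.ct_lt' (by omega) h1 h2; omega

lemma hd_ne_zero_of_sw {r : ℕ} {t : ℕ → Bool} (ht : Ballot n (sw (r + 1) (sw r t)))
    (hr : r + 2 < n) (h : t r ≠ t (r + 1)) (h' : t (r + 2) = t (r + 1)) : hd r t ≠ 0 := by
  have h4 : ∀ k < r, sw (r + 1) (sw r t) k = t k := fun k hk => by
    rw [sw_of_ne _ (by omega) (by omega), sw_of_ne _ (by omega) (by omega)]
  have h5 : sw (r + 1) (sw r t) r = t (r + 1) := by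
    rw [sw_of_ne _ (by omega) (by omega), sw_left]
  have h6 : sw (r + 1) (sw r t) (r + 1) = t (r + 2) := by
    rw [sw_left, sw_of_ne _ (by omega) (by omega)]
  have h3 := ht (r + 1 + 1) (by omega)
  have h7 := ht r (by omega)
  rw [hd]
  rw [cnt_congr h4] at h7
  rw [cnt, cnt, cnt_congr h4, h5, h6] at h3
  rw [ct, ct, cnt]
  rw [h'] at h3
  cases h1 : t r <;> cases h2 : t (r + 1) <;> simp only [h1, h2, ne_eq, not_true] at h
  · simp [h2] at *
    omega
  · simp at *
    omega

lemma psi_braid (hl : 3 ≤ l) (hx : x ≠ 0) {r : ℕ} (hr : r + 2 < n) (a b c : ZMod l) :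
    psi l n x r * psi l n x (r + 1) * psi l n x r *
      (pr l n r a * pr l n (r + 1) b * pr l n (r + 2) c) =
    (psi l n x (r + 1) * psi l n x r * psi l n x (r + 1) + (if c = a ∧ b = a + 1 then 1
      else if c = a ∧ b = a - 1 then -1 else 0)) *
      (pr l n r a * pr l n (r + 1) b * pr l n (r + 2) c) := by
  have : Fact (1 < l) := ⟨by omega⟩
  have h2 := two_ne l hl
  have h20 := two_ne_zero_mod l hl
  refine mul_pr_pr_pr l fun t ht ha hb hc => ?_
  rw [ctn_of_lt (by omega)] at ha hb hc
  simp only [LinearMap.add_apply, Module.End.mul_apply]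
  by_cases h1 : t r = t (r + 1)
  · by_cases h3 : t (r + 1) = t (r + 2)
    · have e1 := ct_succ_of_eq h1
      have e2 := ct_succ_of_eq (r := r + 1) h3
      have hca : c ≠ a := by
        rw [← hc, ← ha, e2, e1]
        push_cast
        intro h4
        exact h20 (by linear_combination -h4)
      rw [psi_vec_eq l x r hl h1, psi_vec_eq l x (r + 1) hl h3, if_neg (fun h => hca h.1),
        if_neg (fun h => hca h.1)]
      simp
    · obtain ⟨s, rfl⟩ : ∃ s, t = sw (r + 1) (sw r s) := ⟨sw r (sw (r + 1) t), by rw [sw_sw, sw_sw]⟩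
      have g1 : sw (r + 1) (sw r s) r = s (r + 1) := by
        rw [sw_of_ne _ (by omega) (by omega), sw_left]
      have g2 : sw (r + 1) (sw r s) (r + 1) = s (r + 2) := by
        rw [sw_left, sw_of_ne _ (by omega) (by omega)]
      have g3 : sw (r + 1) (sw r s) (r + 2) = s r := by rw [sw_right, sw_right]
      rw [g1, g2] at h1
      rw [g2, g3, ← h1, eq_comm] at h3
      have g4 : sw r s (r + 1) ≠ sw r s (r + 1 + 1) := by
        rw [sw_right, sw_of_ne _ (by omega) (by omega)]; rwa [h1] at h3
      rw [braid_left_two l x hl hr h3 h1.symm, braid_right_two l x hl hr h3 h1.symm]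
      rw [dl_mul_kp l hl hx (hd_ne_zero_of_sw ht hr h3 h1.symm)]
      have e1 := ct_succ_of_eq (r := r + 1) h1
      rw [ct_sw_of_ne _ (by omega) (by omega), ct_sw_left h3] at ha
      rw [ct_sw_left g4, ct_sw_of_ne _ (by omega) (by omega), e1] at hb
      rw [ct_sw_right g4, ct_sw_right h3] at hc
      have e : (hd r s : ZMod l) = 0 ↔ c = a := by
        rw [← hc, ← ha, hd, Int.cast_sub, sub_eq_zero, eq_comm]
      have hb' : b = a - 1 := by rw [← hb, ← ha]; push_cast; ring
      have hb2 : b ≠ a + 1 := by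
        rw [hb']; intro h4; exact h2 (by linear_combination -h4)
      by_cases hca : c = a
      · rw [if_pos (e.2 hca), if_neg (fun h => hb2 h.2), if_pos ⟨hca, hb'⟩]
        simp
      · rw [if_neg (fun h => hca (e.1 h)), if_neg (fun h => hb2 h.2), if_neg (fun h => hca h.1)]
        simp
  · by_cases h3 : t (r + 2) = t (r + 1)
    · rw [braid_left_zero l x hl hr h1 h3, braid_right_zero l x hl h3]
      rw [kp_mul_dl l hl hx (hd_ne_one ht hr h1 h3)]
      have e1 := ct_succ_of_eq (r := r + 1) h3.symm
      rw [e1] at hc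
      have e : (hd r t : ZMod l) = 1 ↔ c = a := by
        rw [← hc, ← ha, hd]; push_cast
        constructor <;> intro h <;> linear_combination h
      have hb' : b = c + 1 := by rw [← hb, ← hc]; push_cast; ring
      by_cases hca : c = a
      · rw [if_pos (e.2 hca), if_pos ⟨hca, by rw [hb', hca]⟩]
        simp
      · rw [if_neg (fun h => hca (e.1 h)), if_neg (fun h => hca h.1), if_neg (fun h => hca h.1)]
        simp
    · have h4 : t r = t (r + 2) := by
        cases g1 : t r <;> cases g2 : t (r + 1) <;> cases g3 : t (r + 2) <;> simp_all
      obtain ⟨s, rfl⟩ : ∃ s, t = sw r s := ⟨sw r t, by rw [sw_sw]⟩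
      rw [sw_left, sw_right, eq_comm] at h1
      rw [sw_left, sw_of_ne _ (by omega) (by omega)] at h4
      rw [braid_left_one l x hl hr h1 h4.symm, braid_right_one l x hl hr h1 h4.symm]
      have hca : c ≠ a := by
        have e1 := ct_succ_of_eq (r := r + 1) h4
        rw [← hc, ← ha, ct_sw_left h1, ct_sw_of_ne _ (by omega) (by omega), e1]
        push_cast
        intro h
        simp at h
      rw [if_neg (fun h => hca h.1), if_neg (fun h => hca h.1)]
      simp

lemma pr_eq_of_ge {j : ℕ} (hj : n ≤ j) (a : ZMod l) :
    pr (K := K) l n j a = if a = 0 then 1 else 0 := end_ext fun t _ => by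
  rw [pr_vec, ctn, if_neg (not_lt.2 hj), Int.cast_zero]
  by_cases h : a = 0
  · rw [if_pos h.symm, if_pos h, Module.End.one_apply]
  · rw [if_neg (Ne.symm h), if_neg h, LinearMap.zero_apply]

omit [CharZero K] in
lemma jm_eq_of_ge {j : ℕ} (hj : n ≤ j) : jm x n j = 0 := end_ext fun t _ => by
  rw [jm_vec, ctn, if_neg (not_lt.2 hj), Int.cast_zero, mul_zero, zero_smul, LinearMap.zero_apply]

omit [NeZero l] [CharZero K] in
lemma psi_eq_of_ge {j : ℕ} (hj : n ≤ j + 1) : psi l n x j = 0 := by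
  rw [psi, if_neg (by omega)]

lemma ctn_zero {t : ℕ → Bool} (ht : Ballot n t) : ctn n t 0 = 0 := by
  rw [ctn]
  split_ifs with h
  · exact ct_zero ht h
  · rfl

lemma bad_ctn (hl : 5 ≤ l) {t : ℕ → Bool} (ht : Ballot n t) (h1 : (ctn n t 1 : ZMod l) = 1) :
    (ctn n t 2 : ZMod l) ≠ 2 := by
  have : Fact (1 < l) := ⟨by omega⟩
  have h2 := two_ne l (by omega)
  by_cases hn : 2 < n
  · rw [ctn_of_lt (by omega)] at h1 ⊢
    have a1 := ht 1 (by omega)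
    have a2 := ht 2 (by omega)
    have a3 := ht 3 (by omega)
    have b0 : t 0 = false := by
      by_contra h
      rw [Bool.not_eq_false] at h
      simp [cnt, h] at a1
    have b1 : t 1 = true := by
      by_contra h
      rw [Bool.not_eq_true] at h
      rw [ct] at h1
      simp [cnt, h, b0] at h1
      exact h2 h1.symm
    have b2 : t 2 = false := by
      by_contra h
      rw [Bool.not_eq_false] at h
      simp [cnt, h, b0, b1] at a3
    rw [ct]
    simp [cnt, b0, b1, b2]
    intro h
    refine zmod_int_ne l (m := 3) (by norm_num) (by norm_num; omega) ?_
    push_cast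
    linear_combination -h
  · rw [ctn, if_neg hn, Int.cast_zero]
    exact (two_ne_zero_mod l (by omega)).symm

variable (n) in
/-- The seminormal form. -/
def data (hl : 5 ≤ l) (hx : x ≠ 0) : TLData l n K (Module.End K (Bal n →₀ K)) x where
  P := pr l n
  y := jm x n
  ψ := psi l n x
  P_comm i j a b := by rw [pr, pr, dg_mul, dg_mul, mul_comm]
  P_orth i a b h := end_ext fun t _ => by
    rw [Module.End.mul_apply, pr_vec, LinearMap.zero_apply]
    split_ifs with h1
    · rw [pr_vec, if_neg fun h2 => h (h2.symm.trans h1)]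
    · rw [map_zero]
  P_idem i a := end_ext fun t _ => by
    rw [Module.End.mul_apply, pr_vec]
    split_ifs with h1
    · rw [pr_vec, if_pos h1]
    · rw [map_zero]
  P_sum i := end_ext fun t _ => by
    rw [LinearMap.sum_apply, Module.End.one_apply, Finset.sum_eq_single (ctn n t i : ZMod l)]
    · rw [pr_vec, if_pos rfl]
    · intro b _ hb
      rw [pr_vec, if_neg hb.symm]
    · simp
  Py i j a := by rw [pr, jm, dg_mul, dg_mul, mul_comm]
  yy i j := by rw [jm, jm, dg_mul, dg_mul, mul_comm]
  ψP1 r a := psi_mul_dg l x (by omega) _ _ _ fun hr t ht h => by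
    refine ⟨by rw [ctn_sw_right hr h], fun h1 => ?_⟩
    rw [ctn_eq_of_dl l x hr h1]
  ψP2 r a := psi_mul_dg l x (by omega) _ _ _ fun hr t ht h => by
    refine ⟨by rw [ctn_sw_left hr h], fun h1 => ?_⟩
    rw [ctn_eq_of_dl l x hr h1]
  ψP r j a h1 h2 := psi_mul_dg l x (by omega) _ _ _ fun hr t ht h =>
    ⟨by rw [ctn_sw_of_ne _ h1 h2], fun _ => rfl⟩
  ψy r j h1 h2 := psi_mul_dg l x (by omega) _ _ _ fun hr t ht h =>
    ⟨by rw [ctn_sw_of_ne _ h1 h2], fun _ => rfl⟩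
  ψψ r s h := psi_comm l x (by omega) h
  ψy1 r hr := psi_jm l (by omega) hx hr
  yψ1 r hr := jm_psi l (by omega) hx hr
  psisq r a b hr := psi_psi l (by omega) hr a b
  braid r a b c hr := psi_braid l (by omega) hx hr a b c
  P_zero a ha := end_ext fun t ht => by
    rw [pr_vec, ctn_zero ht, Int.cast_zero, if_neg ha.symm, LinearMap.zero_apply]
  y_zero := end_ext fun t ht => by
    rw [jm_vec, ctn_zero ht, Int.cast_zero, mul_zero, zero_smul, LinearMap.zero_apply]
  bad := end_ext fun t ht => by
    rw [Module.End.mul_apply, Module.End.mul_apply, pr_vec, LinearMap.zero_apply]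
    split_ifs with h1
    · rw [pr_vec, if_neg fun h2 => bad_ctn l hl ht h2 h1, map_zero]
    · rw [map_zero, map_zero]

end Model

namespace Model

variable {l n : ℕ} [NeZero l] {K : Type*} [Field K] {x : K}

/-- The matrix units. -/
def un (s t : Bal n) : Module.End K (Bal n →₀ K) := Finsupp.lsingle s ∘ₗ Finsupp.lapply t

lemma vec_coe (t : Bal n) : vec n t.1 = Finsupp.single t (1 : K) := by rw [vec, dif_pos t.2]

lemma un_apply (s t : Bal n) (v : Bal n →₀ K) : un s t v = v t • vec n s.1 := by
  rw [vec_coe, Finsupp.smul_single_one]; rfl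

lemma un_mul (s t u : Bal n) : un s t * un t u = un (K := K) s u :=
  LinearMap.ext fun v => by
    rw [Module.End.mul_apply, un_apply, un_apply, un_apply, vec_coe t, Finsupp.smul_apply,
      Finsupp.single_eq_same, smul_eq_mul, mul_one]

/-- Diagonal operators as an algebra homomorphism. -/
def dgHom (K : Type*) [Field K] (n : ℕ) : ((ℕ → Bool) → K) →ₐ[K] Module.End K (Bal n →₀ K) where
  toFun := dg n
  map_one' := end_ext fun t _ => by rw [dg_vec, Pi.one_apply, one_smul, Module.End.one_apply]
  map_mul' f g := (dg_mul f g).symm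
  map_zero' := end_ext fun t _ => by rw [dg_vec, Pi.zero_apply, zero_smul, LinearMap.zero_apply]
  map_add' f g := end_ext fun t _ => by
    rw [dg_vec, LinearMap.add_apply, dg_vec, dg_vec, Pi.add_apply, add_smul]
  commutes' r := end_ext fun t _ => by
    rw [dg_vec, Module.algebraMap_end_apply]; rfl

variable [CharZero K]

/-- A function of the contents which vanishes exactly at the ballot sequences other than `t`. -/
def lag (x : K) (n : ℕ) (t : ℕ → Bool) : (ℕ → Bool) → K :=
  ∏ j ∈ Finset.range n, ∏ c ∈ (Finset.Icc (-n : ℤ) 1).erase (ct t j),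
    ((fun u => x * ctn n u j) - algebraMap K _ (x * c))

omit [CharZero K] in
lemma lag_apply (t u : ℕ → Bool) : lag x n t u = ∏ j ∈ Finset.range n,
    ∏ c ∈ (Finset.Icc (-n : ℤ) 1).erase (ct t j), (x * ctn n u j - x * c) := by
  simp [lag, Finset.prod_apply]

lemma lag_self (hx : x ≠ 0) (t : ℕ → Bool) : lag x n t t ≠ 0 := by
  rw [lag_apply]
  refine Finset.prod_ne_zero_iff.2 fun j hj => Finset.prod_ne_zero_iff.2 fun c hc => ?_
  rw [ctn_of_lt (Finset.mem_range.1 hj), ← mul_sub]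
  refine mul_ne_zero hx (sub_ne_zero.2 ?_)
  exact_mod_cast (Finset.ne_of_mem_erase hc).symm

lemma cnt_le (t : ℕ → Bool) (k : ℕ) : cnt t k ≤ k := by
  induction k with
  | zero => rfl
  | succ k ih => rw [cnt]; split_ifs <;> omega

omit [CharZero K] in
lemma lag_of_ne {t u : ℕ → Bool} (ht : Ballot n t) (hu : Ballot n u) (h : ∃ j < n, t j ≠ u j) :
    lag x n t u = 0 := by
  rw [lag_apply]
  by_contra h0
  obtain ⟨j, hj, hne⟩ := h
  refine hne (ht.eq_of_ct hu (fun i hi => ?_) j hj)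
  by_contra h1
  refine Finset.prod_ne_zero_iff.1 (Finset.prod_ne_zero_iff.1 h0 i (Finset.mem_range.2 hi)) (ct u i)
    (Finset.mem_erase.2 ⟨Ne.symm h1, Finset.mem_Icc.2 ?_⟩) (by rw [ctn_of_lt hi, sub_self])
  have := cnt_le u i
  rw [ct]
  split_ifs <;> omega

variable (hl : 5 ≤ l) (hx : x ≠ 0)

lemma un_self_mem (t : Bal n) : un t t ∈ (data l n hl hx).Alg n := by
  have h1 : lag x n t.1 ∈ ((data l n hl hx).Alg n).comap (dgHom K n) := by
    refine prod_mem fun j hj => prod_mem fun c _ => sub_mem ?_ (Subalgebra.algebraMap_mem _ _)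
    exact (data l n hl hx).y_mem (Finset.mem_range.1 hj)
  have h1 : dg n (lag x n t.1) ∈ (data l n hl hx).Alg n := h1
  have h2 : dg n (lag x n t.1) = lag x n t.1 t.1 • un t t := end_ext fun u hu => by
    rw [dg_vec, LinearMap.smul_apply, un_apply]
    by_cases h : ∀ k, n ≤ k → u k = false
    · obtain ⟨v, rfl⟩ : ∃ v : Bal n, v.1 = u := ⟨⟨u, hu, h⟩, rfl⟩
      by_cases e : v = t
      · subst e
        rw [vec_coe, Finsupp.single_eq_same, one_smul]
      · rw [lag_of_ne t.2.1 v.2.1, vec_coe, Finsupp.single_eq_of_ne (Ne.symm e), zero_smul,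
          zero_smul, smul_zero]
        by_contra! h'
        refine e (Subtype.ext (funext fun k => ?_))
        by_cases hk : k < n
        · exact (h' k hk).symm
        · rw [v.2.2 k (by omega), t.2.2 k (by omega)]
    · rw [vec, dif_neg (fun h' => h h'.2), smul_zero, Finsupp.zero_apply, zero_smul, smul_zero]
  have h3 := Subalgebra.smul_mem _ h1 (lag x n t.1 t.1)⁻¹
  rwa [h2, smul_smul, inv_mul_cancel₀ (lag_self hx t.1), one_smul] at h3

omit [NeZero l] in
lemma kp_ne_zero (hx : x ≠ 0) {h : ℤ} (h0 : h ≠ 0) (h1 : h ≠ 1) (h2 : h ≠ -1) :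
    kp l x h ≠ 0 := by
  have e0 : (h : K) ≠ 0 := by exact_mod_cast h0
  have e1 : (h : K) - 1 ≠ 0 := by rw [sub_ne_zero]; exact_mod_cast h1
  have e2 : (h : K) + 1 ≠ 0 := by
    intro h3; exact h2 (by exact_mod_cast eq_neg_of_add_eq_zero_left h3)
  rw [kp]
  split_ifs
  · exact neg_ne_zero.2 (mul_ne_zero (inv_ne_zero (mul_ne_zero hx e0)) (inv_ne_zero (mul_ne_zero hx e0)))
  · exact mul_ne_zero hx e1
  · exact neg_ne_zero.2 (mul_ne_zero hx e2)
  · exact one_ne_zero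

lemma un_sw_mem {s t : Bal n} {r : ℕ} (hr : r + 1 < n) (h : t.1 r ≠ t.1 (r + 1))
    (hs : s.1 = sw r t.1) : un s t ∈ (data l n hl hx).Alg n := by
  have h1 := mul_mem (mul_mem (un_self_mem hl hx s) ((data l n hl hx).ψ_mem hr))
    (un_self_mem hl hx t)
  have hst : t ≠ s := fun e => h (by rw [← sw_right r t.1, ← hs, ← e])
  have h2 : un s s * psi l n x r * un t t =
      od l x (t.1 (r + 1)) (hd r t.1) • un s t := LinearMap.ext fun v => by
    rw [Module.End.mul_apply, Module.End.mul_apply, LinearMap.smul_apply, un_apply t t, map_smul,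
      psi_vec_ne l x (by omega) hr h, map_smul, map_add, map_smul, map_smul, ← hs, un_apply s s,
      un_apply s s, un_apply s t, vec_coe t, vec_coe s, Finsupp.single_eq_same,
      Finsupp.single_eq_of_ne (Ne.symm hst)]
    module
  have h3 : od l x (t.1 (r + 1)) (hd r t.1) ≠ 0 := by
    rw [od]
    split_ifs with h4
    · exact one_ne_zero
    · have h5 : t.1 r = true := by
        rw [Bool.not_eq_true] at h4
        rw [h4] at h
        simpa using h
      have := t.2.1.ct_lt' hr h5 (by simpa using h4)
      refine kp_ne_zero hx ?_ ?_ ?_ <;> rw [hd] <;> omega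
  have h4 := Subalgebra.smul_mem _ h1 (od l x (t.1 (r + 1)) (hd r t.1))⁻¹
  change _ • (un s s * psi l n x r * un t t) ∈ _ at h4
  rwa [h2, smul_smul, inv_mul_cancel₀ h3, one_smul] at h4

/-- Both matrix units connecting `s` and `t` lie in the algebra. -/
def Conn (s t : Bal n) : Prop :=
  un s t ∈ (data l n hl hx).Alg n ∧ un t s ∈ (data l n hl hx).Alg n

variable {hl hx}

lemma Conn.symm {s t : Bal n} (h : Conn hl hx s t) : Conn hl hx t s := ⟨h.2, h.1⟩

lemma Conn.trans {s t u : Bal n} (h : Conn hl hx s t) (h' : Conn hl hx t u) : Conn hl hx s u :=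
  ⟨un_mul (K := K) s t u ▸ mul_mem h.1 h'.1, un_mul (K := K) u t s ▸ mul_mem h'.2 h.2⟩

lemma conn_sw {s t : Bal n} {r : ℕ} (hr : r + 1 < n) (h : t.1 r ≠ t.1 (r + 1))
    (hs : s.1 = sw r t.1) : Conn hl hx s t :=
  ⟨un_sw_mem hl hx hr h hs, un_sw_mem hl hx hr (by rwa [hs, sw_left, sw_right, ne_comm])
    (by rw [hs, sw_sw])⟩

lemma cnt_add_of {t u : ℕ → Bool} {N : ℕ} (h : ∀ k, N ≤ k → t k = u k) (hc : cnt t N = cnt u N)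
    {k : ℕ} (hk : N ≤ k) : cnt t k = cnt u k := by
  induction k, hk using Nat.le_induction with
  | base => exact hc
  | succ k hk ih => rw [cnt, cnt, ih, h k hk]

lemma conn_of_cnt (N : ℕ) (hN : N ≤ n) : ∀ t t' : Bal n, (∀ k, N ≤ k → t.1 k = t'.1 k) →
    cnt t.1 N = cnt t'.1 N → Conn hl hx t t' := by
  induction N with
  | zero =>
    intro t t' h _
    obtain rfl : t = t' := Subtype.ext (funext fun k => h k (Nat.zero_le k))
    exact ⟨un_self_mem hl hx t, un_self_mem hl hx t⟩
  | succ N ih =>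
    have key : ∀ t t' : Bal n, (∀ k, N + 1 ≤ k → t.1 k = t'.1 k) →
        cnt t.1 (N + 1) = cnt t'.1 (N + 1) → t.1 N = false → t'.1 N = true →
        Conn hl hx t t' := by
      intro t t' h hc h1 h2
      rw [cnt, cnt, h1, h2] at hc
      simp only [Bool.false_eq_true, if_false, if_true, add_zero] at hc
      have hb := t.2.1 N (by omega)
      obtain ⟨M, rfl⟩ : ∃ M, N = M + 1 := ⟨N - 1, by omega⟩
      set u : ℕ → Bool := fun k => if k < M + 1 then decide (M + 1 - cnt t.1 (M + 1) ≤ k) else t.1 k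
        with hu
      have hu1 : ∀ k, k < M + 1 → u k = decide (M + 1 - cnt t.1 (M + 1) ≤ k) := fun k hk => if_pos hk
      have hu2 : ∀ k, M + 1 ≤ k → t.1 k = u k := fun k hk => (if_neg (by omega)).symm
      have hu3 : ∀ k ≤ M + 1, cnt u k = k - (M + 1 - cnt t.1 (M + 1)) := by
        intro k
        induction k with
        | zero => intro _; simp [cnt]
        | succ k ihk =>
          intro hk
          rw [cnt, ihk (by omega), hu1 k (by omega)]
          simp only [decide_eq_true_eq]
          split_ifs <;> omega
      have hu4 : cnt t.1 (M + 1) = cnt u (M + 1) := by rw [hu3 _ le_rfl]; omega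
      have hub : Ballot n u := fun k hk => by
        by_cases hk' : k ≤ M + 1
        · rw [hu3 k hk']; omega
        · rw [← cnt_add_of hu2 hu4 (by omega : M + 1 ≤ k)]; exact t.2.1 k hk
      let U : Bal n := ⟨u, hub, fun k hk => by rw [← hu2 k (by omega)]; exact t.2.2 k hk⟩
      have hM : u M = true := by rw [hu1 M (by omega)]; simp; omega
      have hM' : u (M + 1) = false := by rw [← hu2 _ le_rfl, h1]
      let U' : Bal n := ⟨sw M u, hub.sw (by omega) hM', fun k hk => by
        rw [sw_of_ne _ (by omega) (by omega)]; exact U.2.2 k hk⟩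
      refine (ih (by omega) t U hu2 hu4).trans ((conn_sw (s := U') (t := U) (r := M) (by omega)
        ?_ rfl).symm.trans (ih (by omega) U' t' ?_ ?_))
      · change u M ≠ u (M + 1)
        rw [hM, hM']; simp
      · intro k hk
        change sw M u k = _
        by_cases hk' : k = M + 1
        · rw [hk', sw_right, hM, h2]
        · rw [sw_of_ne _ (by omega) hk', ← hu2 k hk, h k (by omega)]
      · change cnt (sw M u) (M + 1) = _
        rw [cnt_sw_succ, hM', hu3 M (by omega)]
        simp
        omega
    intro t t' h hc
    cases h1 : t.1 N <;> cases h2 : t'.1 N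
    · refine ih (by omega) t t' (fun k hk => ?_) ?_
      · rcases Nat.eq_or_lt_of_le hk with e | e
        · rw [← e, h1, h2]
        · exact h k e
      · rw [cnt, cnt, h1, h2] at hc; omega
    · exact key t t' h hc h1 h2
    · exact (key t' t (fun k hk => (h k hk).symm) hc.symm h2 h1).symm
    · refine ih (by omega) t t' (fun k hk => ?_) ?_
      · rcases Nat.eq_or_lt_of_le hk with e | e
        · rw [← e, h1, h2]
        · exact h k e
      · rw [cnt, cnt, h1, h2] at hc; omega

lemma un_mem {t t' : Bal n} (h : cnt t.1 n = cnt t'.1 n) : un t t' ∈ (data l n hl hx).Alg n :=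
  (conn_of_cnt n le_rfl t t' (fun k hk => by rw [t.2.2 k hk, t'.2.2 k hk]) h).1

end Model

instance (n : ℕ) : Finite (TwoCol n) :=
  Finite.of_injective (fun b => (⟨b.1, by have := b.2; omega⟩ : Fin (n + 1))) fun a b h =>
    Subtype.ext (Fin.mk.inj h)

/-- Pairs of standard tableaux of the same two-column shape. -/
abbrev TPair (n : ℕ) := Σ lam : TwoCol n, StdT n lam × StdT n lam

lemma tab_injective {n : ℕ} : Function.Injective (tab (n := n)) := fun S T h => by
  ext ⟨k, hk⟩
  have := congrFun h k
  simpa [tab, hk] using this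

/-- The ballot sequence of a standard tableau. -/
def StdT.bal {n : ℕ} {lam : TwoCol n} (S : StdT n lam) : Bal n :=
  ⟨tab S.1, S.ballot, fun k hk => by simp [tab, hk]⟩

lemma tpair_ext {n : ℕ} {p p' : TPair n} (h : p.2.1.bal = p'.2.1.bal)
    (h' : p.2.2.bal = p'.2.2.bal) : p = p' := by
  obtain ⟨lam, s, t⟩ := p
  obtain ⟨mu, s', t'⟩ := p'
  have e : lam = mu := Subtype.ext <| by
    rw [← s.cnt_eq, ← s'.cnt_eq]
    exact congrArg (fun u : Bal n => cnt u.1 n) h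
  subst e
  have e1 : s = s' := Subtype.ext (tab_injective (congrArg Subtype.val h))
  have e2 : t = t' := Subtype.ext (tab_injective (congrArg Subtype.val h'))
  rw [e1, e2]

/-- The family of cellular basis elements. -/
def TLData.CF {l n : ℕ} [NeZero l] {R A : Type*} [CommRing R] [Ring A] [Algebra R A] {ξ : R}
    (D : TLData l n R A ξ) (p : TPair n) : A := D.C p.1 p.2.1 p.2.2

lemma TLData.Alg_le_span {l n : ℕ} [NeZero l] {R A : Type*} [CommRing R] [Ring A] [Algebra R A]
    {ξ : R} (D : TLData l n R A ξ) (hl : 5 ≤ l) (h2 : IsUnit (2 : R)) {x : A} (hx : x ∈ D.Alg n) :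
    x ∈ Submodule.span R (Set.range D.CF) := by
  refine Submodule.span_mono ?_ (D.mem_Cs_zero hl h2 hx)
  rintro _ ⟨lam, _, s, t, rfl⟩
  exact ⟨⟨lam, s, t⟩, rfl⟩

namespace Model

variable {l n : ℕ} [NeZero l] {K : Type*} [Field K] {x : K}

/-- The family of matrix units of pairs of tableaux of the same shape. -/
def unF (p : TPair n) : Module.End K (Bal n →₀ K) := un p.2.1.bal p.2.2.bal

lemma unF_linearIndependent : LinearIndependent K (unF (n := n) (K := K)) := by
  classical
  refine (linearIndependent_iff' (R := K) (M := (Bal n →₀ K) →ₗ[K] (Bal n →₀ K))).2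
    fun s g h p hp => ?_
  have h1 := congrArg (fun f : Module.End K (Bal n →₀ K) =>
    f (Finsupp.single p.2.2.bal 1) p.2.1.bal) h
  simp only [LinearMap.sum_apply, LinearMap.smul_apply, Finsupp.finsetSum_apply,
    LinearMap.zero_apply, Finsupp.zero_apply] at h1
  rw [Finset.sum_eq_single_of_mem p hp] at h1
  · simpa [unF, un_apply, vec_coe] using h1
  · intro q _ hq
    rw [unF, un_apply, vec_coe, Finsupp.smul_apply, Finsupp.smul_apply, Finsupp.single_apply,
      Finsupp.single_apply]
    split_ifs with e1 e2
    · exact absurd (tpair_ext e2 e1.symm) hq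
    all_goals simp

variable [CharZero K] (hl : 5 ≤ l) (hx : x ≠ 0)

lemma CF_linearIndependent : LinearIndependent K (data l n hl hx).CF := by
  have : Fintype (TPair n) := Fintype.ofFinite _
  rw [linearIndependent_iff_card_le_finrank_span, ← finrank_span_eq_card
    (unF_linearIndependent (n := n) (K := K))]
  have : Module.Finite K (Submodule.span K (Set.range (data l n hl hx).CF)) :=
    Module.Finite.span_of_finite K (Set.finite_range _)
  refine Submodule.finrank_mono (Submodule.span_le.2 ?_)
  rintro _ ⟨p, rfl⟩
  refine (data l n hl hx).Alg_le_span hl (IsUnit.mk0 _ two_ne_zero) (un_mem ?_)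
  exact p.2.1.cnt_eq.trans p.2.2.cnt_eq.symm

end Model

namespace TLData

variable {l n : ℕ} [NeZero l] {R A : Type*} [CommRing R] [Ring A] [Algebra R A] {ξ : R}
  (D : TLData l n R A ξ)

/-- Transport along a ring homomorphism, possibly changing the base ring. -/
def map {R' A' : Type*} [CommRing R'] [Ring A'] [Algebra R' A'] {ξ' : R'} (f : A →+* A')
    (hf : f (algebraMap R A ξ) = algebraMap R' A' ξ') : TLData l n R' A' ξ' where
  P j a := f (D.P j a)
  y j := f (D.y j)
  ψ j := f (D.ψ j)
  P_comm i j a b := by simp only [← map_mul, D.P_comm i j a b]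
  P_orth i a b h := by rw [← map_mul, D.P_orth i a b h, map_zero]
  P_idem i a := by rw [← map_mul, D.P_idem]
  P_sum i := by rw [← map_sum, D.P_sum, map_one]
  Py i j a := by simp only [← map_mul, D.Py i j a]
  yy i j := by simp only [← map_mul, D.yy i j]
  ψP1 r a := by simp only [← map_mul, D.ψP1 r a]
  ψP2 r a := by simp only [← map_mul, D.ψP2 r a]
  ψP r j a h h' := by simp only [← map_mul, D.ψP r j a h h']
  ψy r j h h' := by simp only [← map_mul, D.ψy r j h h']
  ψψ r s h := by simp only [← map_mul, D.ψψ r s h]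
  ψy1 r hr := by simp only [← map_mul, ← map_sum, ← map_add, D.ψy1 r hr]
  yψ1 r hr := by simp only [← map_mul, ← map_sum, ← map_add, D.yψ1 r hr]
  psisq r a b hr := by
    rw [← hf, ← map_mul, ← map_mul, ← map_mul, D.psisq r a b hr, map_mul]
    split_ifs <;> simp only [map_zero, map_one, map_sub]
  braid r a b c hr := by
    simp only [← map_mul]
    rw [D.braid r a b c hr, map_mul, map_add]
    split_ifs <;> simp only [map_zero, map_one, map_neg]
  P_zero a h := by rw [D.P_zero a h, map_zero]
  y_zero := by rw [D.y_zero, map_zero]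
  bad := by rw [← map_mul, ← map_mul, D.bad, map_zero]

lemma map_compat {R' A' : Type*} [CommRing R'] [Ring A'] [Algebra R' A'] {ξ' : R'} (f : A →+* A')
    (hf : f (algebraMap R A ξ) = algebraMap R' A' ξ') : Compat D (D.map f hf) f :=
  ⟨fun _ _ _ => rfl, fun _ _ => rfl⟩

section Restrict

variable (hP : ∀ j a, D.P j a ∈ D.Alg n) (hy : ∀ j, D.y j ∈ D.Alg n) (hψ : ∀ j, D.ψ j ∈ D.Alg n)

/-- Restriction to the subalgebra generated by the generators. -/
def restrict : TLData l n R (D.Alg n) ξ where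
  P j a := ⟨D.P j a, hP j a⟩
  y j := ⟨D.y j, hy j⟩
  ψ j := ⟨D.ψ j, hψ j⟩
  P_comm i j a b := Subtype.ext (D.P_comm i j a b)
  P_orth i a b h := Subtype.ext (D.P_orth i a b h)
  P_idem i a := Subtype.ext (D.P_idem i a)
  P_sum i := Subtype.ext (by simpa using D.P_sum i)
  Py i j a := Subtype.ext (D.Py i j a)
  yy i j := Subtype.ext (D.yy i j)
  ψP1 r a := Subtype.ext (D.ψP1 r a)
  ψP2 r a := Subtype.ext (D.ψP2 r a)
  ψP r j a h h' := Subtype.ext (D.ψP r j a h h')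
  ψy r j h h' := Subtype.ext (D.ψy r j h h')
  ψψ r s h := Subtype.ext (D.ψψ r s h)
  ψy1 r hr := Subtype.ext (by simpa using D.ψy1 r hr)
  yψ1 r hr := Subtype.ext (by simpa using D.yψ1 r hr)
  psisq r a b hr := Subtype.ext <| (D.psisq r a b hr).trans <| by
    split_ifs <;> rfl
  braid r a b c hr := Subtype.ext <| (D.braid r a b c hr).trans <| by
    split_ifs <;> rfl
  P_zero a h := Subtype.ext (D.P_zero a h)
  y_zero := Subtype.ext D.y_zero
  bad := Subtype.ext D.bad

lemma restrict_compat :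
    Compat (D.restrict hP hy hψ) D ((D.Alg n).val : D.Alg n →+* A) :=
  ⟨fun _ _ _ => rfl, fun _ _ => rfl⟩

lemma restrict_Alg : (D.restrict hP hy hψ).Alg n = ⊤ := by
  have h : D.Alg n ≤ ((D.restrict hP hy hψ).Alg n).map (D.Alg n).val := by
    refine Algebra.adjoin_le ?_
    rintro _ ((⟨j, a, hj, rfl⟩ | ⟨j, hj, rfl⟩) | ⟨j, hj, rfl⟩)
    · exact ⟨_, (D.restrict hP hy hψ).P_mem hj a, rfl⟩
    · exact ⟨_, (D.restrict hP hy hψ).y_mem hj, rfl⟩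
    · exact ⟨_, (D.restrict hP hy hψ).ψ_mem hj, rfl⟩
  refine eq_top_iff.2 fun z _ => ?_
  obtain ⟨w, hw, e⟩ := h z.2
  obtain rfl : w = z := Subtype.ext e
  exact hw

lemma restrict_linearIndependent (h : LinearIndependent R D.CF) :
    LinearIndependent R (D.restrict hP hy hψ).CF := by
  have e : (D.Alg n).val.toLinearMap ∘ (D.restrict hP hy hψ).CF = D.CF := funext fun p =>
    (D.restrict_compat hP hy hψ).C p.1 p.2.1 p.2.2
  refine LinearIndependent.of_comp (D.Alg n).val.toLinearMap ?_
  rw [e]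
  exact h

end Restrict

end TLData

section Specialization

open Polynomial

variable {l n : ℕ} [NeZero l]

/-- Independence of the cellular basis elements can be checked over a deformation. -/
lemma tl_linearIndependent_of_deformation (hl : 5 ≤ l) (hn : 3 ≤ n) {S : Type*} [Ring S]
    [Algebra ℂ[X] S] (D : TLData l n ℂ[X] S X) (hD : D.Alg n = ⊤)
    (hC : LinearIndependent ℂ[X] D.CF) : LinearIndependent ℂ (tlData l n hn).CF := by
  letI : Algebra ℂ S := Algebra.compHom S (C : ℂ →+* ℂ[X])
  have : Fintype (TPair n) := Fintype.ofFinite _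
  let I : Ideal S := Ideal.span {algebraMap ℂ[X] S X}
  have hI : I.IsTwoSided := ⟨fun {a} b ha => by
    obtain ⟨c, rfl⟩ := Ideal.mem_span_singleton'.1 ha
    rw [mul_assoc, Algebra.commutes, ← mul_assoc]
    exact Ideal.mem_span_singleton'.2 ⟨_, rfl⟩⟩
  let f : S →+* S ⧸ I := Ideal.Quotient.mk I
  have hf : f (algebraMap ℂ[X] S X) = algebraMap ℂ (S ⧸ I) 0 := by
    rw [map_zero]
    exact Ideal.Quotient.eq_zero_iff_mem.2 (Ideal.mem_span_singleton_self _)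
  let D' : TLData l n ℂ (S ⧸ I) 0 := D.map f hf
  have e1 : ∀ p, tlLift hn D' ((tlData l n hn).CF p) = f (D.CF p) := fun p =>
    ((tlLift_compat hn D').C p.1 p.2.1 p.2.2).trans ((D.map_compat f hf).C p.1 p.2.1 p.2.2).symm
  rw [Fintype.linearIndependent_iff] at hC
  refine (Fintype.linearIndependent_iff (R := ℂ) (M := TL l n hn)).2 fun g hg p => ?_
  have h1 := congrArg (tlLift hn D') hg
  have h2 : f (∑ i, C (g i) • D.CF i) = 0 := by
    rw [map_zero, map_sum] at h1
    rw [map_sum, ← h1]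
    refine Finset.sum_congr rfl fun i _ => ?_
    rw [map_smul (tlLift hn D'), e1, Algebra.smul_def, Algebra.smul_def, map_mul]
    rfl
  obtain ⟨z, hz⟩ := Ideal.mem_span_singleton'.1 (Ideal.Quotient.eq_zero_iff_mem.1 h2)
  have h3 : z ∈ D.Alg n := by rw [hD]; trivial
  have hu : IsUnit (2 : ℂ[X]) := by
    have := (IsUnit.mk0 (2 : ℂ) two_ne_zero).map (C : ℂ →+* ℂ[X])
    rwa [map_ofNat] at this
  obtain ⟨b, rfl⟩ := (Submodule.mem_span_range_iff_exists_fun _).1 (D.Alg_le_span hl hu h3)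
  have h4 := hC (fun i => C (g i) - X * b i) (by
    simp only [sub_smul, Finset.sum_sub_distrib]
    rw [← hz, ← Algebra.commutes, ← Algebra.smul_def, Finset.smul_sum, sub_eq_zero]
    refine Finset.sum_congr rfl fun i _ => ?_
    rw [smul_smul]) p
  simpa using congrArg (eval 0) h4

lemma tl_linearIndependent_of_generated (hl : 5 ≤ l) (hn : 3 ≤ n) {S : Type*} [Ring S]
    [Algebra ℂ[X] S] (D : TLData l n ℂ[X] S X) (hP : ∀ j a, D.P j a ∈ D.Alg n)
    (hy : ∀ j, D.y j ∈ D.Alg n) (hψ : ∀ j, D.ψ j ∈ D.Alg n)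
    (hC : LinearIndependent ℂ[X] D.CF) : LinearIndependent ℂ (tlData l n hn).CF :=
  tl_linearIndependent_of_deformation hl hn (D.restrict hP hy hψ) (D.restrict_Alg hP hy hψ)
    (D.restrict_linearIndependent hP hy hψ hC)

lemma tl_linearIndependent (hl : 5 ≤ l) (hn : 3 ≤ n) :
    LinearIndependent ℂ (tlData l n hn).CF := by
  let K := FractionRing ℂ[X]
  have hx : algebraMap ℂ[X] K X ≠ 0 := by
    rw [Ne, IsFractionRing.to_map_eq_zero_iff]
    exact X_ne_zero
  let D₀ := Model.data l n hl hx
  let D : TLData l n ℂ[X] (Module.End K (Bal n →₀ K)) X := D₀.map (RingHom.id _)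
    (IsScalarTower.algebraMap_apply ℂ[X] K (Module.End K (Bal n →₀ K)) X).symm
  have hP : ∀ j a, D.P j a ∈ D.Alg n := fun j a => by
    by_cases hj : j < n
    · exact D.P_mem hj a
    · have e : D.P j a = if a = 0 then 1 else 0 := Model.pr_eq_of_ge l (not_lt.1 hj) a
      rw [e]
      split_ifs
      · exact one_mem _
      · exact zero_mem _
  have hy : ∀ j, D.y j ∈ D.Alg n := fun j => by
    by_cases hj : j < n
    · exact D.y_mem hj
    · have e : D.y j = 0 := Model.jm_eq_of_ge (not_lt.1 hj)
      rw [e]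
      exact zero_mem _
  have hψ : ∀ j, D.ψ j ∈ D.Alg n := fun j => by
    by_cases hj : j + 1 < n
    · exact D.ψ_mem hj
    · have e : D.ψ j = 0 := Model.psi_eq_of_ge l (not_lt.1 hj)
      rw [e]
      exact zero_mem _
  have h1 : LinearIndependent K D₀.CF := Model.CF_linearIndependent hl hx
  have h2 : LinearIndependent ℂ[X] D₀.CF := h1.restrict_scalars fun a b h => by
    simpa [Algebra.smul_def] using h
  have e1 : D₀.CF = D.CF := funext fun p =>
    (D₀.map_compat (RingHom.id _) _).C p.1 p.2.1 p.2.2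
  exact tl_linearIndependent_of_generated hl hn D hP hy hψ (e1 ▸ h2)

end Specialization

/-- The quotient `TL_n` of the level-one cyclotomic KLR algebra by the
two-sided ideal generated by the idempotents `e(i)` with `(i₁,i₂,i₃) ≡ (0,1,2) (mod l)`
(isomorphic to the Temperley–Lieb algebra `Tl_n(q)`), with its induced `ℤ`-grading, is a
graded cellular algebra with respect to the poset of two-column partitions of `n` under
dominance, with index sets the standard tableaux. -/
theorem statement2 (l : ℕ) [NeZero l] (hl : 5 ≤ l) (hodd : Odd l)
    (q : ℂ) (hq : IsPrimitiveRoot q l) (n : ℕ) (hn : 3 ≤ n) :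
    ∃ 𝒜 : ℤ → Submodule ℂ (BQuot l n (Lam1 l) (badSet1 l n hn)),
      Nonempty (GradedAlgebra 𝒜) ∧
      -- the grading is the one induced from the KLR grading
      (∀ i : Res l n, bmk l n (Lam1 l) (badSet1 l n hn) (eG l n i) ∈ 𝒜 0) ∧
      (∀ r : Fin n, bmk l n (Lam1 l) (badSet1 l n hn) (yG l n r) ∈ 𝒜 2) ∧
      (∀ (r : Fin (n - 1)) (i : Res l n),
        bmk l n (Lam1 l) (badSet1 l n hn) (pG l n r * eG l n i) ∈
          𝒜 (-(cartan l (i (lo r)) (i (hi r))))) ∧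
      -- a graded cellular basis
      ∃ (c : (lam : TwoCol n) → StdT n lam → StdT n lam → BQuot l n (Lam1 l) (badSet1 l n hn))
        (dg : (lam : TwoCol n) → StdT n lam → ℤ),
        (∀ (lam : TwoCol n) (s t : StdT n lam), c lam s t ∈ 𝒜 (dg lam s + dg lam t)) ∧
        LinearIndependent ℂ
          (fun p : Σ lam : TwoCol n, StdT n lam × StdT n lam => c p.1 p.2.1 p.2.2) ∧
        Submodule.span ℂ
          (Set.range
            (fun p : Σ lam : TwoCol n, StdT n lam × StdT n lam => c p.1 p.2.1 p.2.2)) = ⊤ ∧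
        (∃ σ : BQuot l n (Lam1 l) (badSet1 l n hn) ≃ₗ[ℂ] BQuot l n (Lam1 l) (badSet1 l n hn),
          (∀ x y, σ (x * y) = σ y * σ x) ∧
          ∀ (lam : TwoCol n) (s t : StdT n lam), σ (c lam s t) = c lam t s) ∧
        (∀ (a : BQuot l n (Lam1 l) (badSet1 l n hn)) (lam : TwoCol n) (s : StdT n lam),
          ∃ r : StdT n lam → ℂ, ∀ t : StdT n lam,
            a * c lam s t - ∑ u : StdT n lam, r u • c lam u t ∈
              Submodule.span ℂ
                {x | ∃ (mu : TwoCol n) (_ : tcDom n mu lam ∧ mu ≠ lam)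
                    (u v : StdT n mu), x = c mu u v}) := by
  have hl2 : 2 ≤ l := by omega
  have hu : IsUnit (2 : ℂ) := IsUnit.mk0 _ two_ne_zero
  have htop : ∀ x : TL l n hn, x ∈ (tlData l n hn).Alg n := fun x => by
    rw [tlAlg_eq_top]
    trivial
  refine ⟨tlDeg hl2 hn, ⟨tlGraded hl2 hn⟩, eB_mem_tlDeg hl2 hn, yB_mem_tlDeg hl2 hn, fun r i => ?_,
    fun lam s t => (tlData l n hn).C lam s t, fun lam s => TLData.wDeg (tab s.1) n (resIni l lam.1),
    fun lam s t => (tlDeg_homog hl2 hn).C_mem lam s t, tl_linearIndependent hl hn,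
    eq_top_iff.2 fun x _ => (tlData l n hn).Alg_le_span hl hu (htop x),
    ⟨tlAntiEquiv hn, tlAnti_mul hn, tlAnti_C hn⟩, fun a lam s => ?_⟩
  · rw [map_mul]
    exact pB_mul_eB_mem_tlDeg hl2 hn r i
  · obtain ⟨r, hr⟩ := (tlData l n hn).mul_C hl hu lam s (htop a)
    refine ⟨r, fun t => Submodule.span_mono ?_ (hr t)⟩
    rintro _ ⟨mu, hmu, u, v, rfl⟩
    refine ⟨mu, ⟨tcDom_of_le (by omega), ?_⟩, u, v, rfl⟩
    rintro rfl
    omega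

end Statement2
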